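/- arXiv:0710.2331 — 2 statements merged into one kernel-verified Lean document; each statement's English description precedes it below -/
import Mathlib

section
/- Suppose the real eigenvalue sequence E_1 < E_2 < ⋯ satisfies c_H·|m−n|/max{m,n}^{2γ} ≤ |E_m − E_n| ≤ C_H·|m−n|/max{m,n}^{2γ} for all m,n ≥ 1, for some γ ∈ (0,1/2) and 0 < c_H ≤ C_H. Let r > 2, i ≥ 1 an integer, T > 0. Let Y be a bounded self-adjoint diagonal operator with ‖Y‖_{∞,γ} < ∞ and Z(t) a T-periodic, strongly C¹ family of bounded self-adjoint operators with ‖Z‖_{r,iγ} < ∞, and assume ‖Y‖_{∞,γ} + ‖Z‖_{r,iγ} ≤ c_H/(4π·C_{r+1}). Then there exist: a T-periodic, strongly C¹ family 𝒰(t) of unitary operators; a bounded self-adjoint diagonal operator A with ‖A‖_{∞,γ} ≤ 2(‖Y‖_{∞,γ} + ‖Z‖_{r,iγ}); and a T-periodic, strongly C¹ family B(t) of bounded self-adjoint operators with ‖B‖_{r−1,(i+1)γ} ≤ (1/(2C_r))·exp(2C_r/C_{r+1})·(exp(4C_r·T·‖Z‖_{r,iγ}) − 1)·(C_H + 4‖Y‖_{∞,γ}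 + 2C_r‖Z‖_{r,iγ}); such that for every t, 𝒰(t)* maps Dom(H) onto Dom(H) and for every ψ ∈ Dom(H): (H+A+B(t))ψ = 𝒰(t)(H+Y+Z(t))𝒰(t)*ψ + i·𝒰̇(t)𝒰(t)*ψ, where 𝒰̇(t) denotes the strong derivative of 𝒰 at t. -/
noncomputable section

open ContinuousLinearMap

variable {𝓗 : Type*} [NormedAddCommGroup 𝓗] [InnerProductSpace ℂ 𝓗] [CompleteSpace 𝓗]

/-- `⟨x⟩ := max {1, |x|}`. -/
def jap (x : ℝ) : ℝ := max 1 |x|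

/-- `(Pₙ)_{n≥1}` is a family of mutually orthogonal nonzero orthogonal projections
with `Σₙ Pₙ = I` in the strong sense. -/
def ProjFamily (P : ℕ+ → 𝓗 →L[ℂ] 𝓗) : Prop :=
  (∀ n, IsSelfAdjoint (P n)) ∧ (∀ n, (P n).comp (P n) = P n) ∧
  (∀ m n, m ≠ n → (P m).comp (P n) = 0) ∧ (∀ n, P n ≠ 0) ∧
  (∀ ψ : 𝓗, HasSum (fun n => P n ψ) ψ)

/-- The quantity `⟨m-n⟩^p · max{m,n}^(2δ) · ‖Pₘ A Pₙ‖`; the norm `‖A‖_{p,δ}` is its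
supremum over `m, n ≥ 1`. -/
def wnorm (P : ℕ+ → 𝓗 →L[ℂ] 𝓗) (p δ : ℝ) (A : 𝓗 →L[ℂ] 𝓗) (m n : ℕ+) : ℝ :=
  jap (((m : ℕ) : ℝ) - ((n : ℕ) : ℝ)) ^ p * (((max m n : ℕ+) : ℕ) : ℝ) ^ (2 * δ) *
    ‖(P m).comp (A.comp (P n))‖

/-- `A` is diagonal with respect to the family `P`. -/
def IsDiag (P : ℕ+ → 𝓗 →L[ℂ] 𝓗) (A : 𝓗 →L[ℂ] 𝓗) : Prop :=
  ∀ m n, m ≠ n → (P m).comp (A.comp (P n)) = 0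

/-- `Dom(H) = {ψ : Σₙ Eₙ²‖Pₙψ‖² < ∞}`. -/
def HDom (P : ℕ+ → 𝓗 →L[ℂ] 𝓗) (E : ℕ+ → ℝ) : Set 𝓗 :=
  {ψ | Summable fun n => (E n) ^ 2 * ‖P n ψ‖ ^ 2}

/-- The form domain `Q_H = {ψ : Σₙ Eₙ‖Pₙψ‖² < ∞}`. -/
def QDom (P : ℕ+ → 𝓗 →L[ℂ] 𝓗) (E : ℕ+ → ℝ) : Set 𝓗 :=
  {ψ | Summable fun n => E n * ‖P n ψ‖ ^ 2}

/-- `h = Hψ`, i.e. `h = Σₙ Eₙ Pₙ ψ`. -/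
def IsHSum (P : ℕ+ → 𝓗 →L[ℂ] 𝓗) (E : ℕ+ → ℝ) (ψ h : 𝓗) : Prop :=
  HasSum (fun n => (E n : ℂ) • P n ψ) h

/-- `U` is unitary. -/
def IsUnitaryOp (U : 𝓗 →L[ℂ] 𝓗) : Prop := U * star U = 1 ∧ star U * U = 1

/-- A family of bounded operators which is `C¹` in the strong sense. -/
def StrongC1 (V : ℝ → 𝓗 →L[ℂ] 𝓗) : Prop := ∀ ψ : 𝓗, ContDiff ℝ 1 fun t => V t ψ

/-- `U(t,s)` is a propagator for `H + V(t)`. -/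
def IsPropagator (P : ℕ+ → 𝓗 →L[ℂ] 𝓗) (E : ℕ+ → ℝ) (V : ℝ → 𝓗 →L[ℂ] 𝓗)
    (U : ℝ → ℝ → 𝓗 →L[ℂ] 𝓗) : Prop :=
  (∀ t s, IsUnitaryOp (U t s)) ∧
  (∀ ψ : 𝓗, Continuous fun ts : ℝ × ℝ => U ts.1 ts.2 ψ) ∧
  (∀ t, U t t = 1) ∧
  (∀ t s r, (U t s).comp (U s r) = U t r) ∧
  (∀ t s, ⇑(U t s) '' HDom P E = HDom P E) ∧
  (∀ s : ℝ, ∀ ψ ∈ HDom P E, ∀ t : ℝ, ∃ d : 𝓗,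
    HasDerivAt (fun τ => U τ s ψ) d t ∧
    ∀ h : 𝓗, IsHSum P E (U t s ψ) h → Complex.I • d = h + V t (U t s ψ))

/-- The Riemann zeta function `ζ(s) = Σ_{n≥1} n^{-s}` (for real `s > 1`). -/
def rzeta (s : ℝ) : ℝ := ∑' n : ℕ+, (((n : ℕ) : ℝ) ^ s)⁻¹

/-- The constant `C_p = 2^(p+1) (1 + 2 ζ(p-1))`. -/
def Cconst (p : ℝ) : ℝ := 2 ^ (p + 1) * (1 + 2 * rzeta (p - 1))


set_option linter.unusedSectionVars false



def jd (m n : ℕ+) : ℝ := jap (((m : ℕ) : ℝ) - ((n : ℕ) : ℝ))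

def mxu (γ : ℝ) (m n : ℕ+) : ℝ := (((max m n : ℕ+) : ℕ) : ℝ) ^ (2 * γ)

def mnu (γ : ℝ) (m n : ℕ+) : ℝ := (((min m n : ℕ+) : ℕ) : ℝ) ^ (2 * γ)

lemma jd_ge (m n : ℕ+) : 1 ≤ jd m n := le_max_left _ _

lemma jd_pos (m n : ℕ+) : 0 < jd m n := lt_of_lt_of_le one_pos (jd_ge m n)

lemma jd_symm (m n : ℕ+) : jd m n = jd n m := by
  unfold jd jap; rw [abs_sub_comm]

lemma jd_tri (m n l : ℕ+) : jd m n ≤ jd m l + jd l n := by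
  unfold jd jap
  rcases max_cases (1:ℝ) |((m : ℕ) : ℝ) - ((n : ℕ) : ℝ)| with h | h
  · rw [h.1]; linarith [le_max_left (1:ℝ) |((m : ℕ) : ℝ) - ((l : ℕ) : ℝ)|,
      le_max_left (1:ℝ) |((l : ℕ) : ℝ) - ((n : ℕ) : ℝ)|]
  · rw [h.1]; linarith [le_max_right (1:ℝ) |((m : ℕ) : ℝ) - ((l : ℕ) : ℝ)|,
      le_max_right (1:ℝ) |((l : ℕ) : ℝ) - ((n : ℕ) : ℝ)|,
      abs_sub_le ((m : ℕ) : ℝ) ((l : ℕ) : ℝ) ((n : ℕ) : ℝ)]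

lemma abs_le_jd (m n : ℕ+) : |((m : ℕ) : ℝ) - ((n : ℕ) : ℝ)| ≤ jd m n := le_max_right _ _

lemma jd_eq_abs {m n : ℕ+} (h : m ≠ n) : |((m : ℕ) : ℝ) - ((n : ℕ) : ℝ)| = jd m n := by
  unfold jd jap
  rw [eq_comm, max_eq_right_iff]
  have h1 : ((m : ℕ) : ℤ) - ((n : ℕ) : ℤ) ≠ 0 := by
    intro h2
    apply h
    apply PNat.coe_injective
    omega
  have h3 := Int.one_le_abs h1
  exact_mod_cast h3

lemma jd_self (m : ℕ+) : jd m m = 1 := by simp [jd, jap]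

lemma cast_ge (m : ℕ+) : (1:ℝ) ≤ ((m : ℕ) : ℝ) := by exact_mod_cast m.2

lemma cast_max (m n : ℕ+) : (((max m n : ℕ+) : ℕ) : ℝ) = max ((m:ℕ):ℝ) ((n:ℕ):ℝ) := by
  rcases le_total m n with h | h
  · rw [max_eq_right h, max_eq_right]; exact_mod_cast h
  · rw [max_eq_left h, max_eq_left]; exact_mod_cast h

lemma cast_min (m n : ℕ+) : (((min m n : ℕ+) : ℕ) : ℝ) = min ((m:ℕ):ℝ) ((n:ℕ):ℝ) := by
  rcases le_total m n with h | h
  · rw [min_eq_left h, min_eq_left]; exact_mod_cast h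
  · rw [min_eq_right h, min_eq_right]; exact_mod_cast h

lemma mxu_ge {γ : ℝ} (hγ : 0 < γ) (m n : ℕ+) : 1 ≤ mxu γ m n :=
  Real.one_le_rpow (cast_ge _) (by linarith)

lemma mnu_ge {γ : ℝ} (hγ : 0 < γ) (m n : ℕ+) : 1 ≤ mnu γ m n :=
  Real.one_le_rpow (cast_ge _) (by linarith)

lemma mxu_symm (γ : ℝ) (m n : ℕ+) : mxu γ m n = mxu γ n m := by
  unfold mxu; rw [max_comm]

lemma mnu_symm (γ : ℝ) (m n : ℕ+) : mnu γ m n = mnu γ n m := by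
  unfold mnu; rw [min_comm]

lemma mxu_self (γ : ℝ) (m : ℕ+) : mxu γ m m = ((m:ℕ):ℝ) ^ (2*γ) := by
  unfold mxu; rw [max_self]

/-- the key ratio inequality -/
lemma mxu_le_two {γ : ℝ} (hγ : 0 < γ) (hγh : γ < 1/2) (m n l : ℕ+) :
    mxu γ m n ≤ 2 * jd m l * mxu γ l n := by
  unfold mxu
  rw [cast_max, cast_max]
  set a := max ((m:ℕ):ℝ) ((n:ℕ):ℝ)
  set b := max ((l:ℕ):ℝ) ((n:ℕ):ℝ) with hb
  have hb1 : 1 ≤ b := le_trans (cast_ge l) (le_max_left _ _)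
  have hj := jd_ge m l
  have hab : a ≤ 2 * jd m l * b := by
    have h1 : ((l:ℕ):ℝ) ≤ b := le_max_left _ _
    have h2 : ((n:ℕ):ℝ) ≤ b := le_max_right _ _
    have h3 := le_trans (le_abs_self _) (abs_le_jd m l)
    apply max_le
    · nlinarith
    · nlinarith
  have hx : (1:ℝ) ≤ 2 * jd m l := by linarith
  calc a ^ (2*γ) ≤ (2 * jd m l * b) ^ (2*γ) := by
        apply Real.rpow_le_rpow _ hab (by linarith)
        exact le_trans (by positivity) (le_max_left _ _)
    _ = (2 * jd m l) ^ (2*γ) * b ^ (2*γ) := Real.mul_rpow (by linarith) (by linarith)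
    _ ≤ 2 * jd m l * b ^ (2*γ) := by
        gcongr
        calc (2 * jd m l) ^ (2*γ) ≤ (2 * jd m l) ^ (1:ℝ) :=
              Real.rpow_le_rpow_of_exponent_le hx (by linarith)
          _ = _ := Real.rpow_one _

lemma mxu_le_two_self {γ : ℝ} (hγ : 0 < γ) (hγh : γ < 1/2) (m n : ℕ+) :
    mxu γ m n ≤ 2 * jd m n * mxu γ n n := mxu_le_two hγ hγh m n n

lemma mxu_le_two_min {γ : ℝ} (hγ : 0 < γ) (hγh : γ < 1/2) (m n : ℕ+) :
    mxu γ m n ≤ 2 * jd m n * mnu γ m n := by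
  rcases le_total m n with h | h
  · have := mxu_le_two hγ hγh n m m
    rw [mxu_symm, jd_symm]
    unfold mnu; rw [min_eq_left h, ← mxu_self]; exact this
  · have := mxu_le_two hγ hγh m n n
    unfold mnu; rw [min_eq_right h, ← mxu_self]; exact this

lemma mxu_le_max {γ : ℝ} (hγ : 0 < γ) (m n l : ℕ+) :
    mxu γ m n ≤ mxu γ m l ∨ mxu γ m n ≤ mxu γ l n := by
  unfold mxu
  rcases le_total m n with h | h
  · right
    apply Real.rpow_le_rpow (by positivity) _ (by linarith)
    rw [max_eq_right h]
    exact_mod_cast le_max_right l n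
  · left
    apply Real.rpow_le_rpow (by positivity) _ (by linarith)
    rw [max_eq_left h]
    exact_mod_cast le_max_left m l

lemma mxu_le_mul {γ : ℝ} (hγ : 0 < γ) (m n l : ℕ+) :
    mxu γ m n ≤ mxu γ m l * mxu γ l n := by
  have h1 := mxu_ge hγ m l
  have h2 := mxu_ge hγ l n
  rcases mxu_le_max hγ m n l with h | h <;> nlinarith

lemma mxu_self_le {γ : ℝ} (hγ : 0 < γ) (m n : ℕ+) : mxu γ n n ≤ mxu γ m n := by
  unfold mxu
  apply Real.rpow_le_rpow (by positivity) _ (by linarith)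
  rw [max_self]
  exact_mod_cast le_max_right m n

lemma mxu_mul_mnu_le {γ : ℝ} (hγ : 0 < γ) (m n l : ℕ+) :
    mxu γ m n * mnu γ m l ≤ mxu γ m l * mxu γ l n := by
  unfold mxu mnu
  rw [← Real.mul_rpow (by positivity) (by positivity), ← Real.mul_rpow (by positivity) (by positivity)]
  apply Real.rpow_le_rpow (by positivity) _ (by linarith)
  rw [cast_max, cast_max, cast_max, cast_min]
  have h1 := cast_ge m
  have h2 := cast_ge n
  have h3 := cast_ge l
  set a := ((m:ℕ):ℝ)
  set b := ((n:ℕ):ℝ)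
  set c := ((l:ℕ):ℝ)
  rcases le_total a b with h | h
  · rw [max_eq_right h, mul_comm]
    apply mul_le_mul (le_trans (min_le_left _ _) (le_max_left _ _)) (le_max_right _ _)
      (by linarith) (le_trans (by linarith) (le_max_left _ _))
  · rw [max_eq_left h]
    apply mul_le_mul (le_max_left _ _) (le_trans (min_le_right _ _) (le_max_left _ _))
      (by positivity) (le_trans (by linarith) (le_max_left _ _))

/-! ### sums -/

def Ssum (p : ℝ) : ℝ := 1 + 2 * rzeta p

lemma rzeta_summable {p : ℝ} (hp : 1 < p) : Summable fun n : ℕ+ => (((n : ℕ) : ℝ) ^ p)⁻¹ := by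
  have := (Real.summable_nat_rpow_inv).2 hp
  exact this.comp_injective PNat.coe_injective

lemma int_hasSum {p : ℝ} (hp : 1 < p) : HasSum (fun d : ℤ => (jap (d:ℝ) ^ p)⁻¹) (Ssum p) := by
  have h1 := (rzeta_summable hp).hasSum
  change HasSum _ (rzeta p) at h1
  have h2 : HasSum (fun n : ℕ => (((n+1 : ℕ) : ℝ) ^ p)⁻¹) (rzeta p) := by
    have := (Equiv.pnatEquivNat.symm.hasSum_iff (f := fun n : ℕ+ => (((n : ℕ) : ℝ) ^ p)⁻¹) (a := rzeta p)).2 h1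
    refine this.congr_fun ?_ 
    intro n
    simp
  have hj : ∀ n : ℕ, jap ((n:ℝ)+1) = (n:ℝ)+1 := by
    intro n
    unfold jap
    rw [abs_of_nonneg (by positivity)]
    apply max_eq_right
    linarith [(Nat.cast_nonneg n : (0:ℝ) ≤ n)]
  have hj' : ∀ n : ℕ, jap (-((n:ℝ)+1)) = (n:ℝ)+1 := by
    intro n
    have h := hj n
    unfold jap at *
    rw [abs_neg]
    exact h
  have h3 : HasSum (fun n : ℕ => (jap ((n:ℤ):ℝ) ^ p)⁻¹) (1 + rzeta p) := by
    rw [← hasSum_nat_add_iff' 1]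
    simp only [Finset.range_one, Finset.sum_singleton]
    have e1 : 1 + rzeta p - (jap (((0:ℕ):ℤ):ℝ) ^ p)⁻¹ = rzeta p := by simp [jap]
    rw [e1]
    refine h2.congr_fun ?_
    intro n
    push_cast
    rw [hj]
  have h4 : HasSum (fun n : ℕ => (jap ((-((n:ℤ)+1) : ℤ):ℝ) ^ p)⁻¹) (rzeta p) := by
    refine h2.congr_fun ?_
    intro n
    push_cast
    rw [hj']
  have := HasSum.of_nat_of_neg_add_one (f := fun d : ℤ => (jap (d:ℝ) ^ p)⁻¹) h3 h4
  convert this using 1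
  unfold Ssum; ring

lemma row_summable {p : ℝ} (hp : 1 < p) (m : ℕ+) :
    Summable (fun l => (jd m l ^ p)⁻¹) ∧ ∑' l, (jd m l ^ p)⁻¹ ≤ Ssum p := by
  let e : ℕ+ → ℤ := fun l => ((m:ℕ):ℤ) - ((l:ℕ):ℤ)
  have he : Function.Injective e := by
    intro a b h
    apply PNat.coe_injective
    simp only [e] at h
    omega
  have hs := int_hasSum hp
  have heq : (fun l => (jd m l ^ p)⁻¹) = (fun d : ℤ => (jap (d:ℝ) ^ p)⁻¹) ∘ e := by
    funext l
    simp [e, jd]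
  have hsum : Summable (fun l => (jd m l ^ p)⁻¹) := by
    rw [heq]; exact hs.summable.comp_injective he
  refine ⟨hsum, ?_⟩
  rw [← hs.tsum_eq]
  apply Summable.tsum_le_tsum_of_inj e he _ _ hsum hs.summable
  · intro c _
    have : (0:ℝ) ≤ jap c := le_trans zero_le_one (le_max_left _ _)
    positivity
  · intro l
    exact le_of_eq (congrFun heq l)

lemma rzeta_ge_one {p : ℝ} (hp : 1 < p) : 1 ≤ rzeta p := by
  have := (rzeta_summable hp).le_tsum 1 (fun j _ => by positivity)
  simpa [rzeta] using this

lemma Ssum_ge {p : ℝ} (hp : 1 < p) : 3 ≤ Ssum p := by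
  have := rzeta_ge_one hp
  unfold Ssum; linarith

lemma rzeta_anti {p q : ℝ} (hp : 1 < p) (hpq : p ≤ q) : rzeta q ≤ rzeta p := by
  apply Summable.tsum_le_tsum _ (rzeta_summable (lt_of_lt_of_le hp hpq)) (rzeta_summable hp)
  intro n
  have := cast_ge n
  have h2 : ((n:ℕ):ℝ) ^ p ≤ ((n:ℕ):ℝ) ^ q := Real.rpow_le_rpow_of_exponent_le this hpq
  have h3 : 0 < ((n:ℕ):ℝ) ^ p := Real.rpow_pos_of_pos (by linarith) _
  exact inv_anti₀ h3 h2

def Dc (p : ℝ) : ℝ := 2 ^ (p + 1) * Ssum p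

lemma jpos (m n : ℕ+) (p : ℝ) : 0 < jd m n ^ p := Real.rpow_pos_of_pos (jd_pos m n) _

lemma conv_pt {p : ℝ} (hp : 1 < p) (m n l : ℕ+) :
    (jd m l ^ p)⁻¹ * (jd l n ^ p)⁻¹ ≤ 2 ^ p * (jd m n ^ p)⁻¹ * ((jd m l ^ p)⁻¹ + (jd n l ^ p)⁻¹) := by
  have a1 := jpos m l p
  have a2 := jpos l n p
  have a3 := jpos m n p
  rw [jd_symm n l]
  have key : jd m n ^ p ≤ 2 ^ p * (jd m l ^ p + jd l n ^ p) := by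
    have t := jd_tri m n l
    rcases le_total (jd m l) (jd l n) with h | h
    · have : jd m n ≤ 2 * jd l n := by linarith
      calc jd m n ^ p ≤ (2 * jd l n) ^ p := Real.rpow_le_rpow (jd_pos _ _).le this (by linarith)
        _ = 2 ^ p * jd l n ^ p := Real.mul_rpow (by norm_num) (jd_pos _ _).le
        _ ≤ _ := by gcongr; linarith
    · have : jd m n ≤ 2 * jd m l := by linarith
      calc jd m n ^ p ≤ (2 * jd m l) ^ p := Real.rpow_le_rpow (jd_pos _ _).le this (by linarith)
        _ = 2 ^ p * jd m l ^ p := Real.mul_rpow (by norm_num) (jd_pos _ _).le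
        _ ≤ _ := by gcongr; linarith
  have : 2 ^ p * (jd m n ^ p)⁻¹ * ((jd m l ^ p)⁻¹ + (jd l n ^ p)⁻¹) =
    (2 ^ p * (jd m l ^ p + jd l n ^ p)) * ((jd m n ^ p)⁻¹ * ((jd m l ^ p)⁻¹ * (jd l n ^ p)⁻¹)) := by
    field_simp
    ring
  rw [this]
  calc (jd m l ^ p)⁻¹ * (jd l n ^ p)⁻¹ = jd m n ^ p * ((jd m n ^ p)⁻¹ * ((jd m l ^ p)⁻¹ * (jd l n ^ p)⁻¹)) := by
        field_simp
    _ ≤ _ := by gcongr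

lemma conv_sum {p : ℝ} (hp : 1 < p) (m n : ℕ+) :
    Summable (fun l => (jd m l ^ p)⁻¹ * (jd l n ^ p)⁻¹) ∧
    ∑' l, (jd m l ^ p)⁻¹ * (jd l n ^ p)⁻¹ ≤ Dc p * (jd m n ^ p)⁻¹ := by
  obtain ⟨s1, t1⟩ := row_summable hp m
  obtain ⟨s2, t2⟩ := row_summable hp n
  have s3 := (s1.add s2).mul_left (2 ^ p * (jd m n ^ p)⁻¹)
  have hs : Summable (fun l => (jd m l ^ p)⁻¹ * (jd l n ^ p)⁻¹) :=
    Summable.of_nonneg_of_le (fun l => by have := jpos m l p; have := jpos l n p; positivity)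
      (fun l => conv_pt hp m n l) s3
  refine ⟨hs, ?_⟩
  have a3 := jpos m n p
  calc ∑' l, (jd m l ^ p)⁻¹ * (jd l n ^ p)⁻¹
      ≤ ∑' l, 2 ^ p * (jd m n ^ p)⁻¹ * ((jd m l ^ p)⁻¹ + (jd n l ^ p)⁻¹) :=
        hs.tsum_le_tsum (fun l => conv_pt hp m n l) s3
    _ = 2 ^ p * (jd m n ^ p)⁻¹ * (∑' l, (jd m l ^ p)⁻¹ + ∑' l, (jd n l ^ p)⁻¹) := by
        rw [tsum_mul_left, s1.tsum_add s2]
    _ ≤ 2 ^ p * (jd m n ^ p)⁻¹ * (Ssum p + Ssum p) := by gcongr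
    _ = Dc p * (jd m n ^ p)⁻¹ := by
        unfold Dc; rw [Real.rpow_add (by norm_num), Real.rpow_one]; ring

section basics

variable {P : ℕ+ → 𝓗 →L[ℂ] 𝓗}

lemma pf_idem (hP : ProjFamily P) (n : ℕ+) : P n * P n = P n := hP.2.1 n

lemma pf_orth (hP : ProjFamily P) {m n : ℕ+} (h : m ≠ n) : P m * P n = 0 := hP.2.2.1 m n h

lemma pf_star (hP : ProjFamily P) (n : ℕ+) : star (P n) = P n := (hP.1 n).star_eq

lemma pf_sum (hP : ProjFamily P) (ψ : 𝓗) : HasSum (fun n => P n ψ) ψ := hP.2.2.2.2 ψ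

lemma pf_idem_apply (hP : ProjFamily P) (n : ℕ+) (ψ : 𝓗) : P n (P n ψ) = P n ψ :=
  congrArg (fun A : 𝓗 →L[ℂ] 𝓗 => A ψ) (pf_idem hP n)

lemma pf_orth_apply (hP : ProjFamily P) {m n : ℕ+} (h : m ≠ n) (ψ : 𝓗) : P m (P n ψ) = 0 :=
  congrArg (fun A : 𝓗 →L[ℂ] 𝓗 => A ψ) (pf_orth hP h)

lemma pf_symm (hP : ProjFamily P) (n : ℕ+) (x y : 𝓗) : inner ℂ (P n x) y = inner ℂ x (P n y) := by
  have := pf_star hP n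
  rw [ContinuousLinearMap.star_eq_adjoint] at this
  rw [← ContinuousLinearMap.adjoint_inner_right, this]

lemma pf_norm_le (hP : ProjFamily P) (n : ℕ+) : ‖P n‖ ≤ 1 := by
  have h : ‖star (P n) * P n‖ = ‖P n‖ * ‖P n‖ := CStarRing.norm_star_mul_self
  rw [pf_star hP, pf_idem hP] at h
  by_contra hc
  push Not at hc
  nlinarith [norm_nonneg (P n)]

lemma parseval (hP : ProjFamily P) (ψ : 𝓗) : HasSum (fun n => ‖P n ψ‖ ^ 2) (‖ψ‖ ^ 2) := by
  have h1 := (pf_sum hP ψ).mapL (innerSL ℂ ψ)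
  have h2 := h1.mapL Complex.reCLM
  have e : ∀ x : 𝓗, Complex.reCLM (innerSL ℂ x x) = ‖x‖ ^ 2 := by
    intro x
    simp only [innerSL_apply_apply, Complex.reCLM_apply]
    exact inner_self_eq_norm_sq (𝕜 := ℂ) x
  rw [e] at h2
  refine h2.congr_fun ?_
  intro n
  rw [← e (P n ψ)]
  simp only [innerSL_apply_apply]
  rw [pf_symm hP, pf_idem_apply hP]

/-- ranges form an orthogonal family -/
lemma orthFam (hP : ProjFamily P) :
    OrthogonalFamily ℂ (fun n => (LinearMap.range (P n).toLinearMap : Submodule ℂ 𝓗))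
      (fun n => (LinearMap.range (P n).toLinearMap).subtypeₗᵢ) := by
  intro m n h v w
  obtain ⟨x, hx⟩ := v.2
  obtain ⟨y, hy⟩ := w.2
  simp only [Submodule.coe_subtypeₗᵢ, Submodule.subtype_apply]
  rw [← hx, ← hy]
  simp only [ContinuousLinearMap.coe_coe]
  rw [pf_symm hP, pf_orth_apply hP h, inner_zero_right]

lemma orth_summable_iff (hP : ProjFamily P) (v : ℕ+ → 𝓗) (hv : ∀ n, P n (v n) = v n) :
    Summable v ↔ Summable fun n => ‖v n‖ ^ 2 := by
  have := (orthFam hP).summable_iff_norm_sq_summable (fun n => ⟨v n, ⟨v n, hv n⟩⟩)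
  simpa using this

lemma orth_norm_sum (hP : ProjFamily P) (v : ℕ+ → 𝓗) (hv : ∀ n, P n (v n) = v n) (s : Finset ℕ+) :
    ‖∑ n ∈ s, v n‖ ^ 2 = ∑ n ∈ s, ‖v n‖ ^ 2 := by
  have := (orthFam hP).norm_sum (fun n => ⟨v n, ⟨v n, hv n⟩⟩) s
  simpa using this

lemma op_ext (hP : ProjFamily P) {A B : 𝓗 →L[ℂ] 𝓗} (h : ∀ m n, P m * A * P n = P m * B * P n) :
    A = B := by
  have h1 : ∀ n ψ, A (P n ψ) = B (P n ψ) := by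
    intro n ψ
    have a := pf_sum hP (A (P n ψ))
    have b := pf_sum hP (B (P n ψ))
    refine a.unique (b.congr_fun ?_)
    intro m
    exact congrArg (fun A : 𝓗 →L[ℂ] 𝓗 => A ψ) (h m n)
  ext ψ
  have a := (pf_sum hP ψ).mapL A
  have b := (pf_sum hP ψ).mapL B
  exact a.unique (b.congr_fun (fun n => h1 n ψ))

/-- block operator from blocks -/
lemma blockOp (hP : ProjFamily P) {p : ℝ} (hp : 1 < p) {c : ℝ} (hc : 0 ≤ c)
    (a : ℕ+ → ℕ+ → 𝓗 →L[ℂ] 𝓗)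
    (hl : ∀ m n, P m * a m n = a m n) (hr : ∀ m n, a m n * P n = a m n)
    (ha : ∀ m n, ‖a m n‖ ≤ c * (jd m n ^ p)⁻¹) :
    ∃ X : 𝓗 →L[ℂ] 𝓗, (∀ m n, P m * X * P n = a m n) ∧ ‖X‖ ≤ c * Ssum p := by
  set α : ℕ+ → ℕ+ → ℝ := fun m n => c * (jd m n ^ p)⁻¹ with hα
  have α0 : ∀ m n, 0 ≤ α m n := fun m n => by have := jpos m n p; simp only [hα]; positivity
  have αs : ∀ m, Summable (α m) := fun m => (row_summable hp m).1.mul_left c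
  have αt : ∀ m, ∑' n, α m n ≤ c * Ssum p := fun m => by
    simp only [hα]
    rw [tsum_mul_left]
    exact mul_le_mul_of_nonneg_left (row_summable hp m).2 hc
  have hsum : ∀ m, Summable (a m) := fun m =>
    Summable.of_norm_bounded (αs m) (fun n => ha m n)
  set S := c * Ssum p with hS
  have hS0 : 0 ≤ S := by have := Ssum_ge hp; positivity
  let A : ℕ+ → 𝓗 →L[ℂ] 𝓗 := fun m => ∑' n, a m n
  have hA : ∀ m, HasSum (a m) (A m) := fun m => (hsum m).hasSum
  have hAP : ∀ m n, A m * P n = a m n := by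
    intro m n
    have h1 := (hA m).mul_right (P n)
    have h2 : HasSum (fun l => a m l * P n) (a m n) := by
      have : (fun l => a m l * P n) = fun l => if l = n then a m n else 0 := by
        funext l
        split_ifs with h
        · subst h; exact hr m l
        · rw [← hr m l, mul_assoc, pf_orth hP h, mul_zero]
      rw [this]
      exact hasSum_ite_eq n (a m n)
    exact h1.unique h2
  have hPA : ∀ m, P m * A m = A m := by
    intro m
    have h1 := (hA m).mul_left (P m)
    exact h1.unique ((hA m).congr_fun (fun n => hl m n))
  have hPA' : ∀ m ψ, P m (A m ψ) = A m ψ := fun m ψ =>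
    congrArg (fun B : 𝓗 →L[ℂ] 𝓗 => B ψ) (hPA m)
  -- bound for rows
  have hx : ∀ ψ, HasSum (fun n => ‖P n ψ‖^2) (‖ψ‖^2) := parseval hP
  have αx : ∀ m ψ, Summable fun n => α m n * ‖P n ψ‖^2 := by
    intro m ψ
    refine Summable.of_nonneg_of_le (fun n => mul_nonneg (α0 m n) (sq_nonneg _)) (fun n => ?_)
      ((αs m).mul_right (‖ψ‖^2))
    apply mul_le_mul_of_nonneg_left _ (α0 m n)
    exact le_hasSum (hx ψ) n (fun _ _ => sq_nonneg _)
  have hrow : ∀ m ψ, ‖A m ψ‖ ^ 2 ≤ S * ∑' n, α m n * ‖P n ψ‖^2 := by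
    intro m ψ
    have h1 : HasSum (fun n => a m n ψ) (A m ψ) :=
      (hA m).mapL (ContinuousLinearMap.apply ℂ 𝓗 ψ)
    have h2 : ∀ n, ‖a m n ψ‖ ≤ α m n * ‖P n ψ‖ := by
      intro n
      have : a m n ψ = a m n (P n ψ) := (congrArg (fun B : 𝓗 →L[ℂ] 𝓗 => B ψ) (hr m n)).symm
      rw [this]
      exact le_trans (le_opNorm _ _) (mul_le_mul_of_nonneg_right (ha m n) (norm_nonneg _))
    have hq : ∀ τ : ℝ, 0 ≤ S * (τ * τ) + (-2 * ‖A m ψ‖) * τ + ∑' n, α m n * ‖P n ψ‖^2 := by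
      intro τ
      rcases le_total τ 0 with hτ | hτ
      · have : 0 ≤ ∑' n, α m n * ‖P n ψ‖^2 :=
          tsum_nonneg (fun n => mul_nonneg (α0 m n) (sq_nonneg _))
        nlinarith [norm_nonneg (A m ψ), mul_nonneg hS0 (mul_self_nonneg τ)]
      · have h3 : ∀ n, ‖(2*τ : ℝ) • a m n ψ‖ ≤ (τ*τ) * α m n + α m n * ‖P n ψ‖^2 := by
          intro n
          rw [norm_smul, Real.norm_of_nonneg (by linarith)]
          nlinarith [h2 n, α0 m n, mul_nonneg (α0 m n) (sq_nonneg (τ - ‖P n ψ‖)),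
            mul_le_mul_of_nonneg_left (h2 n) hτ]
        have s3 := ((αs m).mul_left (τ*τ)).add (αx m ψ)
        have h4 := tsum_of_norm_bounded s3.hasSum h3
        rw [(h1.const_smul (2*τ : ℝ)).tsum_eq, norm_smul, Real.norm_of_nonneg (by linarith),
          ((αs m).mul_left (τ*τ)).tsum_add (αx m ψ), tsum_mul_left] at h4
        nlinarith [mul_le_mul_of_nonneg_left (αt m) (mul_self_nonneg τ)]
    have := discrim_le_zero hq
    unfold discrim at this
    nlinarith
  have hfin : ∀ ψ (s : Finset ℕ+), ∑ m ∈ s, ‖A m ψ‖^2 ≤ (S * ‖ψ‖)^2 := by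
    intro ψ s
    calc ∑ m ∈ s, ‖A m ψ‖^2 ≤ ∑ m ∈ s, S * ∑' n, α m n * ‖P n ψ‖^2 :=
          Finset.sum_le_sum (fun m _ => hrow m ψ)
      _ = S * ∑' n, ∑ m ∈ s, α m n * ‖P n ψ‖^2 := by
          rw [← Finset.mul_sum, Summable.tsum_finsetSum (fun m _ => αx m ψ)]
      _ ≤ S * ∑' n, S * ‖P n ψ‖^2 := by
          apply mul_le_mul_of_nonneg_left _ hS0
          apply Summable.tsum_le_tsum _ _ ((hx ψ).summable.mul_left S)
          · intro n
            rw [← Finset.sum_mul]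
            apply mul_le_mul_of_nonneg_right _ (sq_nonneg _)
            have : ∀ m, α m n = α n m := fun m => by simp only [hα]; rw [jd_symm]
            simp only [this]
            exact le_trans ((αs n).sum_le_tsum s (fun m _ => α0 n m)) (αt n)
          · exact summable_sum (fun m _ => αx m ψ)
      _ = (S * ‖ψ‖)^2 := by rw [tsum_mul_left, (hx ψ).tsum_eq]; ring
  have hAs : ∀ ψ, Summable fun m => A m ψ := by
    intro ψ
    rw [orth_summable_iff hP _ (fun m => hPA' m ψ)]
    exact summable_of_sum_le (fun m => sq_nonneg _) (hfin ψ)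
  let X0 : 𝓗 →ₗ[ℂ] 𝓗 :=
    { toFun := fun ψ => ∑' m, A m ψ
      map_add' := fun x y => by
        simp only [map_add]
        exact (hAs x).tsum_add (hAs y)
      map_smul' := fun z x => by
        simp only [map_smul, RingHom.id_apply]
        exact (hAs x).tsum_const_smul z }
  have hX0 : ∀ ψ, ‖X0 ψ‖ ≤ S * ‖ψ‖ := by
    intro ψ
    refine le_of_tendsto (hAs ψ).hasSum.norm (Filter.Eventually.of_forall fun s => ?_)
    apply le_of_sq_le_sq _ (by positivity)
    rw [orth_norm_sum hP _ (fun m => hPA' m ψ)]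
    exact hfin ψ s
  refine ⟨X0.mkContinuous S hX0, ?_, X0.mkContinuous_norm_le hS0 hX0⟩
  intro m n
  ext ψ
  have h1 := ((hAs (P n ψ)).hasSum.mapL (P m))
  have h2 : HasSum (fun l => P m (A l (P n ψ))) (a m n ψ) := by
    have : (fun l => P m (A l (P n ψ))) = fun l => if l = m then a m n ψ else 0 := by
      funext l
      split_ifs with h
      · subst h; rw [hPA']; exact congrArg (fun B : 𝓗 →L[ℂ] 𝓗 => B ψ) (hAP l n)
      · rw [← hPA', pf_orth_apply hP (Ne.symm h)]
    rw [this]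
    exact hasSum_ite_eq m _
  exact h1.unique h2

lemma schur (hP : ProjFamily P) {p : ℝ} (hp : 1 < p) {c : ℝ} (hc : 0 ≤ c)
    (X : 𝓗 →L[ℂ] 𝓗) (h : ∀ m n, ‖P m * X * P n‖ ≤ c * (jd m n ^ p)⁻¹) : ‖X‖ ≤ c * Ssum p := by
  obtain ⟨X', h1, h2⟩ := blockOp hP hp hc (fun m n => P m * X * P n)
    (fun m n => by rw [← mul_assoc, ← mul_assoc, pf_idem hP])
    (fun m n => by rw [mul_assoc, pf_idem hP]) h
  have : X' = X := op_ext hP h1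
  rwa [this] at h2

/-- entry estimate of a product -/
lemma mul_entry (hP : ProjFamily P) (A B : 𝓗 →L[ℂ] 𝓗) (m n : ℕ+) (f : ℕ+ → ℝ) (hf : Summable f)
    (h : ∀ l, ‖P m * A * P l‖ * ‖P l * B * P n‖ ≤ f l) : ‖P m * (A * B) * P n‖ ≤ ∑' l, f l := by
  have h0 : ∀ l, 0 ≤ f l := fun l => le_trans (by positivity) (h l)
  refine opNorm_le_bound _ (tsum_nonneg h0) (fun ψ => ?_)
  have h1 : HasSum (fun l => (P m * A * P l) ((P l * B * P n) ψ)) ((P m * (A * B) * P n) ψ) := by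
    have h2 := (pf_sum hP (B (P n ψ))).mapL (P m * A)
    refine h2.congr_fun ?_
    intro l
    exact congrArg (P m * A) (pf_idem_apply hP l (B (P n ψ)))
  rw [← h1.tsum_eq, ← tsum_mul_right]
  refine tsum_of_norm_bounded (hf.mul_right _).hasSum (fun l => ?_)
  calc ‖(P m * A * P l) ((P l * B * P n) ψ)‖ ≤ ‖P m * A * P l‖ * (‖P l * B * P n‖ * ‖ψ‖) :=
        le_trans (le_opNorm _ _) (mul_le_mul_of_nonneg_left (le_opNorm _ _) (norm_nonneg _))
    _ = (‖P m * A * P l‖ * ‖P l * B * P n‖) * ‖ψ‖ := by ring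
    _ ≤ f l * ‖ψ‖ := mul_le_mul_of_nonneg_right (h l) (norm_nonneg _)

/-- weighted entry bound -/
def Ent (P : ℕ+ → 𝓗 →L[ℂ] 𝓗) (p : ℝ) (g : ℕ+ → ℕ+ → ℝ) (a : ℝ) (A : 𝓗 →L[ℂ] 𝓗) : Prop :=
  ∀ m n, ‖P m * A * P n‖ ≤ a * ((jd m n ^ p)⁻¹ * g m n)

lemma Ent.mul (hP : ProjFamily P) {p : ℝ} (hp : 1 < p) {g1 g2 g3 : ℕ+ → ℕ+ → ℝ} {a b e : ℝ}
    {A B : 𝓗 →L[ℂ] 𝓗} (hA : Ent P p g1 a A) (hB : Ent P p g2 b B) (ha : 0 ≤ a) (hb : 0 ≤ b)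
    (he : 0 ≤ e) (g10 : ∀ m n, 0 ≤ g1 m n) (g30 : ∀ m n, 0 ≤ g3 m n)
    (hg : ∀ m n l, g1 m l * g2 l n ≤ e * g3 m n) :
    Ent P p g3 (Dc p * e * a * b) (A * B) := by
  intro m n
  obtain ⟨s, t⟩ := conv_sum hp m n
  have hs := s.mul_left (e * a * b * g3 m n)
  refine le_trans (mul_entry hP A B m n _ hs ?_) ?_
  · intro l
    have j1 := jpos m l p
    have j2 := jpos l n p
    calc ‖P m * A * P l‖ * ‖P l * B * P n‖
        ≤ (a * ((jd m l ^ p)⁻¹ * g1 m l)) * (b * ((jd l n ^ p)⁻¹ * g2 l n)) := by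
          have := g10 m l
          exact mul_le_mul (hA m l) (hB l n) (norm_nonneg _) (by positivity)
      _ = (a * b * ((jd m l ^ p)⁻¹ * (jd l n ^ p)⁻¹)) * (g1 m l * g2 l n) := by ring
      _ ≤ (a * b * ((jd m l ^ p)⁻¹ * (jd l n ^ p)⁻¹)) * (e * g3 m n) :=
          mul_le_mul_of_nonneg_left (hg m n l) (by positivity)
      _ = _ := by ring
  · rw [tsum_mul_left]
    calc _ ≤ (e * a * b * g3 m n) * (Dc p * (jd m n ^ p)⁻¹) := by
          have := g30 m n
          exact mul_le_mul_of_nonneg_left t (by positivity)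
      _ = _ := by ring

lemma Ent.add {p : ℝ} {g : ℕ+ → ℕ+ → ℝ} {a b : ℝ} {A B : 𝓗 →L[ℂ] 𝓗} (hA : Ent P p g a A)
    (hB : Ent P p g b B) : Ent P p g (a + b) (A + B) := by
  intro m n
  rw [mul_add, add_mul, add_mul]
  exact le_trans (norm_add_le _ _) (add_le_add (hA m n) (hB m n))

lemma Ent.neg {p : ℝ} {g : ℕ+ → ℕ+ → ℝ} {a : ℝ} {A : 𝓗 →L[ℂ] 𝓗} (hA : Ent P p g a A) :
    Ent P p g a (-A) := by
  intro m n
  rw [mul_neg, neg_mul, norm_neg]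
  exact hA m n

lemma Ent.sub {p : ℝ} {g : ℕ+ → ℕ+ → ℝ} {a b : ℝ} {A B : 𝓗 →L[ℂ] 𝓗} (hA : Ent P p g a A)
    (hB : Ent P p g b B) : Ent P p g (a + b) (A - B) := by
  rw [sub_eq_add_neg]; exact hA.add hB.neg

lemma Ent.smul {p : ℝ} {g : ℕ+ → ℕ+ → ℝ} {a : ℝ} {A : 𝓗 →L[ℂ] 𝓗} (hA : Ent P p g a A) (c : ℂ) :
    Ent P p g (‖c‖ * a) (c • A) := by
  intro m n
  rw [mul_smul_comm, smul_mul_assoc, norm_smul, mul_assoc ‖c‖]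
  exact mul_le_mul_of_nonneg_left (hA m n) (norm_nonneg c)

lemma Ent.mono {p : ℝ} {g : ℕ+ → ℕ+ → ℝ} (hg : ∀ m n, 0 ≤ g m n) {a b : ℝ} {A : 𝓗 →L[ℂ] 𝓗}
    (hA : Ent P p g a A) (h : a ≤ b) : Ent P p g b A := by
  intro m n
  have := hg m n
  have := jpos m n p
  exact le_trans (hA m n) (mul_le_mul_of_nonneg_right h (by positivity))

lemma Ent.star (hP : ProjFamily P) {p : ℝ} {g : ℕ+ → ℕ+ → ℝ} (hg : ∀ m n, g m n = g n m) {a : ℝ}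
    {A : 𝓗 →L[ℂ] 𝓗} (hA : Ent P p g a A) : Ent P p g a (star A) := by
  intro m n
  have : P m * Star.star A * P n = Star.star (P n * A * P m) := by
    rw [star_mul, star_mul, pf_star hP, pf_star hP, mul_assoc]
  rw [this, norm_star, jd_symm, hg]
  exact hA n m

lemma Ent.lim {p : ℝ} {g : ℕ+ → ℕ+ → ℝ} {a : ℝ} {A : 𝓗 →L[ℂ] 𝓗} {As : ℕ → 𝓗 →L[ℂ] 𝓗}
    (hA : ∀ j, Ent P p g a (As j)) (h : Filter.Tendsto As Filter.atTop (nhds A)) :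
    Ent P p g a A := by
  intro m n
  have : Filter.Tendsto (fun j => ‖P m * As j * P n‖) Filter.atTop (nhds ‖P m * A * P n‖) :=
    ((h.const_mul (P m)).mul_const (P n)).norm
  exact le_of_tendsto' this (fun j => hA j m n)

end basics

section rels

variable {P : ℕ+ → 𝓗 →L[ℂ] 𝓗} {E : ℕ+ → ℝ}

/-- `K` is the commutator `[H, X]`, in terms of entries. -/
def HRel (P : ℕ+ → 𝓗 →L[ℂ] 𝓗) (E : ℕ+ → ℝ) (X K : 𝓗 →L[ℂ] 𝓗) : Prop :=
  ∀ m n, P m * K * P n = ((E m - E n : ℝ) : ℂ) • (P m * X * P n)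

lemma isHSum_iff (hP : ProjFamily P) (ψ h : 𝓗) :
    IsHSum P E ψ h ↔ ∀ m, P m h = (E m : ℂ) • P m ψ := by
  constructor
  · intro H m
    have h1 := H.mapL (P m)
    have h2 : HasSum (fun n => P m ((E n : ℂ) • P n ψ)) ((E m : ℂ) • P m ψ) := by
      have : (fun n => P m ((E n : ℂ) • P n ψ)) = fun n => if n = m then (E m : ℂ) • P m ψ else 0 := by
        funext n
        rw [map_smul]
        split_ifs with h
        · subst h; rw [pf_idem_apply hP]
        · rw [pf_orth_apply hP (Ne.symm h), smul_zero]
      rw [this]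
      exact hasSum_ite_eq m _
    exact h1.unique h2
  · intro H
    exact (pf_sum hP h).congr_fun (fun n => (H n).symm)

lemma hdom_iff (hP : ProjFamily P) (ψ : 𝓗) : ψ ∈ HDom P E ↔ ∃ h, IsHSum P E ψ h := by
  have e : ∀ n, ‖(E n : ℂ) • P n ψ‖ ^ 2 = (E n) ^ 2 * ‖P n ψ‖ ^ 2 := by
    intro n
    rw [norm_smul, mul_pow, Complex.norm_real, Real.norm_eq_abs, sq_abs]
  have h := orth_summable_iff hP (fun n => (E n : ℂ) • P n ψ)
    (fun n => by rw [map_smul, pf_idem_apply hP])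
  simp only [e] at h
  unfold HDom
  rw [Set.mem_setOf_eq, ← h]
  rfl

lemma HRel.dom (hP : ProjFamily P) {X K : 𝓗 →L[ℂ] 𝓗} (hX : HRel P E X K) {ψ h : 𝓗}
    (H : IsHSum P E ψ h) : IsHSum P E (X ψ) (K ψ + X h) := by
  rw [isHSum_iff hP] at H ⊢
  intro m
  have h1 := (pf_sum hP ψ).mapL (P m * K)
  have h2 := (pf_sum hP h).mapL (P m * X)
  have h3 := ((pf_sum hP ψ).mapL (P m * X)).const_smul (E m : ℂ)
  have h4 := h1.add h2
  have e : ∀ n, (E m : ℂ) • (P m * X) (P n ψ) = (P m * K) (P n ψ) + (P m * X) (P n h) := by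
    intro n
    have := congrArg (fun A : 𝓗 →L[ℂ] 𝓗 => A ψ) (hX m n)
    change (P m * K) (P n ψ) = ((E m - E n : ℝ) : ℂ) • (P m * X) (P n ψ) at this
    rw [this, H n, map_smul, ← add_smul]
    push_cast
    congr 1; ring
  have h5 := h4.unique (h3.congr_fun (fun n => (e n).symm))
  rw [map_add]
  exact h5

lemma rel_of_dom (hP : ProjFamily P) {X K : 𝓗 →L[ℂ] 𝓗}
    (hX : ∀ ψ h, IsHSum P E ψ h → IsHSum P E (X ψ) (K ψ + X h)) : HRel P E X K := by
  intro m n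
  ext φ
  have h0 : IsHSum P E (P n φ) ((E n : ℂ) • P n φ) := by
    rw [isHSum_iff hP]
    intro l
    rw [map_smul]
    by_cases h : l = n
    · subst h; rfl
    · rw [pf_orth_apply hP h]; simp
  have h1 := (isHSum_iff hP _ _).1 (hX _ _ h0) m
  rw [map_add, map_smul, map_smul] at h1
  change P m (K (P n φ)) = ((E m - E n : ℝ) : ℂ) • P m (X (P n φ))
  push_cast
  rw [sub_smul, ← h1]
  simp

lemma HRel.mul (hP : ProjFamily P) {X K X' K' : 𝓗 →L[ℂ] 𝓗} (h : HRel P E X K) (h' : HRel P E X' K') :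
    HRel P E (X * X') (K * X' + X * K') := by
  apply rel_of_dom hP
  intro ψ η H
  have h1 := h.dom hP (h'.dom hP H)
  have e : (K * X' + X * K') ψ + (X * X') η = K (X' ψ) + X (K' ψ + X' η) := by
    change K (X' ψ) + X (K' ψ) + X (X' η) = _
    rw [map_add, add_assoc]
  rw [e]
  exact h1

lemma HRel.add {X K X' K' : 𝓗 →L[ℂ] 𝓗} (h : HRel P E X K) (h' : HRel P E X' K') :
    HRel P E (X + X') (K + K') := by
  intro m n
  have h1 := h m n
  have h2 := h' m n
  rw [mul_add, add_mul, h1, h2, mul_add, add_mul, smul_add]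

lemma HRel.smul {X K : 𝓗 →L[ℂ] 𝓗} (h : HRel P E X K) (c : ℂ) : HRel P E (c • X) (c • K) := by
  intro m n
  rw [mul_smul_comm, smul_mul_assoc, h m n, mul_smul_comm, smul_mul_assoc, smul_comm]

lemma HRel.neg {X K : 𝓗 →L[ℂ] 𝓗} (h : HRel P E X K) : HRel P E (-X) (-K) := by
  simpa using h.smul (-1)

lemma HRel.sub {X K X' K' : 𝓗 →L[ℂ] 𝓗} (h : HRel P E X K) (h' : HRel P E X' K') :
    HRel P E (X - X') (K - K') := by
  rw [sub_eq_add_neg, sub_eq_add_neg]; exact h.add h'.neg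

lemma HRel.one (hP : ProjFamily P) : HRel P E (1 : 𝓗 →L[ℂ] 𝓗) 0 := by
  intro m n
  rw [mul_zero, zero_mul, mul_one]
  by_cases h : m = n
  · subst h; simp
  · rw [pf_orth hP h, smul_zero]

lemma HRel.star (hP : ProjFamily P) {X K : 𝓗 →L[ℂ] 𝓗} (h : HRel P E X K) :
    HRel P E (star X) (-(star K)) := by
  intro m n
  have := congrArg Star.star (h n m)
  rw [star_smul, star_mul, star_mul, star_mul, star_mul, pf_star hP, pf_star hP, ← mul_assoc,
    ← mul_assoc] at this
  rw [mul_neg, neg_mul, this, ← neg_smul]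
  congr 1
  simp

lemma HRel.lim {X K : 𝓗 →L[ℂ] 𝓗} {Xs Ks : ℕ → 𝓗 →L[ℂ] 𝓗} (h : ∀ j, HRel P E (Xs j) (Ks j))
    (hX : Filter.Tendsto Xs Filter.atTop (nhds X)) (hK : Filter.Tendsto Ks Filter.atTop (nhds K)) :
    HRel P E X K := by
  intro m n
  have h1 := ((hK.const_mul (P m)).mul_const (P n))
  have h2 := (((hX.const_mul (P m)).mul_const (P n)).const_smul ((E m - E n : ℝ) : ℂ))
  refine tendsto_nhds_unique h1 (h2.congr (fun j => (h j m n).symm))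

lemma HRel.unique (hP : ProjFamily P) {X K K' : 𝓗 →L[ℂ] 𝓗} (h : HRel P E X K) (h' : HRel P E X K') :
    K = K' := op_ext hP (fun m n => by rw [h m n, h' m n])

lemma neumann_tendsto {X R : 𝓗 →L[ℂ] 𝓗} (hX : ‖X‖ < 1) :
    Filter.Tendsto (fun j : ℕ => R * (1 - X ^ j)) Filter.atTop (nhds R) := by
  have h : Filter.Tendsto (fun j : ℕ => X ^ j) Filter.atTop (nhds 0) :=
    tendsto_pow_atTop_nhds_zero_of_norm_lt_one hX
  have := (h.const_sub 1).const_mul R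
  simpa using this

lemma neumann_succ {X R : 𝓗 →L[ℂ] 𝓗} (h1 : (1 - X) * R = 1) (h2 : R * (1 - X) = 1) (j : ℕ) :
    R * (1 - X ^ (j+1)) = 1 + X * (R * (1 - X ^ j)) := by
  have e1 : X * R = R - 1 := by rw [sub_mul, one_mul] at h1; rw [← h1]; abel
  have e2 : R * X = R - 1 := by rw [mul_sub, mul_one] at h2; rw [← h2]; abel
  rw [← mul_assoc, e1, pow_succ', mul_sub, mul_sub, ← mul_assoc, e2]
  simp only [mul_one, sub_mul, one_mul]
  abel

lemma HRel.inv (hP : ProjFamily P) {X K R : 𝓗 →L[ℂ] 𝓗} (h : HRel P E X K) (hX : ‖X‖ ≤ 1/4)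
    (h1 : (1 - X) * R = 1) (h2 : R * (1 - X) = 1) : HRel P E R (R * K * R) := by
  let S : ℕ → 𝓗 →L[ℂ] 𝓗 := fun j => R * (1 - X ^ j)
  have hS : ∀ j, S (j+1) = 1 + X * S j := neumann_succ h1 h2
  let Ks : ℕ → 𝓗 →L[ℂ] 𝓗 := fun j => Nat.rec 0 (fun i L => K * S i + X * L) j
  have hK : ∀ j, Ks (j+1) = K * S j + X * Ks j := fun j => rfl
  have hrel : ∀ j, HRel P E (S j) (Ks j) := by
    intro j
    induction j with
    | zero =>
      intro m n
      simp [S, Ks]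
    | succ j ih =>
      rw [hS, hK]
      have := (HRel.one hP).add (h.mul hP ih)
      rwa [zero_add] at this
  have hfix : R * K * R = K * R + X * (R * K * R) := by
    have : X * R = R - 1 := by rw [sub_mul, one_mul] at h1; rw [← h1]; abel
    rw [← mul_assoc, ← mul_assoc, this]
    simp only [sub_mul, one_mul]; abel
  set M := 4 * (‖K‖ * ‖R‖) + ‖R * K * R‖ with hM
  have hXj : ∀ j : ℕ, ‖X ^ j‖ ≤ (1/4)^j := by
    intro j
    induction j with
    | zero => rw [pow_zero, pow_zero]; exact ContinuousLinearMap.norm_id_le (𝕜 := ℂ) (E := 𝓗)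
    | succ j ih =>
      rw [pow_succ, pow_succ]
      exact le_trans (norm_mul_le _ _) (mul_le_mul ih hX (norm_nonneg _) (by positivity))
  have hb : ∀ j, ‖Ks j - R * K * R‖ ≤ M * (1/2)^j := by
    intro j
    induction j with
    | zero => simp [Ks, hM]; positivity
    | succ j ih =>
      have e : Ks (j+1) - R * K * R = -(K * (R * X ^ j)) + X * (Ks j - R * K * R) := by
        rw [hK]; nth_rewrite 1 [hfix]; simp only [S, mul_sub, mul_one]; abel
      rw [e]
      have a1 : ‖K * (R * X^j)‖ ≤ ‖K‖ * (‖R‖ * (1/4)^j) :=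
        le_trans (norm_mul_le _ _) (mul_le_mul_of_nonneg_left (le_trans (norm_mul_le _ _)
          (mul_le_mul_of_nonneg_left (hXj j) (norm_nonneg _))) (norm_nonneg _))
      have a2 : ‖X * (Ks j - R * K * R)‖ ≤ 1/4 * (M * (1/2)^j) :=
        le_trans (norm_mul_le _ _) (mul_le_mul hX ih (norm_nonneg _) (by norm_num))
      have a3 : ((1:ℝ)/4)^j ≤ (1/2)^j := pow_le_pow_left₀ (by norm_num) (by norm_num) j
      have a4 : 0 ≤ ‖K‖ * ‖R‖ := by positivity
      have a5 : 0 ≤ ‖R * K * R‖ := norm_nonneg _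
      have a6 : (0:ℝ) ≤ (1/2)^j := by positivity
      calc _ ≤ ‖K * (R * X^j)‖ + ‖X * (Ks j - R * K * R)‖ := by
            refine le_trans (norm_add_le _ _) ?_; rw [norm_neg]
        _ ≤ (‖K‖ * ‖R‖) * (1/2)^j + 1/4 * (M * (1/2)^j) := by
            have := mul_le_mul_of_nonneg_left a3 a4
            linarith
        _ ≤ M * (1/2)^(j+1) := by
            rw [pow_succ, hM]; nlinarith [mul_nonneg a5 a6, mul_nonneg a4 a6]
  refine HRel.lim hrel (neumann_tendsto (lt_of_le_of_lt hX (by norm_num))) ?_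
  rw [tendsto_iff_norm_sub_tendsto_zero]
  refine squeeze_zero (fun _ => norm_nonneg _) hb ?_
  have := (tendsto_pow_atTop_nhds_zero_of_lt_one (r := (1:ℝ)/2) (by norm_num) (by norm_num)).const_mul M
  simpa using this

/-- left multiplication by a Neumann inverse, in weighted norms -/
lemma Ent.inv_mul (hP : ProjFamily P) {p : ℝ} (hp : 1 < p) {g1 g2 : ℕ+ → ℕ+ → ℝ} {x b : ℝ}
    {X R M : 𝓗 →L[ℂ] 𝓗} (hXE : Ent P p g1 x X) (hME : Ent P p g2 b M) (hx : 0 ≤ x) (hb : 0 ≤ b)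
    (g10 : ∀ m n, 0 ≤ g1 m n) (g20 : ∀ m n, 0 ≤ g2 m n)
    (hg : ∀ m n l, g1 m l * g2 l n ≤ g2 m n)
    (hX : ‖X‖ < 1) (h1 : (1 - X) * R = 1) (h2 : R * (1 - X) = 1) {κ : ℝ} (hκ : Dc p * x = κ)
    (hκ1 : κ < 1) : Ent P p g2 (b / (1 - κ)) (R * M) := by
  have hκ0 : 0 ≤ κ := by
    rw [← hκ]; unfold Dc; have := Ssum_ge hp; positivity
  have hb' : 0 ≤ b / (1 - κ) := div_nonneg hb (by linarith)
  have key : ∀ j : ℕ, Ent P p g2 (b / (1 - κ)) (R * (1 - X ^ j) * M) := by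
    intro j
    induction j with
    | zero =>
      intro m n
      have := g20 m n
      have := jpos m n p
      simp only [pow_zero, sub_self, mul_zero, zero_mul, norm_zero]
      positivity
    | succ j ih =>
      rw [neumann_succ h1 h2, add_mul, one_mul, mul_assoc]
      have h3 := hME.add (Ent.mul hP hp (g3 := g2) (e := 1) hXE ih hx hb' zero_le_one g10 g20
        (fun m n l => by rw [one_mul]; exact hg m n l))
      refine h3.mono g20 (le_of_eq ?_)
      rw [mul_one, hκ]
      have : 1 - κ ≠ 0 := by linarith
      field_simp
      ring
  exact Ent.lim key ((neumann_tendsto hX).mul_const M)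

end rels

section c1

/-- strong `C¹` with explicit derivative -/
def SC1 (A A' : ℝ → 𝓗 →L[ℂ] 𝓗) : Prop :=
  (∀ ψ t, HasDerivAt (fun τ => A τ ψ) (A' t ψ) t) ∧ ∀ ψ, Continuous fun t => A' t ψ

lemma SC1.strong {A A' : ℝ → 𝓗 →L[ℂ] 𝓗} (h : SC1 A A') : StrongC1 A := by
  intro ψ
  rw [contDiff_one_iff_deriv]
  refine ⟨fun t => (h.1 ψ t).differentiableAt, ?_⟩
  have : deriv (fun t => A t ψ) = fun t => A' t ψ := funext fun t => (h.1 ψ t).deriv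
  rw [this]
  exact h.2 ψ

lemma StrongC1.sc1 {A : ℝ → 𝓗 →L[ℂ] 𝓗} (h : StrongC1 A) : ∃ A', SC1 A A' := by
  have hd : ∀ ψ t, HasDerivAt (fun τ => A τ ψ) (deriv (fun τ => A τ ψ) t) t := fun ψ t =>
    ((h ψ).differentiable one_ne_zero t).hasDerivAt
  have hlim : ∀ t ψ, Filter.Tendsto (fun n : ℕ => ((n:ℝ)+1) • (A (t + ((n:ℝ)+1)⁻¹) ψ - A t ψ)) Filter.atTop
      (nhds (deriv (fun τ => A τ ψ) t)) := by
    intro t ψ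
    have h1 := (hasDerivAt_iff_tendsto_slope_zero.1 (hd ψ t))
    have h2 : Filter.Tendsto (fun n : ℕ => ((n:ℝ)+1)⁻¹) Filter.atTop (nhdsWithin 0 {0}ᶜ) := by
      rw [tendsto_nhdsWithin_iff]
      refine ⟨?_, Filter.Eventually.of_forall fun n => ?_⟩
      · have := tendsto_one_div_add_atTop_nhds_zero_nat (𝕜 := ℝ)
        simpa using this
      · have : (0:ℝ) < (n:ℝ)+1 := by positivity
        simp only [Set.mem_compl_iff, Set.mem_singleton_iff]
        positivity
    have h3 := h1.comp h2
    refine h3.congr (fun n => ?_)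
    simp
  let A' : ℝ → 𝓗 →L[ℂ] 𝓗 := fun t =>
    continuousLinearMapOfTendsto
      (fun n : ℕ => (((n:ℝ)+1 : ℝ) : ℂ) • (A (t + ((n:ℝ)+1)⁻¹) - A t))
      (f := fun ψ => deriv (fun τ => A τ ψ) t)
      (tendsto_pi_nhds.2 (fun ψ => by
        refine (hlim t ψ).congr (fun n => ?_)
        simp only [ContinuousLinearMap.smul_apply, ContinuousLinearMap.sub_apply]
        rw [Complex.coe_smul]))
  refine ⟨A', fun ψ t => hd ψ t, fun ψ => ?_⟩
  exact (contDiff_one_iff_deriv.1 (h ψ)).2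

lemma loc_bdd {A : ℝ → 𝓗 →L[ℂ] 𝓗} (h : ∀ ψ, Continuous fun t => A t ψ) (a b : ℝ) :
    ∃ M, ∀ t ∈ Set.Icc a b, ‖A t‖ ≤ M := by
  obtain ⟨M, hM⟩ := banach_steinhaus (g := fun t : Set.Icc a b => A t) (by
    intro ψ
    obtain ⟨C, hC⟩ := isCompact_Icc.exists_bound_of_continuousOn (s := Set.Icc a b) ((h ψ).continuousOn)
    exact ⟨C, fun t => hC t t.2⟩)
  exact ⟨M, fun t ht => hM ⟨t, ht⟩⟩

lemma tendsto_apply_strong {A : ℝ → 𝓗 →L[ℂ] 𝓗} (h : ∀ ψ, Continuous fun t => A t ψ) {t : ℝ}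
    {l : Filter ℝ} (hl : l ≤ nhds t) {v : ℝ → 𝓗} {w : 𝓗} (hv : Filter.Tendsto v l (nhds w)) :
    Filter.Tendsto (fun τ => A τ (v τ)) l (nhds (A t w)) := by
  obtain ⟨M, hM⟩ := loc_bdd h (t-1) (t+1)
  have h1 : Filter.Tendsto (fun τ => A τ w) l (nhds (A t w)) :=
    ((h w).tendsto t).mono_left hl
  have h2 : Filter.Tendsto (fun τ => A τ (v τ - w)) l (nhds 0) := by
    have h3 : Filter.Tendsto (fun τ => M * ‖v τ - w‖) l (nhds 0) := by
      have := ((hv.sub_const w).norm).const_mul M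
      simpa using this
    refine squeeze_zero_norm' ?_ h3
    have : ∀ᶠ τ in l, τ ∈ Set.Icc (t-1) (t+1) :=
      hl (Icc_mem_nhds (by linarith) (by linarith))
    filter_upwards [this] with τ hτ
    exact le_trans (le_opNorm _ _) (mul_le_mul_of_nonneg_right (hM τ hτ) (norm_nonneg _))
  have := h1.add h2
  rw [add_zero] at this
  refine this.congr (fun τ => ?_)
  rw [map_sub]; abel

lemma SC1.cont {A A' : ℝ → 𝓗 →L[ℂ] 𝓗} (h : SC1 A A') (ψ : 𝓗) : Continuous fun t => A t ψ :=
  continuous_iff_continuousAt.2 (fun t => (h.1 ψ t).continuousAt)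

lemma SC1.mul {A A' B B' : ℝ → 𝓗 →L[ℂ] 𝓗} (hA : SC1 A A') (hB : SC1 B B') :
    SC1 (fun t => A t * B t) (fun t => A' t * B t + A t * B' t) := by
  constructor
  · intro ψ t
    rw [hasDerivAt_iff_tendsto_slope]
    have h1 := hasDerivAt_iff_tendsto_slope.1 (hB.1 ψ t)
    have h2 := hasDerivAt_iff_tendsto_slope.1 (hA.1 (B t ψ) t)
    have h3 := tendsto_apply_strong hA.cont (nhdsWithin_le_nhds (a := t) (s := {t}ᶜ)) h1
    refine (h2.add h3).congr (fun τ => ?_)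
    simp only [slope_def_module]
    change (τ - t)⁻¹ • (A τ (B t ψ) - A t (B t ψ)) + A τ ((τ - t)⁻¹ • (B τ ψ - B t ψ)) =
      (τ - t)⁻¹ • (A τ (B τ ψ) - A t (B t ψ))
    have : A τ ((τ - t)⁻¹ • (B τ ψ - B t ψ)) = (τ - t)⁻¹ • A τ (B τ ψ - B t ψ) :=
      (A τ).map_smul_of_tower _ _
    rw [this, ← smul_add, map_sub]
    congr 1; abel
  · intro ψ
    have a1 : Continuous fun t => A' t (B t ψ) := continuous_iff_continuousAt.2 (fun t =>
      tendsto_apply_strong hA.2 le_rfl ((hB.cont ψ).tendsto t))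
    have a2 : Continuous fun t => A t (B' t ψ) := continuous_iff_continuousAt.2 (fun t =>
      tendsto_apply_strong hA.cont le_rfl ((hB.2 ψ).tendsto t))
    exact a1.add a2

lemma StrongC1.mul {A B : ℝ → 𝓗 →L[ℂ] 𝓗} (hA : StrongC1 A) (hB : StrongC1 B) :
    StrongC1 (fun t => A t * B t) := by
  obtain ⟨A', hA'⟩ := hA.sc1
  obtain ⟨B', hB'⟩ := hB.sc1
  exact (hA'.mul hB').strong

lemma StrongC1.add {A B : ℝ → 𝓗 →L[ℂ] 𝓗} (hA : StrongC1 A) (hB : StrongC1 B) :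
    StrongC1 (fun t => A t + B t) := fun ψ => (hA ψ).add (hB ψ)

lemma StrongC1.sub {A B : ℝ → 𝓗 →L[ℂ] 𝓗} (hA : StrongC1 A) (hB : StrongC1 B) :
    StrongC1 (fun t => A t - B t) := fun ψ => (hA ψ).sub (hB ψ)

lemma StrongC1.const (A : 𝓗 →L[ℂ] 𝓗) : StrongC1 (fun _ : ℝ => A) := fun _ => contDiff_const

lemma StrongC1.smul {A : ℝ → 𝓗 →L[ℂ] 𝓗} (hA : StrongC1 A) (c : ℂ) :
    StrongC1 (fun t => c • A t) := by
  have := (StrongC1.const (c • (1 : 𝓗 →L[ℂ] 𝓗))).mul hA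
  simpa using this

lemma strongC1_of_hasDerivAt {A A' : ℝ → 𝓗 →L[ℂ] 𝓗} (h : ∀ t, HasDerivAt A (A' t) t)
    (hc : Continuous A') : SC1 A A' := by
  constructor
  · intro ψ t
    exact ((ContinuousLinearMap.apply ℂ 𝓗 ψ).restrictScalars ℝ).hasFDerivAt.comp_hasDerivAt t (h t)
  · intro ψ
    exact (ContinuousLinearMap.apply ℂ 𝓗 ψ).continuous.comp hc

/-- strongly `C¹` implies norm continuous -/
lemma StrongC1.continuous {A : ℝ → 𝓗 →L[ℂ] 𝓗} (hA : StrongC1 A) : Continuous A := by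
  obtain ⟨A', h⟩ := hA.sc1
  rw [continuous_iff_continuousAt]
  intro t
  obtain ⟨M, hM⟩ := loc_bdd h.2 (t-1) (t+1)
  have hb : ∀ τ ∈ Set.Icc (t-1) (t+1), ‖A τ - A t‖ ≤ M * ‖τ - t‖ := by
    intro τ hτ
    have hM0 : 0 ≤ M := le_trans (norm_nonneg _) (hM τ hτ)
    refine opNorm_le_bound _ (by positivity) (fun ψ => ?_)
    have := (convex_Icc (t-1) (t+1)).norm_image_sub_le_of_norm_hasDerivWithin_le
      (f := fun τ => A τ ψ) (f' := fun τ => A' τ ψ) (C := M * ‖ψ‖) (x := t) (y := τ)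
      (fun x _ => (h.1 ψ x).hasDerivWithinAt)
      (fun x hx => le_trans (le_opNorm _ _) (mul_le_mul_of_nonneg_right (hM x hx) (norm_nonneg _)))
      ⟨by linarith, by linarith⟩ hτ
    calc _ ≤ M * ‖ψ‖ * ‖τ - t‖ := this
      _ = _ := by ring
  rw [ContinuousAt, tendsto_iff_norm_sub_tendsto_zero]
  refine squeeze_zero' (Filter.Eventually.of_forall fun _ => norm_nonneg _)
    (g := fun τ => M * ‖τ - t‖) ?_ ?_
  · filter_upwards [Icc_mem_nhds (show t - 1 < t by linarith) (show t < t + 1 by linarith)] with τ hτ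
    exact hb τ hτ
  · have : Continuous fun τ : ℝ => M * ‖τ - t‖ := by fun_prop
    have := this.tendsto t
    simpa using this

end c1

section gauge
variable {P : ℕ+ → 𝓗 →L[ℂ] 𝓗} {E : ℕ+ → ℝ}

/-- `H + M'` is obtained from `H + M` by a periodic unitary gauge transformation -/
def Gauge (P : ℕ+ → 𝓗 →L[ℂ] 𝓗) (E : ℕ+ → ℝ) (T : ℝ) (M M' : ℝ → 𝓗 →L[ℂ] 𝓗) : Prop :=
  ∃ U U' K : ℝ → 𝓗 →L[ℂ] 𝓗, (∀ t, IsUnitaryOp (U t)) ∧ (∀ t, U (t + T) = U t) ∧ SC1 U U' ∧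
    (∀ t, HRel P E (star (U t)) (K t)) ∧
    ∀ t, M' t = U t * K t + U t * M t * star (U t) + Complex.I • (U' t * star (U t))

lemma Gauge.refl (hP : ProjFamily P) (T : ℝ) (M : ℝ → 𝓗 →L[ℂ] 𝓗) : Gauge P E T M M := by
  refine ⟨fun _ => 1, fun _ => 0, fun _ => 0, fun t => ?_, fun _ => rfl, ?_, fun t => ?_, fun t => ?_⟩
  · simp [IsUnitaryOp]
  · exact strongC1_of_hasDerivAt (fun t => hasDerivAt_const t _) continuous_const
  · rw [star_one]; exact HRel.one hP
  · simp

lemma Gauge.trans (hP : ProjFamily P) {T : ℝ} {M M' M'' : ℝ → 𝓗 →L[ℂ] 𝓗} (h : Gauge P E T M M')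
    (h' : Gauge P E T M' M'') : Gauge P E T M M'' := by
  obtain ⟨U, U', K, hu, hper, hc, hK, hM⟩ := h
  obtain ⟨V, V', L, vu, vper, vc, hL, hM'⟩ := h'
  refine ⟨fun t => V t * U t, fun t => V' t * U t + V t * U' t,
    fun t => K t * star (V t) + star (U t) * L t, fun t => ?_, fun t => ?_, vc.mul hc, fun t => ?_,
    fun t => ?_⟩
  · have h1 := hu t
    have h2 := vu t
    constructor
    · rw [star_mul, mul_assoc, ← mul_assoc (U t), h1.1, one_mul, h2.1]
    · rw [star_mul, mul_assoc, ← mul_assoc (star (V t)), h2.2, one_mul, h1.2]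
  · simp only [vper, hper]
  · rw [star_mul]
    exact (hK t).mul hP (hL t)
  · have h1 := (hu t).1
    rw [hM', hM]
    have e1 : V' t * U t * (star (U t) * star (V t)) = V' t * star (V t) := by
      rw [mul_assoc, ← mul_assoc (U t), h1, one_mul]
    have e2 : V t * U t * (star (U t) * L t) = V t * L t := by
      rw [mul_assoc, ← mul_assoc (U t), h1, one_mul]
    rw [star_mul, mul_add (V t * U t), e2, add_mul (V' t * U t), e1, mul_add, mul_add, add_mul, add_mul]
    simp only [smul_add, mul_smul_comm, smul_mul_assoc, mul_assoc]
    abel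

/-- the conclusion of the theorem from a gauge transformation -/
lemma Gauge.final (hP : ProjFamily P) {T : ℝ} {M M' : ℝ → 𝓗 →L[ℂ] 𝓗} (h : Gauge P E T M M') :
    ∃ 𝒰 : ℝ → 𝓗 →L[ℂ] 𝓗, (∀ t, IsUnitaryOp (𝒰 t)) ∧ (∀ t, 𝒰 (t + T) = 𝒰 t) ∧ StrongC1 𝒰 ∧
      (∀ t : ℝ, ⇑(star (𝒰 t)) '' HDom P E = HDom P E) ∧
      (∀ t : ℝ, ∀ ψ ∈ HDom P E, ∀ h₁ h₂ : 𝓗,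
        IsHSum P E ψ h₁ → IsHSum P E (star (𝒰 t) ψ) h₂ →
        h₁ + M' t ψ = 𝒰 t (h₂ + M t (star (𝒰 t) ψ)) +
            Complex.I • deriv (fun τ => 𝒰 τ (star (𝒰 t) ψ)) t) := by
  obtain ⟨U, U', K, hu, hper, hc, hK, hM⟩ := h
  have hU1 : ∀ t ψ, U t (star (U t) ψ) = ψ := fun t ψ =>
    congrArg (fun A : 𝓗 →L[ℂ] 𝓗 => A ψ) (hu t).1
  have hU2 : ∀ t ψ, star (U t) (U t ψ) = ψ := fun t ψ =>
    congrArg (fun A : 𝓗 →L[ℂ] 𝓗 => A ψ) (hu t).2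
  refine ⟨U, hu, hper, hc.strong, fun t => ?_, fun t ψ hψ h₁ h₂ H1 H2 => ?_⟩
  · apply Set.Subset.antisymm
    · rintro _ ⟨ψ, hψ, rfl⟩
      obtain ⟨η, hη⟩ := (hdom_iff hP ψ).1 hψ
      exact (hdom_iff hP _).2 ⟨_, (hK t).dom hP hη⟩
    · intro ψ hψ
      obtain ⟨η, hη⟩ := (hdom_iff hP ψ).1 hψ
      have h2 := (hK t).star hP
      rw [star_star] at h2
      exact ⟨U t ψ, (hdom_iff hP _).2 ⟨_, h2.dom hP hη⟩, hU2 t ψ⟩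
  · have e1 : h₂ = K t ψ + star (U t) h₁ := HasSum.unique H2 ((hK t).dom hP H1)
    rw [(hc.1 (star (U t) ψ) t).deriv, hM, e1]
    change h₁ + (U t (K t ψ) + U t (M t (star (U t) ψ)) + Complex.I • U' t (star (U t) ψ)) = _
    rw [map_add, map_add, hU1]
    abel

end gauge


section weights

def wB (γ : ℝ) (j : ℕ) (m n : ℕ+) : ℝ := (mxu γ m n ^ (j+2))⁻¹
def wW (γ : ℝ) (j : ℕ) (m n : ℕ+) : ℝ := (mnu γ m n / mxu γ m n) ^ (j+2)
def wF (γ : ℝ) (j : ℕ) (m n : ℕ+) : ℝ := (jd m n)⁻¹ * (mxu γ m n ^ (j+1))⁻¹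
def wZ (γ : ℝ) (j : ℕ) (m n : ℕ+) : ℝ := (mxu γ m n ^ (j+1))⁻¹
def wX (γ : ℝ) (j : ℕ) (m n : ℕ+) : ℝ := (jd m n)⁻¹ * (mxu γ m n ^ j)⁻¹

variable {γ : ℝ}

lemma mxu_pos (hγ : 0 < γ) (m n : ℕ+) : 0 < mxu γ m n := lt_of_lt_of_le one_pos (mxu_ge hγ m n)
lemma mnu_pos (hγ : 0 < γ) (m n : ℕ+) : 0 < mnu γ m n := lt_of_lt_of_le one_pos (mnu_ge hγ m n)

lemma wB_pos (hγ : 0 < γ) (j : ℕ) (m n : ℕ+) : 0 < wB γ j m n := by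
  have := mxu_pos hγ m n; unfold wB; positivity
lemma wW_pos (hγ : 0 < γ) (j : ℕ) (m n : ℕ+) : 0 < wW γ j m n := by
  have := mxu_pos hγ m n; have := mnu_pos hγ m n; unfold wW; positivity
lemma wF_pos (hγ : 0 < γ) (j : ℕ) (m n : ℕ+) : 0 < wF γ j m n := by
  have := mxu_pos hγ m n; have := jd_pos m n; unfold wF; positivity
lemma wZ_pos (hγ : 0 < γ) (j : ℕ) (m n : ℕ+) : 0 < wZ γ j m n := by
  have := mxu_pos hγ m n; unfold wZ; positivity
lemma wX_pos (hγ : 0 < γ) (j : ℕ) (m n : ℕ+) : 0 < wX γ j m n := by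
  have := mxu_pos hγ m n; have := jd_pos m n; unfold wX; positivity

lemma wB_symm (j : ℕ) (m n : ℕ+) : wB γ j m n = wB γ j n m := by unfold wB; rw [mxu_symm]
lemma wW_symm (j : ℕ) (m n : ℕ+) : wW γ j m n = wW γ j n m := by
  unfold wW; rw [mxu_symm, mnu_symm]
lemma wF_symm (j : ℕ) (m n : ℕ+) : wF γ j m n = wF γ j n m := by
  unfold wF; rw [mxu_symm, jd_symm]
lemma wZ_symm (j : ℕ) (m n : ℕ+) : wZ γ j m n = wZ γ j n m := by unfold wZ; rw [mxu_symm]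
lemma wX_symm (j : ℕ) (m n : ℕ+) : wX γ j m n = wX γ j n m := by
  unfold wX; rw [mxu_symm, jd_symm]

lemma W1 (hγ : 0 < γ) (hγh : γ < 1/2) (j : ℕ) (m n l : ℕ+) :
    wF γ j m l * wF γ j l n ≤ 2 * wB γ j m n := by
  unfold wF wB
  have a1 := mxu_ge hγ m l
  have a2 := mxu_ge hγ l n
  have a3 := mxu_ge hγ m n
  have b1 := jd_ge m l
  have b2 := jd_ge l n
  have c1 := mxu_le_two hγ hγh m n l
  have c2 := mxu_le_two hγ hγh n m l
  rw [mxu_symm γ n m, jd_symm n l, mxu_symm γ l m] at c2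
  set A := mxu γ m l
  set B := mxu γ l n
  set M := mxu γ m n
  have key : M ^ (j+2) ≤ 2 * (jd m l * A^(j+1) * (jd l n * B^(j+1))) := by
    rw [pow_succ]
    rcases mxu_le_max hγ m n l with h | h
    · have h1 : M ^ (j+1) ≤ A ^ (j+1) := pow_le_pow_left₀ (by linarith) h _
      have h2 : B ≤ B ^ (j+1) := le_self_pow₀ a2 (by omega)
      calc M^(j+1) * M ≤ A^(j+1) * (2 * jd m l * B^(j+1)) := by
            apply mul_le_mul h1 (le_trans c1 _) (by linarith) (by positivity)
            gcongr
        _ = 2 * (jd m l * A^(j+1) * (1 * B^(j+1))) := by ring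
        _ ≤ _ := by gcongr
    · have h1 : M ^ (j+1) ≤ B ^ (j+1) := pow_le_pow_left₀ (by linarith) h _
      have h2 : A ≤ A ^ (j+1) := le_self_pow₀ a1 (by omega)
      calc M^(j+1) * M ≤ B^(j+1) * (2 * jd l n * A^(j+1)) := by
            apply mul_le_mul h1 (le_trans c2 _) (by linarith) (by positivity)
            gcongr
        _ = 2 * (1 * A^(j+1) * (jd l n * B^(j+1))) := by ring
        _ ≤ _ := by gcongr
  have : 0 < M := by linarith
  have : 0 < A := by linarith
  have : 0 < B := by linarith
  have : 0 < jd m l := by linarith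
  have : 0 < jd l n := by linarith
  rw [← mul_inv, ← mul_inv, ← mul_inv, ← div_eq_mul_inv, inv_eq_one_div, div_le_div_iff₀ (by positivity) (by positivity)]
  linarith

lemma W2 (hγ : 0 < γ) (j : ℕ) (m n l : ℕ+) :
    wW γ j m l * wB γ j l n ≤ wB γ j m n := by
  unfold wW wB
  have a1 := mxu_pos hγ m l
  have a2 := mxu_pos hγ l n
  have a3 := mxu_pos hγ m n
  have a4 := mnu_pos hγ m l
  rw [← inv_pow, ← inv_pow, ← mul_pow]
  apply pow_le_pow_left₀ (by positivity)
  rw [div_mul_eq_mul_div, ← div_eq_mul_inv, div_div, inv_eq_one_div, div_le_div_iff₀ (by positivity) (by positivity)]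
  have := mxu_mul_mnu_le hγ m n l
  linarith

lemma W3 (hγ : 0 < γ) (hγh : γ < 1/2) (j : ℕ) (m n : ℕ+) : wF γ j m n ≤ 2 * wW γ j m n := by
  unfold wF wW
  have a1 := mxu_pos hγ m n
  have a4 := mnu_ge hγ m n
  have a5 := jd_pos m n
  have c := mxu_le_two_min hγ hγh m n
  set M := mxu γ m n
  set u := mnu γ m n
  have h2 : u ≤ u ^ (j+2) := le_self_pow₀ a4 (by omega)
  rw [div_pow, ← mul_inv, inv_eq_one_div, ← mul_div_assoc, div_le_div_iff₀ (by positivity) (by positivity)]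
  calc 1 * M^(j+2) = M * M^(j+1) := by ring
    _ ≤ 2 * jd m n * u^(j+2) * M^(j+1) := by
      gcongr; exact le_trans c (by gcongr)
    _ = _ := by ring

lemma W4 (hγ : 0 < γ) (hγh : γ < 1/2) (j : ℕ) (m n : ℕ+) :
    (jd m n)⁻¹ * wX γ j m n ≤ 4 * wW γ j m n := by
  unfold wX wW
  have a1 := mxu_pos hγ m n
  have a4 := mnu_ge hγ m n
  have a5 := jd_pos m n
  have c := mxu_le_two_min hγ hγh m n
  set M := mxu γ m n
  set u := mnu γ m n
  have h2 : u ^ 2 ≤ u ^ (j+2) := pow_le_pow_right₀ a4 (by omega)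
  rw [div_pow, ← mul_inv, ← mul_inv, inv_eq_one_div, ← mul_div_assoc, div_le_div_iff₀ (by positivity) (by positivity)]
  calc 1 * M^(j+2) = M^2 * M^j := by ring
    _ ≤ (2 * jd m n * u)^2 * M^j := by gcongr
    _ = 4 * (jd m n)^2 * u^2 * M^j := by ring
    _ ≤ 4 * (jd m n)^2 * u^(j+2) * M^j := by gcongr
    _ = _ := by ring

lemma W5 (hγ : 0 < γ) (hγh : γ < 1/2) (j : ℕ) (m n l : ℕ+) :
    wZ γ j m l * wX γ j l n ≤ 2 * wZ γ j m n := by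
  unfold wX wZ
  have a1 := mxu_ge hγ m l
  have a2 := mxu_ge hγ l n
  have a3 := mxu_ge hγ m n
  have b2 := jd_ge l n
  have c2 := mxu_le_two hγ hγh n m l
  rw [mxu_symm γ n m, jd_symm n l, mxu_symm γ l m] at c2
  set A := mxu γ m l
  set B := mxu γ l n
  set M := mxu γ m n
  have key : M ^ (j+1) ≤ 2 * (A^(j+1) * (jd l n * B^j)) := by
    rcases mxu_le_max hγ m n l with h | h
    · have h1 : M ^ (j+1) ≤ A ^ (j+1) := pow_le_pow_left₀ (by linarith) h _
      have h2 : 1 ≤ B ^ j := one_le_pow₀ a2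
      calc M^(j+1) ≤ A^(j+1) * (1 * 1) := by linarith
        _ ≤ A^(j+1) * (jd l n * B^j) := by gcongr
        _ ≤ _ := by
          have : 0 ≤ A^(j+1) * (jd l n * B^j) := by positivity
          linarith
    · have h1 : M ^ j ≤ B ^ j := pow_le_pow_left₀ (by linarith) h _
      have h2 : A ≤ A ^ (j+1) := le_self_pow₀ a1 (by omega)
      calc M^(j+1) = M^j * M := pow_succ _ _
        _ ≤ B^j * (2 * jd l n * A^(j+1)) := by
            apply mul_le_mul h1 (le_trans c2 _) (by linarith) (by positivity)
            gcongr
        _ = _ := by ring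
  have : 0 < M := by linarith
  have : 0 < A := by linarith
  have : 0 < B := by linarith
  have : 0 < jd l n := by linarith
  rw [← mul_inv, ← mul_inv, ← div_eq_mul_inv, inv_eq_one_div, div_le_div_iff₀ (by positivity) (by positivity)]
  linarith

lemma mxu_pow (m n : ℕ+) (j : ℕ) : (((max m n : ℕ+) : ℕ) : ℝ) ^ (2 * ((j:ℝ) * γ)) = mxu γ m n ^ j := by
  unfold mxu
  rw [← Real.rpow_natCast, ← Real.rpow_mul (by positivity)]
  congr 1; ring

lemma jd_rpow_succ (m n : ℕ+) (r : ℝ) : jd m n ^ r = jd m n ^ (r - 1) * jd m n := by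
  have := jd_pos m n
  rw [Real.rpow_sub_one (by positivity)]
  field_simp

variable {P : ℕ+ → 𝓗 →L[ℂ] 𝓗}

lemma ent_iff (hγ : 0 < γ) {r z : ℝ} {j : ℕ} {A : 𝓗 →L[ℂ] 𝓗} (m n : ℕ+) :
    wnorm P r ((j : ℝ) * γ) A m n ≤ z ↔
      ‖P m * A * P n‖ ≤ z * ((jd m n ^ r)⁻¹ * (mxu γ m n ^ j)⁻¹) := by
  unfold wnorm
  rw [mxu_pow]
  change jd m n ^ r * mxu γ m n ^ j * ‖P m * (A * P n)‖ ≤ z ↔ _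
  rw [← mul_assoc (P m)]
  have := jpos m n r
  have := mxu_pos hγ m n
  rw [← mul_inv, ← div_eq_mul_inv, le_div_iff₀ (by positivity), mul_comm]

lemma ent_ZF {r z : ℝ} {j : ℕ} {A : 𝓗 →L[ℂ] 𝓗} (h : Ent P r (wZ γ j) z A) :
    Ent P (r - 1) (wF γ j) z A := by
  intro m n
  have := h m n
  rw [jd_rpow_succ, mul_inv, mul_assoc _ _ (wZ γ j m n)] at this
  exact this

lemma ent_FW (hγ : 0 < γ) (hγh : γ < 1/2) {q z : ℝ} (hz : 0 ≤ z) {j : ℕ} {A : 𝓗 →L[ℂ] 𝓗}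
    (h : Ent P q (wF γ j) z A) : Ent P q (wW γ j) (2 * z) A := by
  intro m n
  refine le_trans (h m n) ?_
  have h1 := W3 hγ hγh j m n
  have h2 := jpos m n q
  calc z * ((jd m n ^ q)⁻¹ * wF γ j m n) ≤ z * ((jd m n ^ q)⁻¹ * (2 * wW γ j m n)) := by gcongr
    _ = _ := by ring

lemma ent_XW (hγ : 0 < γ) (hγh : γ < 1/2) {r z : ℝ} (hz : 0 ≤ z) {j : ℕ} {A : 𝓗 →L[ℂ] 𝓗}
    (h : Ent P r (wX γ j) z A) : Ent P (r - 1) (wW γ j) (4 * z) A := by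
  intro m n
  refine le_trans (h m n) ?_
  rw [jd_rpow_succ, mul_inv, mul_assoc _ _ (wX γ j m n)]
  have h1 := W4 hγ hγh j m n
  have h2 := jpos m n (r-1)
  calc z * ((jd m n ^ (r-1))⁻¹ * ((jd m n)⁻¹ * wX γ j m n))
      ≤ z * ((jd m n ^ (r-1))⁻¹ * (4 * wW γ j m n)) := by gcongr
    _ = _ := by ring

/-- crude operator norm bound -/
lemma ent_norm (hP : ProjFamily P) {p : ℝ} (hp : 1 < p) {g : ℕ+ → ℕ+ → ℝ} (hg : ∀ m n, g m n ≤ 1)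
    {a : ℝ} (ha : 0 ≤ a) {A : 𝓗 →L[ℂ] 𝓗} (h : Ent P p g a A) : ‖A‖ ≤ a * Ssum p := by
  refine schur hP hp ha A (fun m n => le_trans (h m n) ?_)
  have h2 := jpos m n p
  have := hg m n
  calc a * ((jd m n ^ p)⁻¹ * g m n) ≤ a * ((jd m n ^ p)⁻¹ * 1) := by gcongr
    _ = _ := by ring

lemma wB_le (hγ : 0 < γ) (j : ℕ) (m n : ℕ+) : wB γ j m n ≤ 1 :=
  inv_le_one_of_one_le₀ (one_le_pow₀ (mxu_ge hγ m n))
lemma wZ_le (hγ : 0 < γ) (j : ℕ) (m n : ℕ+) : wZ γ j m n ≤ 1 :=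
  inv_le_one_of_one_le₀ (one_le_pow₀ (mxu_ge hγ m n))
lemma wX_le (hγ : 0 < γ) (j : ℕ) (m n : ℕ+) : wX γ j m n ≤ 1 :=
  mul_le_one₀ (inv_le_one_of_one_le₀ (jd_ge m n))
    (inv_nonneg.2 (pow_nonneg (mxu_pos hγ m n).le _))
    (inv_le_one_of_one_le₀ (one_le_pow₀ (mxu_ge hγ m n)))
lemma wF_le (hγ : 0 < γ) (j : ℕ) (m n : ℕ+) : wF γ j m n ≤ 1 :=
  mul_le_one₀ (inv_le_one_of_one_le₀ (jd_ge m n))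
    (inv_nonneg.2 (pow_nonneg (mxu_pos hγ m n).le _))
    (inv_le_one_of_one_le₀ (one_le_pow₀ (mxu_ge hγ m n)))

lemma Dc_pos {p : ℝ} (hp : 1 < p) : 0 < Dc p := by
  unfold Dc; have := Ssum_ge hp; positivity

lemma Dc_ge {p : ℝ} (hp : 1 < p) : 12 ≤ Dc p := by
  unfold Dc; have := Ssum_ge hp
  have h : (2:ℝ)^(2:ℝ) ≤ 2 ^ (p+1) := Real.rpow_le_rpow_of_exponent_le (by norm_num) (by linarith)
  norm_num at h
  nlinarith

lemma Cconst_eq (r : ℝ) : Cconst r = 2 * Dc (r - 1) := by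
  unfold Cconst Dc Ssum
  rw [sub_add_cancel, Real.rpow_add_one (by norm_num)]; ring

lemma FF_B (hP : ProjFamily P) (hγ : 0 < γ) (hγh : γ < 1/2) {q f z : ℝ} (hq : 1 < q) (hf : 0 ≤ f)
    (hz : 0 ≤ z) {j : ℕ} {F Z : 𝓗 →L[ℂ] 𝓗} (hF : Ent P q (wF γ j) f F) (hZ : Ent P q (wF γ j) z Z) :
    Ent P q (wB γ j) (2 * Dc q * f * z) (F * Z) := by
  refine (Ent.mul hP hq hF hZ hf hz (by norm_num : (0:ℝ) ≤ 2) (fun m n => (wF_pos hγ j m n).le)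
    (fun m n => (wB_pos hγ j m n).le) (fun m n l => W1 hγ hγh j m n l)).mono
    (fun m n => (wB_pos hγ j m n).le) (le_of_eq (by ring))

lemma WB_B (hP : ProjFamily P) (hγ : 0 < γ) {q f z : ℝ} (hq : 1 < q) (hf : 0 ≤ f)
    (hz : 0 ≤ z) {j : ℕ} {F Z : 𝓗 →L[ℂ] 𝓗} (hF : Ent P q (wW γ j) f F) (hZ : Ent P q (wB γ j) z Z) :
    Ent P q (wB γ j) (Dc q * f * z) (F * Z) := by
  refine (Ent.mul hP hq hF hZ hf hz (by norm_num : (0:ℝ) ≤ 1) (fun m n => (wW_pos hγ j m n).le)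
    (fun m n => (wB_pos hγ j m n).le) (fun m n l => by rw [one_mul]; exact W2 hγ j m n l)).mono
    (fun m n => (wB_pos hγ j m n).le) (le_of_eq (by ring))

/-- conjugating a right multiplication into a left one -/
lemma ent_star_iff (hP : ProjFamily P) {p : ℝ} {g : ℕ+ → ℕ+ → ℝ} (hg : ∀ m n, g m n = g n m) {a : ℝ}
    {A : 𝓗 →L[ℂ] 𝓗} : Ent P p g a (star A) ↔ Ent P p g a A :=
  ⟨fun h => by have := h.star hP hg; rwa [star_star] at this, fun h => h.star hP hg⟩

lemma BW_B (hP : ProjFamily P) (hγ : 0 < γ) {q f z : ℝ} (hq : 1 < q) (hf : 0 ≤ f)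
    (hz : 0 ≤ z) {j : ℕ} {F Z : 𝓗 →L[ℂ] 𝓗} (hF : Ent P q (wW γ j) f F) (hZ : Ent P q (wB γ j) z Z) :
    Ent P q (wB γ j) (Dc q * f * z) (Z * F) := by
  rw [← ent_star_iff hP (wB_symm j), star_mul]
  exact WB_B hP hγ hq hf hz (hF.star hP (wW_symm j)) (hZ.star hP (wB_symm j))

end weights


section prim
variable {V W : Type*} [NormedAddCommGroup V] [NormedSpace ℝ V] [CompleteSpace V]
  [NormedAddCommGroup W] [NormedSpace ℝ W] [CompleteSpace W]

def pavg (G : ℝ → V) (T : ℝ) : V := T⁻¹ • ∫ s in (0:ℝ)..T, G s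

def pprim (G : ℝ → V) (T t : ℝ) : V := (∫ s in (0:ℝ)..t, G s) - t • pavg G T

lemma pprim_deriv {G : ℝ → V} (hG : Continuous G) (T t : ℝ) :
    HasDerivAt (pprim G T) (G t - pavg G T) t := by
  have h1 : HasDerivAt (fun t => ∫ s in (0:ℝ)..t, G s) (G t) t := hG.integral_hasStrictDerivAt 0 t |>.hasDerivAt
  have h2 : HasDerivAt (fun t : ℝ => t • pavg G T) ((1:ℝ) • pavg G T) t := (hasDerivAt_id t).smul_const _
  rw [one_smul] at h2
  exact h1.sub h2

lemma pprim_per {G : ℝ → V} (hG : Continuous G) {T : ℝ} (hT : 0 < T) (hper : ∀ t, G (t + T) = G t) (t : ℝ) :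
    pprim G T (t + T) = pprim G T t := by
  have h1 : ∫ s in t..(t+T), G s = ∫ s in (0:ℝ)..T, G s := by
    have := (show Function.Periodic G T from hper).intervalIntegral_add_eq t 0
    simpa using this
  have h2 := intervalIntegral.integral_add_adjacent_intervals (hG.intervalIntegrable (μ := MeasureTheory.volume) 0 t)
    (hG.intervalIntegrable (μ := MeasureTheory.volume) t (t+T))
  unfold pprim
  rw [← h2, h1, add_smul]
  have : T • pavg G T = ∫ s in (0:ℝ)..T, G s := by
    unfold pavg; rw [smul_smul, mul_inv_cancel₀ hT.ne', one_smul]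
  rw [this]; abel

lemma pavg_map {G : ℝ → V} (hG : Continuous G) (T : ℝ) (Λ : V →L[ℝ] W) :
    Λ (pavg G T) = pavg (fun s => Λ (G s)) T := by
  unfold pavg
  rw [map_smul, ← Λ.intervalIntegral_comp_comm (hG.intervalIntegrable _ _)]

lemma pprim_map {G : ℝ → V} (hG : Continuous G) (T t : ℝ) (Λ : V →L[ℝ] W) :
    Λ (pprim G T t) = pprim (fun s => Λ (G s)) T t := by
  unfold pprim
  rw [map_sub, map_smul, pavg_map hG, ← Λ.intervalIntegral_comp_comm (hG.intervalIntegrable _ _)]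

lemma pavg_bound {G : ℝ → V} {T : ℝ} (hT : 0 < T) {w : ℝ} (hw : ∀ s, ‖G s‖ ≤ w) :
    ‖pavg G T‖ ≤ w := by
  have := intervalIntegral.norm_integral_le_of_norm_le_const (a := 0) (b := T) (f := G) (C := w) (fun s _ => hw s)
  unfold pavg
  rw [norm_smul, norm_inv, Real.norm_eq_abs, abs_of_pos hT]
  rw [sub_zero, abs_of_pos hT] at this
  rw [inv_mul_le_iff₀ hT]; linarith

lemma pprim_bound {G : ℝ → V} (hG : Continuous G) {T : ℝ} (hT : 0 < T) (hper : ∀ t, G (t + T) = G t)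
    {w : ℝ} (hw : ∀ s, ‖G s‖ ≤ w) (t : ℝ) : ‖pprim G T t‖ ≤ T / 2 * w := by
  have hw0 : 0 ≤ w := le_trans (norm_nonneg _) (hw 0)
  obtain ⟨s, hs, he⟩ := (show Function.Periodic (pprim G T) T from pprim_per hG hT hper).exists_mem_Ico₀ hT t
  rw [he]
  have h2 := intervalIntegral.integral_add_adjacent_intervals (hG.intervalIntegrable (μ := MeasureTheory.volume) 0 s)
    (hG.intervalIntegrable (μ := MeasureTheory.volume) s T)
  have a := intervalIntegral.norm_integral_le_of_norm_le_const (a := 0) (b := s) (f := G) (C := w) (fun s _ => hw s)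
  have b := intervalIntegral.norm_integral_le_of_norm_le_const (a := s) (b := T) (f := G) (C := w) (fun s _ => hw s)
  rw [sub_zero, abs_of_nonneg hs.1] at a
  rw [abs_of_nonneg (by linarith [hs.2])] at b
  have e : pprim G T s = (1 - s/T) • (∫ s in (0:ℝ)..s, G s) - (s/T) • ∫ s in s..T, G s := by
    unfold pprim pavg
    rw [← h2, smul_smul, smul_add, sub_smul, one_smul, div_eq_mul_inv]; abel
  have h3 : s / T ≤ 1 := by rw [div_le_one hT]; exact hs.2.le
  have h4 : 0 ≤ s / T := div_nonneg hs.1 hT.le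
  rw [e]
  refine le_trans (norm_sub_le _ _) ?_
  rw [norm_smul, norm_smul, Real.norm_eq_abs, Real.norm_eq_abs, abs_of_nonneg h4, abs_of_nonneg (by linarith)]
  have h5 : (1 - s/T) * ‖∫ s in (0:ℝ)..s, G s‖ ≤ (1 - s/T) * (w * s) :=
    mul_le_mul_of_nonneg_left a (by linarith)
  have h6 := mul_le_mul_of_nonneg_left b h4
  have h7 : (1 - s/T) * (w * s) + s/T * (w * (T - s)) ≤ T/2 * w := by
    set x := s / T
    have : s = x * T := by simp only [x]; field_simp
    rw [this]
    nlinarith [mul_nonneg (mul_nonneg hw0 hT.le) (sq_nonneg (1 - 2 * x))]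
  linarith

end prim

section FC
variable {P : ℕ+ → 𝓗 →L[ℂ] 𝓗} {E : ℕ+ → ℝ} {γ CH : ℝ}

/-- upper gap bound -/
def UGap (E : ℕ+ → ℝ) (γ CH : ℝ) : Prop := ∀ m n : ℕ+, |E m - E n| ≤ CH * jd m n * (mxu γ m n)⁻¹

lemma HRel.ent (hγ : 0 < γ) (hE : UGap E γ CH) {j : ℕ} {r f : ℝ} {F C : 𝓗 →L[ℂ] 𝓗}
    (hCH : 0 ≤ CH) (h : HRel P E F C)
    (hF : Ent P r (wZ γ j) f F) : Ent P (r - 1) (wB γ j) (CH * f) C := by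
  intro m n
  rw [h m n, norm_smul, Complex.norm_real, Real.norm_eq_abs]
  have h1 := hE m n
  have h2 := hF m n
  have hj := jd_pos m n
  have hm := mxu_pos hγ m n
  have h3 := jpos m n (r-1)
  calc _ ≤ (CH * jd m n * (mxu γ m n)⁻¹) * (f * ((jd m n ^ r)⁻¹ * wZ γ j m n)) := by
        gcongr
    _ = _ := by
        rw [jd_rpow_succ]
        unfold wZ wB
        field_simp
        ring

lemma exists_L (hP : ProjFamily P) (hγ : 0 < γ) (hE : UGap E γ CH) {j : ℕ} {r f : ℝ} (hr : 2 < r)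
    (hCH : 0 ≤ CH) (hf : 0 ≤ f) (F : 𝓗 →L[ℂ] 𝓗) (hF : Ent P r (wZ γ j) f F) : ∃ L, HRel P E F L := by
  obtain ⟨L, h1, _⟩ := blockOp hP (p := r - 1) (by linarith) (c := CH * f) (by positivity)
    (fun m n => ((E m - E n : ℝ) : ℂ) • (P m * F * P n))
    (fun m n => by rw [mul_smul_comm, ← mul_assoc, ← mul_assoc, pf_idem hP])
    (fun m n => by rw [smul_mul_assoc, mul_assoc _ (P n), pf_idem hP]) (fun m n => by
      rw [norm_smul, Complex.norm_real, Real.norm_eq_abs]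
      have h1 := hE m n
      have h2 := hF m n
      have hj := jd_pos m n
      have hm := mxu_pos hγ m n
      have h3 := jpos m n (r-1)
      have h4 := wB_le hγ j m n
      calc _ ≤ (CH * jd m n * (mxu γ m n)⁻¹) * (f * ((jd m n ^ r)⁻¹ * wZ γ j m n)) := by
            gcongr
        _ = CH * f * ((jd m n ^ (r-1))⁻¹ * wB γ j m n) := by
            rw [jd_rpow_succ]
            unfold wZ wB
            field_simp
            ring
        _ ≤ CH * f * ((jd m n ^ (r-1))⁻¹ * 1) := by gcongr
        _ = _ := by rw [mul_one])
  exact ⟨L, h1⟩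

lemma entry_le (hP : ProjFamily P) (A : 𝓗 →L[ℂ] 𝓗) (m n : ℕ+) : ‖P m * A * P n‖ ≤ ‖A‖ := by
  calc ‖P m * A * P n‖ ≤ ‖P m‖ * ‖A‖ * ‖P n‖ := le_trans (norm_mul_le _ _)
        (mul_le_mul_of_nonneg_right (norm_mul_le _ _) (norm_nonneg _))
    _ ≤ 1 * ‖A‖ * 1 := by
        have := pf_norm_le hP m
        have := pf_norm_le hP n
        gcongr
    _ = _ := by ring

lemma L_cont (hP : ProjFamily P) (hγ : 0 < γ) (hE : UGap E γ CH) {j : ℕ} {r z : ℝ} (hr : 2 < r)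
    (hCH : 0 ≤ CH) (hz : 0 ≤ z) {Z L : ℝ → 𝓗 →L[ℂ] 𝓗} (hZ : ∀ t, Ent P r (wZ γ j) z (Z t))
    (hL : ∀ t, HRel P E (Z t) (L t)) (hc : Continuous Z) : Continuous L := by
  set q := r - 1 with hq
  have hq1 : 1 < q := by linarith
  set θ := (q - 1) / (2 * (q + 1)) with hθ
  have hθ0 : 0 < θ := div_pos (by linarith) (by linarith)
  have hθ1 : θ < 1 := by rw [hθ, div_lt_one (by linarith)]; linarith
  have hθe : q * (1 - θ) - θ = (q + 1)/2 := by
    have : θ * (q + 1) = (q - 1)/2 := by rw [hθ]; have : q + 1 ≠ 0 := by linarith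
                                         field_simp
    linarith
  have key : ∀ s t, ‖L s - L t‖ ≤ ((CH * (z + z)) ^ (1 - θ) * (CH * ‖Z s - Z t‖) ^ θ) * Ssum ((q+1)/2) := by
    intro s t
    refine schur hP (by linarith) (by positivity) _ (fun m n => ?_)
    have hrel := (hL s).sub (hL t)
    have hj := jd_pos m n
    have h1 : ‖P m * (L s - L t) * P n‖ ≤ (CH * (z + z)) * (jd m n ^ q)⁻¹ := by
      refine le_trans (hrel.ent hγ hE hCH ((hZ s).sub (hZ t)) m n) ?_
      have := jpos m n q
      have h4 := wB_le hγ j m n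
      have : 0 ≤ CH * (z+z) := by positivity
      calc CH * (z+z) * ((jd m n ^ (r-1))⁻¹ * wB γ j m n) ≤ CH * (z+z) * ((jd m n ^ (r-1))⁻¹ * 1) := by
            have := jpos m n (r-1)
            gcongr
        _ = _ := by rw [mul_one]
    have h2 : ‖P m * (L s - L t) * P n‖ ≤ (CH * ‖Z s - Z t‖) * jd m n := by
      rw [hrel m n, norm_smul, Complex.norm_real, Real.norm_eq_abs]
      have h3 := entry_le hP (Z s - Z t) m n
      have h5 := hE m n
      have h6 := inv_le_one_of_one_le₀ (mxu_ge hγ m n)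
      calc _ ≤ (CH * jd m n * (mxu γ m n)⁻¹) * ‖Z s - Z t‖ := by
            have := mxu_pos hγ m n
            gcongr
        _ ≤ (CH * jd m n * 1) * ‖Z s - Z t‖ := by gcongr
        _ = _ := by ring
    set a := ‖P m * (L s - L t) * P n‖
    have ha : 0 ≤ a := norm_nonneg _
    have e1 : a = a ^ (1 - θ) * a ^ θ := by
      rw [← Real.rpow_add_of_nonneg ha (by linarith) hθ0.le, sub_add_cancel, Real.rpow_one]
    rw [e1]
    have hj2 := jpos m n q
    calc a ^ (1 - θ) * a ^ θ ≤ ((CH * (z + z)) * (jd m n ^ q)⁻¹) ^ (1 - θ) * ((CH * ‖Z s - Z t‖) * jd m n) ^ θ := by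
          apply mul_le_mul (Real.rpow_le_rpow ha h1 (by linarith)) (Real.rpow_le_rpow ha h2 hθ0.le)
            (by positivity) (by positivity)
      _ = ((CH * (z + z)) ^ (1 - θ) * (CH * ‖Z s - Z t‖) ^ θ) * (jd m n ^ ((q+1)/2))⁻¹ := by
          rw [Real.mul_rpow (by positivity) (by positivity), Real.mul_rpow (by positivity) hj.le,
            Real.inv_rpow hj2.le, ← Real.rpow_mul hj.le, ← hθe, Real.rpow_sub hj]
          have := jpos m n (q * (1 - θ))
          have := jpos m n θ
          field_simp
  rw [continuous_iff_continuousAt]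
  intro t
  rw [ContinuousAt, tendsto_iff_norm_sub_tendsto_zero]
  refine squeeze_zero (fun _ => norm_nonneg _) (fun s => key s t) ?_
  have h1 : Continuous fun s => ((CH * (z + z)) ^ (1 - θ) * (CH * ‖Z s - Z t‖) ^ θ) * Ssum ((q+1)/2) := by
    refine Continuous.mul (continuous_const.mul (Continuous.rpow_const (by fun_prop) (fun _ => Or.inr hθ0.le))) continuous_const
  have := h1.tendsto t
  rw [sub_self, norm_zero, mul_zero, Real.zero_rpow hθ0.ne', mul_zero, zero_mul] at this
  exact this

/-- the map `A ↦ Pₘ A Pₙ` -/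
def entL (P : ℕ+ → 𝓗 →L[ℂ] 𝓗) (m n : ℕ+) : (𝓗 →L[ℂ] 𝓗) →L[ℝ] (𝓗 →L[ℂ] 𝓗) :=
  (((ContinuousLinearMap.mul ℝ (𝓗 →L[ℂ] 𝓗)).flip (P n)).comp (ContinuousLinearMap.mul ℝ (𝓗 →L[ℂ] 𝓗) (P m)))

lemma entL_apply (m n : ℕ+) (A : 𝓗 →L[ℂ] 𝓗) : entL P m n A = P m * A * P n := rfl

lemma exists_FC (hP : ProjFamily P) (hγ : 0 < γ) (hE : UGap E γ CH) {j : ℕ} {r z T : ℝ} (hr : 2 < r)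
    (hCH : 0 ≤ CH) (hz : 0 ≤ z) (hT : 0 < T) {Z : ℝ → 𝓗 →L[ℂ] 𝓗} (hZ : ∀ t, Ent P r (wZ γ j) z (Z t))
    (hper : ∀ t, Z (t + T) = Z t) (hsa : ∀ t, star (Z t) = Z t) (hc : Continuous Z) :
    ∃ (Zb : 𝓗 →L[ℂ] 𝓗) (F C Cd : ℝ → 𝓗 →L[ℂ] 𝓗), star Zb = Zb ∧ Ent P r (wZ γ j) z Zb ∧
      (∀ t, HasDerivAt F (Z t - Zb) t) ∧ (∀ t, F (t + T) = F t) ∧ (∀ t, star (F t) = F t) ∧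
      (∀ t, Ent P r (wZ γ j) (T / 2 * z) (F t)) ∧ (∀ t, HRel P E (F t) (C t)) ∧
      (∀ t, HasDerivAt C (Cd t) t) ∧ Continuous Cd := by
  choose L hL using fun t => exists_L hP hγ hE hr hCH hz (Z t) (hZ t)
  have hLc := L_cont hP hγ hE hr hCH hz hZ hL hc
  have hst : ∀ A : 𝓗 →L[ℂ] 𝓗, star A = (starL' ℝ : (𝓗 →L[ℂ] 𝓗) ≃L[ℝ] (𝓗 →L[ℂ] 𝓗)).toContinuousLinearMap A := fun A => rfl
  refine ⟨pavg Z T, pprim Z T, pprim L T, fun t => L t - pavg L T, ?_, fun m n => ?_, pprim_deriv hc T,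
    pprim_per hc hT hper, fun t => ?_, fun t m n => ?_, fun t m n => ?_, pprim_deriv hLc T, by fun_prop⟩
  · rw [hst, pavg_map hc]
    congr 1; funext s; exact hsa s
  · rw [← entL_apply, pavg_map hc]
    exact pavg_bound hT (fun s => hZ s m n)
  · rw [hst, pprim_map hc]
    congr 1; funext s; exact hsa s
  · rw [← entL_apply, pprim_map hc, mul_assoc]
    refine pprim_bound ?_ hT ?_ (fun s => hZ s m n) t
    · exact (entL P m n).continuous.comp hc
    · intro t; rw [hper]
  · rw [← entL_apply, ← entL_apply, pprim_map hLc]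
    have e : (fun s => entL P m n (L s)) = fun s => (((E m - E n : ℝ)) • entL P m n) (Z s) := by
      funext s
      rw [entL_apply, hL s m n]
      change _ = (E m - E n) • (P m * Z s * P n)
      rw [Complex.coe_smul]
    rw [e, ← pprim_map hc]
    rw [Complex.coe_smul]
    rfl

end FC


section step
variable {P : ℕ+ → 𝓗 →L[ℂ] 𝓗} {E : ℕ+ → ℝ} {γ CH : ℝ}

/-- weighted bound on a diagonal operator -/
def DiagB (P : ℕ+ → 𝓗 →L[ℂ] 𝓗) (γ y : ℝ) (Y : 𝓗 →L[ℂ] 𝓗) : Prop :=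
  (∀ m n, m ≠ n → P m * Y * P n = 0) ∧ ∀ n, ‖Y * P n‖ ≤ y * (mxu γ n n)⁻¹

lemma DiagB.comm (hP : ProjFamily P) {y : ℝ} {Y : 𝓗 →L[ℂ] 𝓗} (h : DiagB P γ y Y) (n : ℕ+) :
    P n * Y = Y * P n := by
  apply op_ext hP
  intro m l
  rw [← mul_assoc, mul_assoc _ (Y * P n), mul_assoc Y, ← mul_assoc _ Y]
  by_cases h1 : m = n
  · subst h1
    rw [pf_idem hP]
    by_cases h2 : m = l
    · subst h2; rw [pf_idem hP]
    · rw [pf_orth hP h2, mul_zero, h.1 m l h2]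
  · rw [pf_orth hP h1, zero_mul, zero_mul]
    by_cases h2 : n = l
    · subst h2; rw [pf_idem hP, h.1 m n h1]
    · rw [pf_orth hP h2, mul_zero]

lemma DiagB.mul_entry (hP : ProjFamily P) {y : ℝ} {Y : 𝓗 →L[ℂ] 𝓗} (h : DiagB P γ y Y)
    (F : 𝓗 →L[ℂ] 𝓗) (m n : ℕ+) : P m * (F * Y) * P n = (P m * F * P n) * (Y * P n) := by
  have : Y * P n = P n * (Y * P n) := by
    rw [← mul_assoc, h.comm hP, mul_assoc, pf_idem hP]
  rw [mul_assoc, mul_assoc F, mul_assoc (P m * F), ← this, mul_assoc]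

lemma DiagB.right (hP : ProjFamily P) (hγ : 0 < γ) (hγh : γ < 1/2) {y q f : ℝ} {j : ℕ} (hf : 0 ≤ f)
    {Y F : 𝓗 →L[ℂ] 𝓗} (hy : 0 ≤ y) (h : DiagB P γ y Y) (hF : Ent P q (wF γ j) f F) :
    Ent P q (wB γ j) (2 * f * y) (F * Y) := by
  intro m n
  rw [h.mul_entry hP]
  have h1 := hF m n
  have h2 := h.2 n
  have h3 := jpos m n q
  have hm := mxu_pos hγ m n
  have hn := mxu_pos hγ n n
  have hj := jd_pos m n
  have h4 := mxu_le_two_self hγ hγh m n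
  have h5 : (jd m n)⁻¹ * (mxu γ n n)⁻¹ ≤ 2 * (mxu γ m n)⁻¹ := by
    rw [← mul_inv, ← div_eq_mul_inv, inv_eq_one_div, div_le_div_iff₀ (by positivity) (by positivity)]
    linarith
  calc _ ≤ (f * ((jd m n ^ q)⁻¹ * wF γ j m n)) * (y * (mxu γ n n)⁻¹) := by
        refine le_trans (norm_mul_le _ _) (mul_le_mul h1 h2 (norm_nonneg _) ?_)
        have := wF_pos hγ j m n
        positivity
    _ = (f * y * ((jd m n ^ q)⁻¹ * (mxu γ m n ^ (j+1))⁻¹)) * ((jd m n)⁻¹ * (mxu γ n n)⁻¹) := by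
        unfold wF; ring
    _ ≤ (f * y * ((jd m n ^ q)⁻¹ * (mxu γ m n ^ (j+1))⁻¹)) * (2 * (mxu γ m n)⁻¹) := by gcongr
    _ = _ := by
        unfold wB; rw [pow_succ _ (j+1), mul_inv]; ring

lemma DiagB.left (hP : ProjFamily P) (hγ : 0 < γ) (hγh : γ < 1/2) {y q f : ℝ} {j : ℕ} (hf : 0 ≤ f)
    {Y F : 𝓗 →L[ℂ] 𝓗} (hy : 0 ≤ y) (h : DiagB P γ y Y) (hs : star Y = Y) (hF : Ent P q (wF γ j) f F) :
    Ent P q (wB γ j) (2 * f * y) (Y * F) := by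
  rw [← ent_star_iff hP (wB_symm j), star_mul, hs]
  exact h.right hP hγ hγh hf hy (hF.star hP (wF_symm j))

/-- pointwise Cayley algebra -/
lemma cayley_alg {a R S F C Fd N B : 𝓗 →L[ℂ] 𝓗} {ν : ℝ} (ha : a = (Complex.I * ν) • F)
    (h1 : (1 - a) * R = 1) (h2 : R * (1 - a) = 1) (h3 : (1 + a) * S = 1) (h4 : S * (1 + a) = 1) :
    (2 * R - 1) * (2 * S - 1) = 1 ∧ (2 * S - 1) * (2 * R - 1) = 1 ∧
    (2 * R - 1) * ((2:ℂ) • (S * ((-(Complex.I * ν)) • C) * S)) + (2 * R - 1) * (N + B) * (2 * S - 1)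
      + Complex.I • (((2:ℂ) • (R * ((Complex.I * ν) • Fd) * R)) * (2 * S - 1)) =
    N - ((2 * ν : ℝ) : ℂ) • Fd + ((2 * R - 1) * B * (2 * S - 1) + ((2 * ν : ℝ) : ℂ) •
      (R * (Complex.I • (-C + (F * N - N * F)) + (Fd * a - a * Fd - a * Fd * a)) * S)) := by
  have v1 : 2 * R - 1 = (1 + a) * R := by
    have : (1 + a) * R = 2 * R - (1 - a) * R := by noncomm_ring
    rw [this, h1]
  have v2 : 2 * R - 1 = R * (1 + a) := by
    have : R * (1 + a) = 2 * R - R * (1 - a) := by noncomm_ring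
    rw [this, h2]
  have s1 : 2 * S - 1 = (1 - a) * S := by
    have : (1 - a) * S = 2 * S - (1 + a) * S := by noncomm_ring
    rw [this, h3]
  have s2 : 2 * S - 1 = S * (1 - a) := by
    have : S * (1 - a) = 2 * S - S * (1 + a) := by noncomm_ring
    rw [this, h4]
  have vS : (2 * R - 1) * S = R := by rw [v2, mul_assoc, h3, mul_one]
  have Rs : R * (2 * S - 1) = S := by rw [s1, ← mul_assoc, h2, one_mul]
  refine ⟨?_, ?_, ?_⟩
  · rw [s1, v1, mul_assoc, ← mul_assoc R, h2, one_mul, h3]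
  · rw [s1, v1, mul_assoc, ← mul_assoc S, h4, one_mul, h1]
  · have e1 : (2 * R - 1) * ((2:ℂ) • (S * ((-(Complex.I * ν)) • C) * S)) = R * ((2:ℂ) • ((-(Complex.I * ν)) • C)) * S := by
      simp only [mul_smul_comm, smul_mul_assoc, ← mul_assoc, vS]
    have e2 : ((2:ℂ) • (R * ((Complex.I * ν) • Fd) * R)) * (2 * S - 1) = R * ((2:ℂ) • ((Complex.I * ν) • Fd)) * S := by
      rw [smul_mul_assoc, mul_assoc, Rs, mul_smul_comm (2:ℂ), smul_mul_assoc]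
    have e3 : (2 * R - 1) * N * (2 * S - 1) = R * ((1 + a) * N * (1 - a)) * S := by
      rw [v2, s1]; simp only [mul_assoc]
    have e4 : ∀ X, X = R * ((1 - a) * X * (1 + a)) * S := by
      intro X
      calc X = (R * (1 - a)) * X * ((1 + a) * S) := by rw [h2, h3, one_mul, mul_one]
        _ = _ := by simp only [mul_assoc]
    have e5 : N - ((2 * ν : ℝ) : ℂ) • Fd = R * ((1 - a) * (N - ((2 * ν : ℝ) : ℂ) • Fd) * (1 + a)) * S := e4 _
    rw [mul_add (2 * R - 1) N B, add_mul _ _ (2 * S - 1), e1, e2, e3, e5]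
    have e6 : (2:ℂ) • ((-(Complex.I * ν)) • C) + (1 + a) * N * (1 - a) + Complex.I • ((2:ℂ) • ((Complex.I * ν) • Fd))
        = (1 - a) * (N - ((2 * ν : ℝ) : ℂ) • Fd) * (1 + a) + ((2 * ν : ℝ) : ℂ) •
      ((Complex.I • (-C + (F * N - N * F)) + (Fd * a - a * Fd - a * Fd * a))) := by
      have f1 : (1 + a) * N * (1 - a) = (1 - a) * N * (1 + a) + (2:ℂ) • (a * N - N * a) := by
        rw [two_smul]; noncomm_ring
      have f2 : (1 - a) * (N - ((2 * ν : ℝ) : ℂ) • Fd) * (1 + a) = (1 - a) * N * (1 + a) -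
          ((2 * ν : ℝ) : ℂ) • (Fd + (Fd * a - a * Fd - a * Fd * a)) := by
        rw [mul_sub, sub_mul, mul_smul_comm, smul_mul_assoc]
        congr 2; noncomm_ring
      have f3 : a * N - N * a = (Complex.I * ν) • (F * N - N * F) := by
        rw [ha, smul_mul_assoc, mul_smul_comm, smul_sub]
      rw [f1, f2, f3]
      simp only [smul_add, smul_sub, smul_neg, smul_smul, neg_smul]
      have g1 : Complex.I * (2 * (Complex.I * ν)) = -((2 * ν : ℝ) : ℂ) := by
        push_cast; linear_combination (2 * (ν:ℂ)) * Complex.I_mul_I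
      have g2 : ((2 * ν : ℝ) : ℂ) * Complex.I = 2 * (Complex.I * ν) := by push_cast; ring
      rw [g1, g2]
      simp only [neg_smul]
      abel
    have e7 := congrArg (fun X => R * X * S) e6
    simp only [mul_add, add_mul, mul_smul_comm, smul_mul_assoc] at e7 ⊢
    rw [← sub_eq_zero] at e7 ⊢
    rw [← e7]
    abel

end step


section step
variable {P : ℕ+ → 𝓗 →L[ℂ] 𝓗} {E : ℕ+ → ℝ} {γ CH : ℝ}

lemma exists_R {a ad : ℝ → 𝓗 →L[ℂ] 𝓗} (hd : ∀ t, HasDerivAt a (ad t) t) (hn : ∀ t, ‖a t‖ < 1) :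
    ∀ t, (1 - a t) * Ring.inverse (1 - a t) = 1 ∧ Ring.inverse (1 - a t) * (1 - a t) = 1 ∧
      HasDerivAt (fun t => Ring.inverse (1 - a t)) (Ring.inverse (1 - a t) * ad t * Ring.inverse (1 - a t)) t := by
  intro t
  have hu : ((Units.oneSub (a t) (hn t) : (𝓗 →L[ℂ] 𝓗)ˣ) : 𝓗 →L[ℂ] 𝓗) = 1 - a t := rfl
  have hiu : IsUnit (1 - a t) := ⟨_, hu⟩
  refine ⟨Ring.mul_inverse_cancel _ hiu, Ring.inverse_mul_cancel _ hiu, ?_⟩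
  have h1 := hasFDerivAt_ringInverse (𝕜 := ℝ) (Units.oneSub (a t) (hn t))
  have h2 : HasDerivAt (fun t => 1 - a t) (-ad t) t := by
    simpa using (hd t).const_sub 1
  rw [hu] at h1
  have h3 := HasFDerivAt.comp_hasDerivAt t h1 h2
  have e : (((Units.oneSub (a t) (hn t))⁻¹ : (𝓗 →L[ℂ] 𝓗)ˣ) : 𝓗 →L[ℂ] 𝓗) = Ring.inverse (1 - a t) := by
    rw [← hu, Ring.inverse_unit]
  rw [e] at h3
  have e2 : (-(mulLeftRight ℝ (𝓗 →L[ℂ] 𝓗)) (Ring.inverse (1 - a t)) (Ring.inverse (1 - a t))) (-ad t) =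
      Ring.inverse (1 - a t) * ad t * Ring.inverse (1 - a t) := by
    change -(Ring.inverse (1 - a t) * (-ad t) * Ring.inverse (1 - a t)) = _
    rw [mul_neg, neg_mul, neg_neg]
  rw [← e2]
  exact h3

lemma star_inv_of {a R S : 𝓗 →L[ℂ] 𝓗} (hs : star a = -a) (h1 : (1 - a) * R = 1) (h2 : R * (1 - a) = 1)
    (hS : S = star R) : (1 + a) * S = 1 ∧ S * (1 + a) = 1 := by
  have e1 := congrArg star h1
  have e2 := congrArg star h2
  rw [star_mul, star_sub, star_one, hs, sub_neg_eq_add] at e1 e2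
  rw [hS]; exact ⟨e2, e1⟩

/-- weighted bounds for the Cayley transform -/
lemma cayley_ent (hP : ProjFamily P) (hγ : 0 < γ) {q x κ : ℝ} (hq : 1 < q) {j : ℕ}
    {a R : 𝓗 →L[ℂ] 𝓗} (hx : 0 ≤ x) (ha : Ent P q (wW γ j) x a) (hn : ‖a‖ < 1) (hκ : Dc q * x = κ) (hκ1 : κ < 1)
    (h1 : (1 - a) * R = 1) (h2 : R * (1 - a) = 1) {b : ℝ} (hb : 0 ≤ b) {M : 𝓗 →L[ℂ] 𝓗}
    (hM : Ent P q (wB γ j) b M) :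
    Ent P q (wB γ j) (b / (1 - κ)) (R * M) ∧ Ent P q (wB γ j) ((1 + κ) / (1 - κ) * b) ((2 * R - 1) * M) := by
  have h3 := Ent.inv_mul hP hq ha hM hx hb (fun m n => (wW_pos hγ j m n).le) (fun m n => (wB_pos hγ j m n).le)
    (fun m n l => W2 hγ j m n l) hn h1 h2 hκ hκ1
  refine ⟨h3, ?_⟩
  have v1 : (2 * R - 1) * M = R * M + a * (R * M) := by
    have : (1 + a) * R = 2 * R - (1 - a) * R := by noncomm_ring
    rw [h1] at this
    rw [← this]; noncomm_ring
  rw [v1]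
  have h1κ : 1 - κ ≠ 0 := by linarith
  have h4 := WB_B hP hγ hq hx (div_nonneg hb (by linarith : 0 ≤ 1 - κ)) ha h3
  refine (h3.add h4).mono (fun m n => (wB_pos hγ j m n).le) (le_of_eq ?_)
  rw [hκ]; field_simp

/-- both sided -/
lemma cayley_ent2 (hP : ProjFamily P) (hγ : 0 < γ) {q x κ : ℝ} (hq : 1 < q) {j : ℕ}
    {a R : 𝓗 →L[ℂ] 𝓗} (hx : 0 ≤ x) (ha : Ent P q (wW γ j) x a) (hn : ‖a‖ < 1) (hκ : Dc q * x = κ) (hκ1 : κ < 1)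
    (h1 : (1 - a) * R = 1) (h2 : R * (1 - a) = 1) {b : ℝ} (hb : 0 ≤ b) {M : 𝓗 →L[ℂ] 𝓗}
    (hM : Ent P q (wB γ j) b M) :
    Ent P q (wB γ j) (b / (1 - κ) / (1 - κ)) (R * M * star R) ∧
    Ent P q (wB γ j) ((1 + κ) / (1 - κ) * ((1 + κ) / (1 - κ) * b)) ((2 * R - 1) * M * star (2 * R - 1)) := by
  have hκ0 : 0 ≤ κ := by rw [← hκ]; have := Dc_pos hq; positivity
  have hk : 0 ≤ 1 - κ := by linarith
  have h3 := cayley_ent hP hγ hq hx ha hn hκ hκ1 h1 h2 hb hM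
  constructor
  · rw [← ent_star_iff hP (wB_symm j), star_mul, star_star]
    exact (cayley_ent hP hγ hq hx ha hn hκ hκ1 h1 h2 (by positivity) (h3.1.star hP (wB_symm j))).1
  · rw [← ent_star_iff hP (wB_symm j), star_mul, star_star]
    exact (cayley_ent hP hγ hq hx ha hn hκ hκ1 h1 h2 (by positivity) (h3.2.star hP (wB_symm j))).2

structure FCD (P : ℕ+ → 𝓗 →L[ℂ] 𝓗) (E : ℕ+ → ℝ) (γ CH : ℝ) (j : ℕ) (r T y z f : ℝ) (Y Zb : 𝓗 →L[ℂ] 𝓗)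
    (Z F C Cd : ℝ → 𝓗 →L[ℂ] 𝓗) : Prop where
  hP : ProjFamily P
  hγ : 0 < γ
  hγh : γ < 1/2
  hE : UGap E γ CH
  hr : 2 < r
  hCH : 0 ≤ CH
  hz : 0 ≤ z
  hy : 0 ≤ y
  hf : 0 ≤ f
  hT : 0 < T
  hYs : star Y = Y
  hYd : DiagB P γ y Y
  hZ : ∀ t, Ent P r (wZ γ j) z (Z t)
  hZper : ∀ t, Z (t + T) = Z t
  hZs : ∀ t, star (Z t) = Z t
  hZc : StrongC1 Z
  hZbs : star Zb = Zb
  hZb : Ent P r (wZ γ j) z Zb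
  hFd : ∀ t, HasDerivAt F (Z t - Zb) t
  hFper : ∀ t, F (t + T) = F t
  hFs : ∀ t, star (F t) = F t
  hF : ∀ t, Ent P r (wZ γ j) f (F t)
  hFC : ∀ t, HRel P E (F t) (C t)
  hCd : ∀ t, HasDerivAt C (Cd t) t
  hCdc : Continuous Cd

/-- admissible remainder -/
def Rem (P : ℕ+ → 𝓗 →L[ℂ] 𝓗) (γ : ℝ) (j : ℕ) (q T b : ℝ) (B : ℝ → 𝓗 →L[ℂ] 𝓗) : Prop :=
  StrongC1 B ∧ (∀ t, B (t + T) = B t) ∧ (∀ t, star (B t) = B t) ∧ ∀ t, Ent P q (wB γ j) b (B t)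

lemma Q_ent {j : ℕ} {r T y z f : ℝ} {Y Zb : 𝓗 →L[ℂ] 𝓗} {Z F C Cd : ℝ → 𝓗 →L[ℂ] 𝓗}
    (h : FCD P E γ CH j r T y z f Y Zb Z F C Cd) {ν θ : ℝ} (hν : 0 < ν) (hν8 : ν ≤ 1/8) (hθ0 : 0 ≤ θ)
    (hθ1 : θ ≤ 1) (hκ : Dc (r - 1) * (2 * (ν * f)) ≤ 1/4) (t : ℝ) {a Fd N : 𝓗 →L[ℂ] 𝓗}
    (ha : a = (Complex.I * ν) • F t) (hFd : Fd = Z t - Zb) (hN : N = Y + (Z t - (θ : ℂ) • Fd)) :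
    Ent P (r - 1) (wB γ j) (3/2 * (f * (CH + 4 * y + 4 * Dc (r - 1) * z)))
      (Complex.I • (-C t + (F t * N - N * F t)) + (Fd * a - a * Fd - a * Fd * a)) := by
  obtain ⟨hP, hγ, hγh, hE, hr, hCH, hz, hy, hf, hT, hYs, hYd, hZ, hZper, hZs, hZc, hZbs, hZb, hFd', hFper,
    hFs, hF, hFC, hCd, hCdc⟩ := h
  have hq : 1 < r - 1 := by linarith
  have wBp := fun m n => (wB_pos hγ j m n).le
  have wFp := fun m n => (wF_pos hγ j m n).le
  have wZp := fun m n => (wZ_pos hγ j m n).le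
  have bC := (hFC t).ent hγ hE hCH (hF t)
  have bF := ent_ZF (hF t)
  have bFd : Ent P (r-1) (wF γ j) (z + z) Fd := by rw [hFd]; exact ent_ZF ((hZ t).sub hZb)
  have ba : Ent P (r-1) (wF γ j) (ν * f) a := by
    rw [ha]
    refine (bF.smul (Complex.I * ν)).mono wFp (le_of_eq ?_)
    rw [norm_mul, Complex.norm_I, one_mul, Complex.norm_real, Real.norm_eq_abs, abs_of_pos hν]
  have hνf : 0 ≤ ν * f := by positivity
  have baW := ent_FW hγ hγh hνf ba
  have bG : Ent P (r-1) (wF γ j) z (Z t - (θ:ℂ) • Fd) := by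
    have e : Z t - (θ:ℂ) • Fd = ((1 - θ : ℝ) : ℂ) • Z t + (θ : ℂ) • Zb := by
      rw [hFd, smul_sub]; push_cast; rw [sub_smul, one_smul]; abel
    rw [e]
    refine ent_ZF ((((hZ t).smul _).add (hZb.smul _)).mono wZp (le_of_eq ?_))
    rw [Complex.norm_real, Complex.norm_real, Real.norm_eq_abs, Real.norm_eq_abs, abs_of_nonneg hθ0,
      abs_of_nonneg (by linarith)]
    ring
  have b1 := hYd.right hP hγ hγh hf hy bF
  have b2 := hYd.left hP hγ hγh hf hy hYs bF
  have b3 := FF_B hP hγ hγh hq hf hz bF bG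
  have b4 := FF_B hP hγ hγh hq hz hf bG bF
  have hzz : 0 ≤ z + z := by linarith
  have b5 := FF_B hP hγ hγh hq hzz hνf bFd ba
  have b6 := FF_B hP hγ hγh hq hνf hzz ba bFd
  have hD := Dc_pos hq
  have b7 := BW_B hP hγ hq (by positivity) (by positivity) baW b6
  have e : Complex.I • (-C t + (F t * N - N * F t)) + (Fd * a - a * Fd - a * Fd * a) =
      Complex.I • (-C t + ((F t * Y - Y * F t) + (F t * (Z t - (θ:ℂ) • Fd) - (Z t - (θ:ℂ) • Fd) * F t))) +
        (Fd * a - a * Fd - a * Fd * a) := by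
    rw [hN, mul_add, add_mul]; congr 3; abel
  rw [e]
  have b8 := ((bC.neg.add ((b1.sub b2).add (b3.sub b4))).smul Complex.I).add ((b5.sub b6).sub b7)
  refine b8.mono wBp ?_
  rw [Complex.norm_I, one_mul]
  set D := Dc (r - 1)
  have k1 : 0 ≤ D * f * z := by positivity
  have k2 : ν * (D * f * z) ≤ 1/8 * (D * f * z) := mul_le_mul_of_nonneg_right hν8 k1
  have k3 : D * (2 * (ν * f)) * (2 * D * (ν * f) * (z + z)) ≤ 1/4 * (2 * D * (ν * f) * (z+z)) :=
    mul_le_mul_of_nonneg_right hκ (by positivity)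
  have k4 : 0 ≤ f * CH := by positivity
  have k5 : 0 ≤ f * y := by positivity
  nlinarith

end step


section step
variable {P : ℕ+ → 𝓗 →L[ℂ] 𝓗} {E : ℕ+ → ℝ} {γ CH : ℝ}

lemma cayley_step {j : ℕ} {r T y z f : ℝ} {Y Zb : 𝓗 →L[ℂ] 𝓗} {Z F C Cd : ℝ → 𝓗 →L[ℂ] 𝓗}
    (h : FCD P E γ CH j r T y z f Y Zb Z F C Cd) {ν θ κ b : ℝ} (hν : 0 < ν) (hν8 : ν ≤ 1/8) (hθ0 : 0 ≤ θ)
    (hθ1 : θ ≤ 1) (hκ : Dc (r - 1) * (2 * (ν * f)) = κ) (hκ1 : κ ≤ 1/4) (hb : 0 ≤ b)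
    (hn : ∀ t, ν * ‖F t‖ ≤ 1/4) {B : ℝ → 𝓗 →L[ℂ] 𝓗} (hB : Rem P γ j (r - 1) T b B) :
    ∃ B', Rem P γ j (r - 1) T ((1 + κ) / (1 - κ) * ((1 + κ) / (1 - κ) * b) +
        2 * ν * (3/2 * (f * (CH + 4 * y + 4 * Dc (r - 1) * z)) / (1 - κ) / (1 - κ))) B' ∧
      Gauge P E T (fun t => Y + (Z t - (θ : ℂ) • (Z t - Zb)) + B t)
        (fun t => Y + (Z t - ((θ + 2 * ν : ℝ) : ℂ) • (Z t - Zb)) + B' t) := by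
  have hQ := fun t => Q_ent h hν hν8 hθ0 hθ1 (hκ.trans_le hκ1) t rfl rfl rfl
  obtain ⟨hP, hγ, hγh, hE, hr, hCH, hz, hy, hf, hT, hYs, hYd, hZ, hZper, hZs, hZc, hZbs, hZb, hFd, hFper,
    hFs, hF, hFC, hCd, hCdc⟩ := h
  obtain ⟨hBc, hBper, hBs, hBe⟩ := hB
  have hq : 1 < r - 1 := by linarith
  have hD := Dc_pos hq
  set c : ℂ := Complex.I * ν with hc
  have hcn : ‖c‖ = ν := by
    rw [hc, norm_mul, Complex.norm_I, one_mul, Complex.norm_real, Real.norm_eq_abs, abs_of_pos hν]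
  have hcs : star c = -c := by
    rw [hc]; simp
  let a : ℝ → 𝓗 →L[ℂ] 𝓗 := fun t => c • F t
  have had : ∀ t, HasDerivAt a (c • (Z t - Zb)) t := fun t => (hFd t).const_smul c
  have han : ∀ t, ‖a t‖ ≤ 1/4 := fun t => by
    simp only [a]; rw [norm_smul, hcn]; exact hn t
  have han1 : ∀ t, ‖a t‖ < 1 := fun t => lt_of_le_of_lt (han t) (by norm_num)
  have has : ∀ t, star (a t) = - a t := fun t => by
    simp only [a]; rw [star_smul, hFs, hcs, neg_smul]
  have hR := exists_R had han1
  set R : ℝ → 𝓗 →L[ℂ] 𝓗 := fun t => Ring.inverse (1 - a t) with hRdef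
  have hRper : ∀ t, R (t + T) = R t := fun t => by simp only [hRdef, a, hFper]
  have h1 : ∀ t, (1 - a t) * R t = 1 := fun t => (hR t).1
  have h2 : ∀ t, R t * (1 - a t) = 1 := fun t => (hR t).2.1
  have hRd : ∀ t, HasDerivAt R (R t * (c • (Z t - Zb)) * R t) t := fun t => (hR t).2.2
  have h34 := fun t => star_inv_of (has t) (h1 t) (h2 t) rfl
  have hRcont : Continuous R := continuous_iff_continuousAt.2 (fun t => (hRd t).continuousAt)
  have hZcont := hZc.continuous
  have hVs : ∀ t, star (2 * R t - 1) = 2 * star (R t) - 1 := fun t => by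
    rw [star_sub, star_one, two_mul, two_mul, star_add]
  have hRC1 : StrongC1 R := (strongC1_of_hasDerivAt hRd (by fun_prop)).strong
  have hSC1 : StrongC1 (fun t => star (R t)) :=
    (strongC1_of_hasDerivAt (fun t => (hRd t).star) (by fun_prop)).strong
  have hFcont : Continuous F := continuous_iff_continuousAt.2 (fun t => (hFd t).continuousAt)
  have hFC1 : StrongC1 F := (strongC1_of_hasDerivAt hFd (by fun_prop)).strong
  have hCC1 : StrongC1 C := (strongC1_of_hasDerivAt hCd hCdc).strong
  have hVd : ∀ t, HasDerivAt (fun t => 2 * R t - 1) ((2:ℂ) • (R t * (c • (Z t - Zb)) * R t)) t := fun t => by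
    have := ((hRd t).const_smul (2:ℂ)).sub_const 1
    refine this.congr_of_eventuallyEq (Filter.Eventually.of_forall fun s => ?_)
    change 2 * R s - 1 = (2:ℂ) • R s - 1
    rw [two_mul, two_smul]
  have hVSC1 : SC1 (fun t => 2 * R t - 1) (fun t => (2:ℂ) • (R t * (c • (Z t - Zb)) * R t)) :=
    strongC1_of_hasDerivAt hVd (by fun_prop)
  have hVstar : StrongC1 (fun t => star (2 * R t - 1)) := by
    have := ((hSC1.smul 2).sub (StrongC1.const 1))
    have e : (fun t => star (2 * R t - 1)) = fun t => (2:ℂ) • star (R t) - 1 := by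
      funext t; rw [hVs, two_mul, two_smul]
    rw [e]; exact this
  have hFd1 : StrongC1 (fun t => Z t - Zb) := hZc.sub (StrongC1.const Zb)
  have ha1 : StrongC1 a := hFC1.smul c
  have hCs : ∀ t, star (C t) = - C t := fun t => by
    have e := (hFC t).star hP
    rw [hFs] at e
    have := HRel.unique hP (hFC t) e
    rw [this, star_neg, star_star, ← this]
  have hCper : ∀ t, C (t + T) = C t := fun t => by
    have e := hFC (t + T)
    rw [hFper] at e
    exact HRel.unique hP e (hFC t)
  let N : ℝ → 𝓗 →L[ℂ] 𝓗 := fun t => Y + (Z t - (θ : ℂ) • (Z t - Zb))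
  have hNs : ∀ t, star (N t) = N t := fun t => by
    simp only [N]
    rw [star_add, star_sub, star_smul, star_sub, hYs, hZs, hZbs]
    simp
  have hN1 : StrongC1 N := (StrongC1.const Y).add (hZc.sub (hFd1.smul _))
  let Q : ℝ → 𝓗 →L[ℂ] 𝓗 := fun t => Complex.I • (-C t + (F t * N t - N t * F t)) +
    ((Z t - Zb) * a t - a t * (Z t - Zb) - a t * (Z t - Zb) * a t)
  have hQs : ∀ t, star (Q t) = Q t := fun t => by
    simp only [Q]
    simp only [star_add, star_sub, star_smul, star_mul, star_neg, hNs, hFs, hCs, has, hZs, hZbs]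
    have : star Complex.I = -Complex.I := Complex.conj_I
    rw [this]
    simp only [neg_smul, neg_mul, mul_neg, neg_neg, smul_add, smul_sub, smul_neg, sub_mul, mul_sub, mul_assoc]
    abel
  have hQper : ∀ t, Q (t + T) = Q t := fun t => by
    simp only [Q, N, a, hFper, hZper, hCper]
  have hQ1 : StrongC1 Q := by
    have hCn : StrongC1 (fun t => -C t) := by
      have := hCC1.smul (-1); simpa using this
    exact ((hCn.add ((hFC1.mul hN1).sub (hN1.mul hFC1))).smul _).add
      (((hFd1.mul ha1).sub (ha1.mul hFd1)).sub ((ha1.mul hFd1).mul ha1))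
  let B' : ℝ → 𝓗 →L[ℂ] 𝓗 := fun t => (2 * R t - 1) * B t * star (2 * R t - 1) +
    ((2 * ν : ℝ) : ℂ) • (R t * Q t * star (R t))
  have wFp := fun m n => (wF_pos hγ j m n).le
  have wBp := fun m n => (wB_pos hγ j m n).le
  have ba : ∀ t, Ent P (r-1) (wW γ j) (2 * (ν * f)) (a t) := fun t => by
    refine ent_FW hγ hγh (by positivity) ?_
    refine ((ent_ZF (hF t)).smul c).mono wFp (le_of_eq ?_)
    rw [hcn]
  have hcc : 0 ≤ 3/2 * (f * (CH + 4 * y + 4 * Dc (r - 1) * z)) := by positivity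
  refine ⟨B', ⟨?_, fun t => ?_, fun t => ?_, fun t => ?_⟩, ?_⟩
  · exact ((hVSC1.strong.mul hBc).mul hVstar).add (((hRC1.mul hQ1).mul hSC1).smul _)
  · simp only [B', hRper, hBper, hQper]
  · simp only [B']
    rw [star_add, star_smul, star_mul, star_mul, star_star, star_mul, star_mul, star_star, hBs, hQs,
      mul_assoc, mul_assoc]
    congr 2
    simp
  · have hlt : κ < 1 := by linarith
    have c1 := (cayley_ent2 hP hγ hq (by positivity) (ba t) (han1 t) hκ hlt (h1 t) (h2 t) hb (hBe t)).2
    have c2 := (cayley_ent2 hP hγ hq (by positivity) (ba t) (han1 t) hκ hlt (h1 t) (h2 t) hcc (hQ t)).1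
    refine (c1.add (c2.smul ((2 * ν : ℝ) : ℂ))).mono wBp (le_of_eq ?_)
    rw [Complex.norm_real, Real.norm_eq_abs, abs_of_pos (by positivity)]
  · have halg := fun t => cayley_alg (a := a t) (R := R t) (S := star (R t)) (F := F t) (C := C t) (Fd := Z t - Zb)
      (N := N t) (B := B t) (ν := ν) rfl (h1 t) (h2 t) (h34 t).1 (h34 t).2
    refine ⟨fun t => 2 * R t - 1, fun t => (2:ℂ) • (R t * (c • (Z t - Zb)) * R t),
      fun t => (2:ℂ) • (star (R t) * ((-c) • C t) * star (R t)), fun t => ?_, fun t => ?_, hVSC1, fun t => ?_, fun t => ?_⟩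
    · exact ⟨by rw [hVs]; exact (halg t).1, by rw [hVs]; exact (halg t).2.1⟩
    · simp only [hRper]
    · rw [hVs]
      have e1 : HRel P E (-(a t)) ((-c) • C t) := by
        have := (hFC t).smul (-c)
        simp only [a]; rw [← neg_smul]; exact this
      have e2 := HRel.inv hP e1 (by rw [norm_neg]; exact han t) (R := star (R t))
        (by rw [sub_neg_eq_add]; exact (h34 t).1) (by rw [sub_neg_eq_add]; exact (h34 t).2)
      have e3 := (e2.smul 2).sub (HRel.one hP)
      rw [sub_zero, two_smul, ← two_mul] at e3
      exact e3
    · have e := (halg t).2.2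
      rw [← hVs] at e
      rw [e]
      simp only [B', Q, N]
      push_cast
      rw [add_smul]
      abel

end step


section iter
variable {P : ℕ+ → 𝓗 →L[ℂ] 𝓗} {E : ℕ+ → ℝ} {γ CH : ℝ}

lemma mu_le {κ : ℝ} (h0 : 0 ≤ κ) (h1 : κ ≤ 1/4) : (1 + κ) / (1 - κ) ≤ Real.exp (3 * κ) := by
  rw [div_le_iff₀ (by linarith)]
  have a1 := Real.add_one_le_exp κ
  have a2 := Real.add_one_le_exp (2 * κ)
  have e : Real.exp (3 * κ) = Real.exp κ * Real.exp (2 * κ) := by rw [← Real.exp_add]; congr 1; ring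
  have h3 : 1 ≤ Real.exp (2 * κ) * (1 - κ) := by nlinarith
  rw [e, mul_assoc]
  nlinarith [Real.exp_pos κ]

lemma exp_final {x : ℝ} (hx : 0 ≤ x) : 8/3 * x * Real.exp (3/2 * x) ≤ Real.exp (4 * x) - 1 := by
  have h1 : 2 * x ≤ Real.sinh (2 * x) := Real.self_le_sinh_iff.2 (by linarith)
  rw [Real.sinh_eq] at h1
  have e1 : Real.exp (4 * x) = Real.exp (2*x) * Real.exp (2*x) := by rw [← Real.exp_add]; congr 1; ring
  have e2 : Real.exp (2 * x) * Real.exp (-(2*x)) = 1 := by rw [← Real.exp_add, add_neg_cancel, Real.exp_zero]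
  have h2 : Real.exp (3/2 * x) ≤ Real.exp (2 * x) := Real.exp_le_exp.2 (by linarith)
  have h3 := Real.exp_pos (2 * x)
  have h4 : 4 * x * Real.exp (2 * x) ≤ Real.exp (4 * x) - 1 := by
    rw [e1]; nlinarith
  have h5 : 8/3 * x * Real.exp (3/2 * x) ≤ 8/3 * x * Real.exp (2*x) := by gcongr
  nlinarith [mul_nonneg hx h3.le]

lemma anti_adiabatic {j : ℕ} {r T y z f : ℝ} {Y Zb : 𝓗 →L[ℂ] 𝓗} {Z F C Cd : ℝ → 𝓗 →L[ℂ] 𝓗}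
    (h : FCD P E γ CH j r T y z f Y Zb Z F C Cd) (hfT : f = T / 2 * z) :
    ∃ B, Rem P γ j (r - 1) T (1 / (2 * Cconst r) * (Real.exp (4 * Cconst r * T * z) - 1) *
            (CH + 4 * y + 2 * Cconst r * z)) B ∧
      Gauge P E T (fun t => Y + Z t) (fun t => (Y + Zb) + B t) := by
  have hq : 1 < r - 1 := by linarith [h.hr]
  have hD := Dc_pos hq
  have hf := h.hf
  have hz := h.hz
  have hT := h.hT
  have hy := h.hy
  have hCH := h.hCH
  have hS := Ssum_ge (p := r) (by linarith)
  obtain ⟨n, hn⟩ := exists_nat_ge (4 + 4 * (Dc (r-1) * f) + 2 * (f * Ssum r))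
  have hDf : 0 ≤ Dc (r-1) * f := by positivity
  have hfS : 0 ≤ f * Ssum r := by positivity
  have hn4 : (4:ℝ) ≤ n := by linarith
  have hn0 : (0:ℝ) < n := by linarith
  set ν : ℝ := 1 / (2 * n) with hν
  have hνp : 0 < ν := by positivity
  have hν8 : ν ≤ 1/8 := by
    rw [hν, div_le_div_iff₀ (by positivity) (by norm_num)]; linarith
  set κ := Dc (r - 1) * (2 * (ν * f)) with hκ
  have hκe : κ * n = Dc (r-1) * f := by rw [hκ, hν]; field_simp
  have hκ0 : 0 ≤ κ := by positivity
  have hκ1 : κ ≤ 1/4 := by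
    by_contra hc; push Not at hc
    have : 1/4 * (n:ℝ) < κ * n := mul_lt_mul_of_pos_right hc hn0
    linarith
  have hFn : ∀ t, ν * ‖F t‖ ≤ 1/4 := by
    intro t
    have h1 := ent_norm h.hP (by linarith) (fun m n => wZ_le h.hγ j m n) hf (h.hF t)
    have h2 : ν * (f * Ssum r) ≤ 1/4 := by
      rw [hν, one_div, inv_mul_le_iff₀ (by positivity)]; linarith
    exact le_trans (mul_le_mul_of_nonneg_left h1 hνp.le) h2
  set μ := (1 + κ) / (1 - κ) with hμ
  have hμ1 : 1 ≤ μ := by rw [hμ, le_div_iff₀ (by linarith)]; linarith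
  set w := 3/2 * (f * (CH + 4 * y + 4 * Dc (r - 1) * z)) / (1 - κ) / (1 - κ) with hw
  have hw0 : 0 ≤ w := by
    have : 0 ≤ 1 - κ := by linarith
    rw [hw]; positivity
  have key : ∀ i : ℕ, i ≤ n → ∃ B, Rem P γ j (r-1) T (i / n * w * μ ^ (2 * i)) B ∧
      Gauge P E T (fun t => Y + Z t) (fun t => Y + (Z t - ((i / n : ℝ) : ℂ) • (Z t - Zb)) + B t) := by
    intro i
    induction i with
    | zero =>
      intro _
      refine ⟨fun _ => 0, ⟨StrongC1.const 0, fun _ => rfl, fun _ => star_zero _, fun t m n => ?_⟩, ?_⟩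
      · simp
      · have e : (fun t => Y + (Z t - (((0:ℕ) / n : ℝ) : ℂ) • (Z t - Zb)) + (0 : 𝓗 →L[ℂ] 𝓗)) = fun t => Y + Z t := by
          funext t; simp
        rw [e]
        exact Gauge.refl h.hP T _
    | succ i ih =>
      intro hi
      obtain ⟨B, hB, hG⟩ := ih (by omega)
      have hin : (i:ℝ) ≤ n := by exact_mod_cast (by omega : i ≤ n)
      obtain ⟨B', hB', hG'⟩ := cayley_step h hνp hν8 (θ := i / n) (by positivity)
        (by rw [div_le_one hn0]; exact hin) hκ.symm hκ1 (by positivity) hFn hB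
      refine ⟨B', ⟨hB'.1, hB'.2.1, hB'.2.2.1, fun t => (hB'.2.2.2 t).mono (fun m n => (wB_pos h.hγ j m n).le) ?_⟩, ?_⟩
      · have e1 : μ * (μ * (i / n * w * μ ^ (2 * i))) = i / n * w * μ ^ (2 * (i+1)) := by
          rw [mul_add 2 i 1, pow_add]; ring
        have e2 : 2 * ν = 1 / n := by rw [hν]; field_simp
        rw [e1, e2]
        have e3 : 1 ≤ μ ^ (2 * (i+1)) := one_le_pow₀ hμ1
        push_cast
        have e4 : 1 / (n:ℝ) * w * 1 ≤ 1 / n * w * μ ^ (2 * (i+1)) := by gcongr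
        rw [add_div, add_mul, add_mul]
        linarith
      · have e : ((i:ℝ) / n + 2 * ν) = ((i + 1 : ℕ) : ℝ) / n := by
          rw [hν]; push_cast; field_simp
        rw [e] at hG'
        exact hG.trans h.hP hG'
  obtain ⟨B, hB, hG⟩ := key n le_rfl
  refine ⟨B, ⟨hB.1, hB.2.1, hB.2.2.1, fun t => (hB.2.2.2 t).mono (fun m n => (wB_pos h.hγ j m n).le) ?_⟩, ?_⟩
  · rw [div_self hn0.ne', one_mul, Cconst_eq]
    have g1 : μ ^ (2 * n) ≤ Real.exp (6 * (Dc (r-1) * f)) := by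
      calc μ ^ (2 * n) ≤ Real.exp (3 * κ) ^ (2 * n) := pow_le_pow_left₀ (by linarith) (mu_le hκ0 hκ1) _
        _ = Real.exp (6 * (Dc (r-1) * f)) := by
          rw [← Real.exp_nat_mul]; congr 1; push_cast; rw [← hκe]; ring
    set c := CH + 4 * y + 4 * Dc (r - 1) * z with hc
    have hc0 : 0 ≤ c := by positivity
    have g2 : w ≤ 8/3 * (f * c) := by
      rw [hw, div_div, div_le_iff₀ (by nlinarith)]
      have : 9/16 ≤ (1 - κ) * (1 - κ) := by nlinarith
      have h0 : 0 ≤ f * c := by positivity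
      nlinarith
    set x := 2 * Dc (r-1) * T * z with hx
    have hx0 : 0 ≤ x := by positivity
    have g3 := exp_final hx0
    have e1 : 6 * (Dc (r-1) * f) = 3/2 * x := by rw [hx, hfT]; ring
    rw [e1] at g1
    have e2 : Real.exp (4 * (2 * Dc (r-1)) * T * z) = Real.exp (4 * x) := by congr 1; rw [hx]; ring
    have e3 : CH + 4 * y + 2 * (2 * Dc (r-1)) * z = c := by rw [hc]; ring
    rw [e2, e3]
    calc w * μ ^ (2 * n) ≤ (8/3 * (f * c)) * Real.exp (3/2 * x) := by gcongr
      _ = 1 / (2 * (2 * Dc (r-1))) * (8/3 * x * Real.exp (3/2 * x)) * c := by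
          rw [hx, hfT]; field_simp
      _ ≤ _ := by gcongr
  · have e : (fun t => Y + (Z t - (((n:ℝ) / n : ℝ) : ℂ) • (Z t - Zb)) + B t) = fun t => (Y + Zb) + B t := by
      funext t
      rw [div_self hn0.ne']; simp
    rw [e] at hG
    exact hG

end iter


section fixedpoint
variable {P : ℕ+ → 𝓗 →L[ℂ] 𝓗} {E : ℕ+ → ℝ} {γ : ℝ}

lemma two_wX (hγ : 0 < γ) (hγh : γ < 1/2) (j : ℕ) (m n : ℕ+) :
    wX γ j m n * (mxu γ n n)⁻¹ ≤ 2 * wZ γ j m n := by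
  unfold wX wZ
  have h1 := mxu_le_two_self hγ hγh m n
  have h2 := mxu_pos hγ n n
  have h3 := mxu_pos hγ m n
  have h4 := jd_pos m n
  have h5 : (jd m n)⁻¹ * (mxu γ n n)⁻¹ ≤ 2 * (mxu γ m n)⁻¹ := by
    rw [← mul_inv, ← div_eq_mul_inv, inv_eq_one_div, div_le_div_iff₀ (by positivity) h3]
    linarith
  calc (jd m n)⁻¹ * (mxu γ m n ^ j)⁻¹ * (mxu γ n n)⁻¹
      = ((jd m n)⁻¹ * (mxu γ n n)⁻¹) * (mxu γ m n ^ j)⁻¹ := by ring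
    _ ≤ (2 * (mxu γ m n)⁻¹) * (mxu γ m n ^ j)⁻¹ := by gcongr
    _ = 2 * (mxu γ m n ^ (j+1))⁻¹ := by rw [pow_succ, mul_inv]; ring

lemma right_entry (hγ : 0 < γ) (hγh : γ < 1/2) {j : ℕ} {r d q : ℝ} (hd : 0 ≤ d) (hq : 0 ≤ q)
    {D Q : 𝓗 →L[ℂ] 𝓗} (hD : Ent P r (wX γ j) d D) (m n : ℕ+) (hQ : ‖Q‖ ≤ q * (mxu γ n n)⁻¹) :
    ‖(P m * D * P n) * Q‖ ≤ (2 * d * q) * ((jd m n ^ r)⁻¹ * wZ γ j m n) := by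
  have h1 := hD m n
  have h2 := two_wX hγ hγh j m n
  have h3 := mxu_pos hγ n n
  have h4 := jpos m n r
  calc ‖(P m * D * P n) * Q‖ ≤ ‖P m * D * P n‖ * ‖Q‖ := norm_mul_le _ _
    _ ≤ (d * ((jd m n ^ r)⁻¹ * wX γ j m n)) * (q * (mxu γ n n)⁻¹) := by
        have := wX_pos hγ j m n
        gcongr
    _ = d * q * (jd m n ^ r)⁻¹ * (wX γ j m n * (mxu γ n n)⁻¹) := by ring
    _ ≤ d * q * (jd m n ^ r)⁻¹ * (2 * wZ γ j m n) := by gcongr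
    _ = _ := by ring

lemma left_entry (hγ : 0 < γ) (hγh : γ < 1/2) {j : ℕ} {r d q : ℝ} (hd : 0 ≤ d) (hq : 0 ≤ q)
    {D Q : 𝓗 →L[ℂ] 𝓗} (hD : Ent P r (wX γ j) d D) (m n : ℕ+) (hQ : ‖Q‖ ≤ q * (mxu γ m m)⁻¹) :
    ‖Q * (P m * D * P n)‖ ≤ (2 * d * q) * ((jd m n ^ r)⁻¹ * wZ γ j m n) := by
  have h1 := hD m n
  have h2 := two_wX hγ hγh j n m
  rw [wX_symm, wZ_symm] at h2
  have h3 := mxu_pos hγ m m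
  have h4 := jpos m n r
  calc ‖Q * (P m * D * P n)‖ ≤ ‖Q‖ * ‖P m * D * P n‖ := norm_mul_le _ _
    _ ≤ (q * (mxu γ m m)⁻¹) * (d * ((jd m n ^ r)⁻¹ * wX γ j m n)) := by
        have := wX_pos hγ j m n
        gcongr
    _ = d * q * (jd m n ^ r)⁻¹ * (wX γ j m n * (mxu γ m m)⁻¹) := by ring
    _ ≤ d * q * (jd m n ^ r)⁻¹ * (2 * wZ γ j m n) := by gcongr
    _ = _ := by ring

lemma ent_diag (hγ : 0 < γ) {j : ℕ} {r z : ℝ} (hz : 0 ≤ z) {Z : 𝓗 →L[ℂ] 𝓗}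
    (h : Ent P r (wZ γ j) z Z) (n : ℕ+) : ‖P n * Z * P n‖ ≤ z * (mxu γ n n)⁻¹ := by
  refine le_trans (h n n) ?_
  rw [jd_self, Real.one_rpow, inv_one, one_mul]
  unfold wZ
  have := mxu_ge hγ n n
  have h0 := mxu_pos hγ n n
  gcongr
  exact le_self_pow₀ this (by omega)

lemma DiagB.diag (hP : ProjFamily P) {y : ℝ} {Y : 𝓗 →L[ℂ] 𝓗} (h : DiagB P γ y Y) (n : ℕ+) :
    ‖P n * Y * P n‖ ≤ y * (mxu γ n n)⁻¹ := by
  rw [h.comm hP, mul_assoc, pf_idem hP]; exact h.2 n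

lemma DiagB.left_mul_entry (hP : ProjFamily P) {y : ℝ} {Y : 𝓗 →L[ℂ] 𝓗} (h : DiagB P γ y Y)
    (F : 𝓗 →L[ℂ] 𝓗) (m n : ℕ+) : P m * (Y * F) * P n = (Y * P m) * (P m * F * P n) := by
  have e1 : Y * P m * (P m * F * P n) = Y * (P m * P m) * F * P n := by simp only [mul_assoc]
  rw [e1, pf_idem hP, ← mul_assoc, h.comm hP]

/-- right-hand side of the fixed point equation -/
def gF (P : ℕ+ → 𝓗 →L[ℂ] 𝓗) (Y Zb X : 𝓗 →L[ℂ] 𝓗) (m n : ℕ+) : 𝓗 →L[ℂ] 𝓗 :=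
  (P m * X * P n) * (P n * (Y + Zb + Zb * X) * P n) - P m * (Y * X + Zb + Zb * X) * P n

structure FP (P : ℕ+ → 𝓗 →L[ℂ] 𝓗) (E : ℕ+ → ℝ) (γ cH : ℝ) (j : ℕ) (r y z e : ℝ)
    (Y Zb : 𝓗 →L[ℂ] 𝓗) : Prop where
  hP : ProjFamily P
  hγ : 0 < γ
  hγh : γ < 1/2
  hcH : 0 < cH
  hE : ∀ m n, m ≠ n → cH * jd m n * (mxu γ m n)⁻¹ ≤ |E m - E n|
  hr : 2 < r
  hy : 0 ≤ y
  hz : 0 ≤ z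
  he : 0 ≤ e
  hyz : y + z ≤ cH * e
  hDe : Dc r * e ≤ 1/24
  hYs : star Y = Y
  hYd : DiagB P γ y Y
  hZbs : star Zb = Zb
  hZb : Ent P r (wZ γ j) z Zb

variable {cH : ℝ} {j : ℕ} {r y z e : ℝ} {Y Zb : 𝓗 →L[ℂ] 𝓗}

lemma FP.hr1 (h : FP P E γ cH j r y z e Y Zb) : 1 < r := by linarith [h.hr]

lemma FP.ZX (h : FP P E γ cH j r y z e Y Zb) {d : ℝ} (hd : 0 ≤ d) {X : 𝓗 →L[ℂ] 𝓗}
    (hX : Ent P r (wX γ j) d X) : Ent P r (wZ γ j) (2 * Dc r * z * d) (Zb * X) :=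
  (Ent.mul h.hP h.hr1 h.hZb hX h.hz hd (by norm_num : (0:ℝ) ≤ 2) (fun m n => (wZ_pos h.hγ j m n).le)
    (fun m n => (wZ_pos h.hγ j m n).le) (fun m n l => W5 h.hγ h.hγh j m n l)).mono
    (fun m n => (wZ_pos h.hγ j m n).le) (le_of_eq (by ring))

lemma FP.diff (h : FP P E γ cH j r y z e Y Zb) {d : ℝ} (hd : 0 ≤ d) {X X' : 𝓗 →L[ℂ] 𝓗}
    (hX : Ent P r (wX γ j) (2*e) X) (hX' : Ent P r (wX γ j) (2*e) X')
    (hd' : Ent P r (wX γ j) d (X - X')) (m n : ℕ+) :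
    ‖gF P Y Zb X m n - gF P Y Zb X' m n‖ ≤ (cH * (d/2)) * ((jd m n ^ r)⁻¹ * wZ γ j m n) := by
  have hP := h.hP
  have hγ := h.hγ
  have hγh := h.hγh
  have hy := h.hy
  have hz := h.hz
  have he := h.he
  have hDp := Dc_pos h.hr1
  have hD12 := Dc_ge h.hr1
  have e0 : gF P Y Zb X m n - gF P Y Zb X' m n =
      (P m * (X - X') * P n) * (P n * (Y + Zb + Zb * X) * P n) +
      (P m * X' * P n) * (P n * (Zb * (X - X')) * P n) - P m * (Y * (X - X')) * P n
      - P m * (Zb * (X - X')) * P n := by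
    unfold gF; noncomm_ring
  have a1 : ‖P n * (Y + Zb + Zb * X) * P n‖ ≤ (y + z + 2 * Dc r * z * (2*e)) * (mxu γ n n)⁻¹ := by
    rw [mul_add, add_mul, mul_add, add_mul, add_mul, add_mul]
    exact le_trans (norm_add₃_le) (add_le_add (add_le_add (h.hYd.diag hP n) (ent_diag hγ hz h.hZb n))
      (ent_diag hγ (by positivity) (h.ZX (by positivity) hX) n))
  have a2 := ent_diag hγ (by positivity) (h.ZX hd hd') n
  have b1 := right_entry hγ hγh hd (by positivity) hd' m n a1
  have b2 := right_entry hγ hγh (by positivity) (by positivity) hX' m n a2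
  have b3 := left_entry hγ hγh hd hy hd' m n (h.hYd.2 m)
  rw [← h.hYd.left_mul_entry hP] at b3
  have b4 := h.ZX hd hd' m n
  rw [e0]
  have hW : 0 ≤ (jd m n ^ r)⁻¹ * wZ γ j m n := by
    have := jpos m n r
    have := wZ_pos hγ j m n
    positivity
  calc _ ≤ ‖(P m * (X - X') * P n) * (P n * (Y + Zb + Zb * X) * P n)‖ +
      ‖(P m * X' * P n) * (P n * (Zb * (X - X')) * P n)‖ + ‖P m * (Y * (X - X')) * P n‖
      + ‖P m * (Zb * (X - X')) * P n‖ := by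
        refine le_trans (norm_sub_le _ _) (add_le_add_left (le_trans (norm_sub_le _ _) (add_le_add_left (norm_add_le _ _) _)) _)
    _ ≤ (2 * d * (y + z + 2 * Dc r * z * (2*e)) + 2 * (2*e) * (2 * Dc r * z * d) + 2 * d * y
        + 2 * Dc r * z * d) * ((jd m n ^ r)⁻¹ * wZ γ j m n) := by linarith
    _ ≤ _ := by
      refine mul_le_mul_of_nonneg_right ?_ hW
      have hDe := h.hDe
      have hyz := h.hyz
      have he' : e ≤ 1/288 := by nlinarith
      have k1 : 2 * d * (y + z + 2 * Dc r * z * (2*e)) + 2 * (2*e) * (2 * Dc r * z * d) + 2 * d * y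
        + 2 * Dc r * z * d = d * (4 * y + 2 * z + 16 * (Dc r * e) * z + 2 * Dc r * z) := by ring
      rw [k1]
      have k2 : 4 * y + 2 * z + 16 * (Dc r * e) * z + 2 * Dc r * z ≤ (5 + 2 * Dc r) * (y + z) := by
        nlinarith
      have k3 : (5 + 2 * Dc r) * (y + z) ≤ (5 + 2 * Dc r) * (cH * e) := by gcongr
      have k4 : (5 + 2 * Dc r) * (cH * e) = cH * (5 * e + 2 * (Dc r * e)) := by ring
      have k5 : cH * (5 * e + 2 * (Dc r * e)) ≤ cH * (1/2) := by
        have := h.hcH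
        gcongr; linarith
      calc _ ≤ d * (cH * (1/2)) := by gcongr; linarith
        _ = _ := by ring

lemma ent_zero (hg : ∀ m n, 0 ≤ (wX γ j) m n) {a : ℝ} (ha : 0 ≤ a) : Ent P r (wX γ j) a (0 : 𝓗 →L[ℂ] 𝓗) := by
  intro m n
  have := hg m n
  have := jpos m n r
  rw [mul_zero, zero_mul, norm_zero]; positivity

lemma FP.bd (h : FP P E γ cH j r y z e Y Zb) {X : 𝓗 →L[ℂ] 𝓗}
    (hX : Ent P r (wX γ j) (2*e) X) (m n : ℕ+) :
    ‖gF P Y Zb X m n‖ ≤ (cH * (2 * e)) * ((jd m n ^ r)⁻¹ * wZ γ j m n) := by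
  have he := h.he
  have h1 := h.diff (by positivity : 0 ≤ 2 * e) hX (ent_zero (fun m n => (wX_pos h.hγ j m n).le)
    (by positivity : 0 ≤ 2 * e)) (by rwa [sub_zero]) m n
  have h2 : ‖gF P Y Zb 0 m n‖ ≤ (cH * e) * ((jd m n ^ r)⁻¹ * wZ γ j m n) := by
    have : gF P Y Zb 0 m n = -(P m * Zb * P n) := by unfold gF; simp
    rw [this, norm_neg]
    refine h.hZb.mono (fun m n => (wZ_pos h.hγ j m n).le) ?_ m n
    linarith [h.hyz, h.hy]
  have h3 : gF P Y Zb X m n = (gF P Y Zb X m n - gF P Y Zb 0 m n) + gF P Y Zb 0 m n := by abel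
  rw [h3]
  refine le_trans (norm_add_le _ _) ?_
  linarith

/-- passing from the right-hand side to the solution through the gap -/
lemma FP.gap (h : FP P E γ cH j r y z e Y Zb) {m n : ℕ+} (hmn : m ≠ n) {G : 𝓗 →L[ℂ] 𝓗} {c : ℝ} (hc : 0 ≤ c)
    (hG : ‖G‖ ≤ (cH * c) * ((jd m n ^ r)⁻¹ * wZ γ j m n)) :
    ‖(((E m - E n : ℝ) : ℂ)⁻¹) • G‖ ≤ c * ((jd m n ^ r)⁻¹ * wX γ j m n) := by
  have hcH := h.hcH
  have h1 := h.hE m n hmn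
  have h2 := mxu_pos h.hγ m n
  have h3 := jd_pos m n
  have h4 := jpos m n r
  have h5 : 0 < |E m - E n| := lt_of_lt_of_le (by positivity) h1
  rw [norm_smul, norm_inv, Complex.norm_real, Real.norm_eq_abs, inv_mul_le_iff₀ h5]
  refine le_trans hG ?_
  calc cH * c * ((jd m n ^ r)⁻¹ * wZ γ j m n) = (cH * jd m n * (mxu γ m n)⁻¹) * (c * ((jd m n ^ r)⁻¹ * wX γ j m n)) := by
        unfold wZ wX; rw [pow_succ]; field_simp
    _ ≤ _ := by
      have := wX_pos h.hγ j m n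
      gcongr

def SolStep (P : ℕ+ → 𝓗 →L[ℂ] 𝓗) (E : ℕ+ → ℝ) (Y Zb X X' : 𝓗 →L[ℂ] 𝓗) : Prop :=
  ∀ m n, P m * X' * P n = if m = n then 0 else (((E m - E n : ℝ) : ℂ)⁻¹) • gF P Y Zb X m n

lemma gF_l (hP : ProjFamily P) (X : 𝓗 →L[ℂ] 𝓗) (m n : ℕ+) : P m * gF P Y Zb X m n = gF P Y Zb X m n := by
  unfold gF; rw [mul_sub]; simp only [← mul_assoc, pf_idem hP]
lemma gF_r (hP : ProjFamily P) (X : 𝓗 →L[ℂ] 𝓗) (m n : ℕ+) : gF P Y Zb X m n * P n = gF P Y Zb X m n := by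
  unfold gF; rw [sub_mul]; simp only [mul_assoc, pf_idem hP]

lemma FP.ex_step (h : FP P E γ cH j r y z e Y Zb) {X : 𝓗 →L[ℂ] 𝓗} (hX : Ent P r (wX γ j) (2*e) X) :
    ∃ X', SolStep P E Y Zb X X' ∧ Ent P r (wX γ j) (2*e) X' := by
  have he := h.he
  have key : ∀ m n, ‖(if m = n then 0 else (((E m - E n : ℝ) : ℂ)⁻¹) • gF P Y Zb X m n)‖ ≤
      (2*e) * ((jd m n ^ r)⁻¹ * wX γ j m n) := by
    intro m n
    have := wX_pos h.hγ j m n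
    have := jpos m n r
    split_ifs with hmn
    · rw [norm_zero]; positivity
    · exact h.gap hmn (by positivity) (h.bd hX m n)
  obtain ⟨X', h1, _⟩ := blockOp h.hP h.hr1 (by positivity : 0 ≤ 2*e)
    (fun m n => if m = n then 0 else (((E m - E n : ℝ) : ℂ)⁻¹) • gF P Y Zb X m n)
    (fun m n => by split_ifs; · simp
                   · rw [mul_smul_comm, gF_l h.hP])
    (fun m n => by split_ifs; · simp
                   · rw [smul_mul_assoc, gF_r h.hP])
    (fun m n => le_trans (key m n) (by
      have := wX_le h.hγ j m n
      have := jpos m n r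
      calc _ ≤ (2*e) * ((jd m n ^ r)⁻¹ * 1) := by gcongr
        _ = _ := by ring))
  exact ⟨X', h1, fun m n => by rw [h1]; exact key m n⟩

lemma FP.exists_X (h : FP P E γ cH j r y z e Y Zb) :
    ∃ X, SolStep P E Y Zb X X ∧ Ent P r (wX γ j) (2*e) X := by
  have he := h.he
  have hS := Ssum_ge h.hr1
  let S := {X : 𝓗 →L[ℂ] 𝓗 // Ent P r (wX γ j) (2*e) X}
  choose φ hφ hφ' using fun X : S => h.ex_step X.2
  let Φ : S → S := fun X => ⟨φ X, hφ' X⟩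
  let x0 : S := ⟨0, ent_zero (fun m n => (wX_pos h.hγ j m n).le) (by positivity : 0 ≤ 2 * e)⟩
  let x : ℕ → S := fun k => Φ^[k] x0
  have hx : ∀ k, (x (k+1)).1 = φ (x k) := fun k => by
    change (Φ^[k+1] x0).1 = _
    rw [Function.iterate_succ_apply']
  have hd : ∀ k, Ent P r (wX γ j) (2 * e * (1/2)^k) ((x (k+1)).1 - (x k).1) := by
    intro k
    induction k with
    | zero =>
      have : (x 0).1 = 0 := rfl
      rw [this, sub_zero, pow_zero, mul_one]; exact (x 1).2
    | succ k ih =>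
      intro m n
      rw [hx (k+1), hx k, mul_sub, sub_mul, hφ, hφ]
      have := wX_pos h.hγ j m n
      have := jpos m n r
      split_ifs with hmn
      · rw [sub_zero, norm_zero]; positivity
      · rw [← smul_sub]
        apply h.gap hmn (by positivity)
        have := h.diff (by positivity) (x (k+1)).2 (x k).2 ih m n
        refine le_trans this (le_of_eq ?_)
        ring
  have hn : ∀ k, dist (x k).1 (x (k+1)).1 ≤ (2 * e * Ssum r) * (1/2)^k := by
    intro k
    rw [dist_comm, dist_eq_norm]
    refine le_trans (ent_norm h.hP h.hr1 (fun m n => wX_le h.hγ j m n) (by positivity) (hd k)) (le_of_eq (by ring))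
  have hc := cauchySeq_of_le_geometric (1/2) _ (by norm_num) hn
  obtain ⟨X, hX⟩ := cauchySeq_tendsto_of_complete hc
  refine ⟨X, fun m n => ?_, Ent.lim (fun k => (x k).2) hX⟩
  have t1 : Filter.Tendsto (fun k => P m * (x (k+1)).1 * P n) Filter.atTop (nhds (P m * X * P n)) :=
    (((Filter.tendsto_add_atTop_iff_nat 1).2 hX).const_mul _).mul_const _
  have cg : Continuous fun X : 𝓗 →L[ℂ] 𝓗 => if m = n then 0 else (((E m - E n : ℝ) : ℂ)⁻¹) • gF P Y Zb X m n := by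
    split_ifs
    · exact continuous_const
    · unfold gF; fun_prop
  have t2 := (cg.tendsto X).comp hX
  refine tendsto_nhds_unique t1 (t2.congr (fun k => ?_))
  rw [hx, hφ]; rfl

end fixedpoint

section diagonalization
variable {P : ℕ+ → 𝓗 →L[ℂ] 𝓗} {E : ℕ+ → ℝ} {γ : ℝ}

lemma diag_comm (hP : ProjFamily P) {Y : 𝓗 →L[ℂ] 𝓗} (h : ∀ m n, m ≠ n → P m * Y * P n = 0) (n : ℕ+) :
    P n * Y = Y * P n := by
  have : DiagB P 0 ‖Y‖ Y := ⟨h, fun n => by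
    unfold mxu
    rw [mul_zero, Real.rpow_zero, inv_one]
    exact le_trans (norm_mul_le _ _) (mul_le_mul_of_nonneg_left (pf_norm_le hP n) (norm_nonneg _))⟩
  exact this.comm hP n

lemma comm_diag (hP : ProjFamily P) {Y : 𝓗 →L[ℂ] 𝓗} (h : ∀ n, P n * Y = Y * P n) {m n : ℕ+} (hmn : m ≠ n) :
    P m * Y * P n = 0 := by
  rw [h, mul_assoc, pf_orth hP hmn, mul_zero]

lemma exists_sqrt {T Ti : 𝓗 →L[ℂ] 𝓗} (h1 : T * Ti = 1) (h2 : Ti * T = 1) :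
    ∃ S : 𝓗 →L[ℂ] 𝓗, star S = S ∧ S * S = Ti * star Ti ∧ ‖S‖ ^ 2 = ‖Ti‖ ^ 2 ∧
      ∀ Q, Q * (star T * T) = (star T * T) * Q → Q * S = S * Q := by
  have hnn : 0 ≤ Ti * star Ti := mul_star_self_nonneg Ti
  have hS : CFC.sqrt (Ti * star Ti) * CFC.sqrt (Ti * star Ti) = Ti * star Ti :=
    CFC.sqrt_mul_sqrt_self _ hnn
  have hs : star (CFC.sqrt (Ti * star Ti)) = CFC.sqrt (Ti * star Ti) :=
    (IsSelfAdjoint.of_nonneg (CFC.sqrt_nonneg _)).star_eq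
  refine ⟨CFC.sqrt (Ti * star Ti), hs, hS, ?_, ?_⟩
  · have a : ‖star (CFC.sqrt (Ti * star Ti)) * CFC.sqrt (Ti * star Ti)‖ = _ := CStarRing.norm_star_mul_self
    have b : ‖Ti * star Ti‖ = _ := CStarRing.norm_self_mul_star
    rw [hs, hS] at a
    rw [sq, sq, ← a, b]
  · intro Q hQ
    have s1 : star Ti * star T = 1 := by rw [← star_mul, h1, star_one]
    have s2 : star T * star Ti = 1 := by rw [← star_mul, h2, star_one]
    have i1 : (Ti * star Ti) * (star T * T) = 1 := by
      rw [mul_assoc, ← mul_assoc (star Ti), s1, one_mul, h2]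
    have i2 : (star T * T) * (Ti * star Ti) = 1 := by
      rw [mul_assoc, ← mul_assoc T, h1, one_mul, s2]
    have hc : (Ti * star Ti) * Q = Q * (Ti * star Ti) := by
      calc (Ti * star Ti) * Q = (Ti * star Ti) * Q * ((star T * T) * (Ti * star Ti)) := by rw [i2, mul_one]
        _ = (Ti * star Ti) * (Q * (star T * T)) * (Ti * star Ti) := by simp only [mul_assoc]
        _ = ((Ti * star Ti) * (star T * T)) * Q * (Ti * star Ti) := by rw [hQ]; simp only [mul_assoc]
        _ = _ := by rw [i1, one_mul]
    have := Commute.cfc_nnreal (a := Ti * star Ti) (b := Q) hc NNReal.sqrt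
    rw [← CFC.sqrt_eq_cfc] at this
    exact this.symm

variable {cH : ℝ} {j : ℕ} {r y z e : ℝ} {Y Zb : 𝓗 →L[ℂ] 𝓗}

lemma FP.exists_A' (h : FP P E γ cH j r y z e Y Zb) {X : 𝓗 →L[ℂ] 𝓗} (hs : SolStep P E Y Zb X X)
    (hX : Ent P r (wX γ j) (2*e) X) :
    ∃ A', DiagB P γ (7/6 * (y + z)) A' ∧
      HRel P E (1 + X) ((1 + X) * A' - (Y + Zb) * (1 + X)) := by
  have hP := h.hP
  have hy := h.hy
  have hz := h.hz
  have he := h.he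
  have hD := Dc_pos h.hr1
  obtain ⟨A', hA, _⟩ := blockOp hP h.hr1 (norm_nonneg ((Y + Zb) * (1 + X)))
    (fun m n => if m = n then P n * ((Y + Zb) * (1 + X)) * P n else 0)
    (fun m n => by
      split_ifs with hmn
      · subst hmn; simp only [← mul_assoc, pf_idem hP]
      · simp)
    (fun m n => by
      split_ifs with hmn
      · simp only [mul_assoc, pf_idem hP]
      · simp)
    (fun m n => by
      have := jpos m n r
      split_ifs with hmn
      · subst hmn
        rw [jd_self, Real.one_rpow, inv_one, mul_one]
        exact entry_le hP _ m m
      · rw [norm_zero]; positivity)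
  have hXd : ∀ n, P n * X * P n = 0 := fun n => by rw [hs n n, if_pos rfl]
  have hcomm := diag_comm hP (Y := A') (fun m n hmn => by rw [hA, if_neg hmn])
  have hAP : ∀ n, A' * P n = P n * ((Y + Zb) * (1 + X)) * P n := by
    intro n
    have := hA n n
    rw [if_pos rfl, hcomm, mul_assoc, pf_idem hP] at this
    exact this
  have hYX : ∀ n, P n * (Y * X) * P n = 0 := fun n => by
    rw [h.hYd.left_mul_entry hP, hXd, mul_zero]
  have hAP' : ∀ n, A' * P n = P n * (Y + Zb + Zb * X) * P n := by
    intro n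
    rw [hAP]
    have : P n * ((Y + Zb) * (1 + X)) * P n = P n * (Y + Zb + Zb * X) * P n + P n * (Y * X) * P n := by
      noncomm_ring
    rw [this, hYX, add_zero]
  refine ⟨A', ⟨fun m n hmn => by rw [hA, if_neg hmn], fun n => ?_⟩, fun m n => ?_⟩
  · rw [hAP']
    have hm := mxu_pos h.hγ n n
    have a1 : ‖P n * (Y + Zb + Zb * X) * P n‖ ≤ (y + z + 2 * Dc r * z * (2*e)) * (mxu γ n n)⁻¹ := by
      rw [mul_add, add_mul, mul_add, add_mul, add_mul, add_mul]
      exact le_trans (norm_add₃_le) (add_le_add (add_le_add (h.hYd.diag hP n) (ent_diag h.hγ hz h.hZb n))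
        (ent_diag h.hγ (by positivity) (h.ZX (by positivity) hX) n))
    refine le_trans a1 ?_
    gcongr
    have := h.hDe
    nlinarith
  · have e1 : P m * ((1 + X) * A' - (Y + Zb) * (1 + X)) * P n =
        (P m * P n) * (A' * P n) + (P m * X * P n) * (A' * P n) - P m * ((Y + Zb) * (1 + X)) * P n := by
      have : A' * P n = P n * (A' * P n) := by rw [← mul_assoc, hcomm, mul_assoc, pf_idem hP]
      have k : P m * (1 + X) * (P n * (A' * P n)) = (P m * P n) * (A' * P n) + (P m * X * P n) * (A' * P n) := by
        noncomm_ring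
      rw [← k, ← this]; noncomm_ring
    rw [e1]
    by_cases hmn : m = n
    · subst hmn
      rw [hXd, zero_mul, add_zero, pf_idem hP, sub_self, Complex.ofReal_zero, zero_smul, ← hAP,
        ← mul_assoc, hcomm, mul_assoc, pf_idem hP, sub_self]
    · have e2 : P m * (1 + X) * P n = P m * X * P n := by
        rw [mul_add, add_mul, mul_one, pf_orth hP hmn, zero_add]
      have hE : ((E m - E n : ℝ) : ℂ) ≠ 0 := by
        have h1 := h.hE m n hmn
        have h2 := mxu_pos h.hγ m n
        have h3 := jd_pos m n
        have hcH := h.hcH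
        have h5 : 0 < |E m - E n| := lt_of_lt_of_le (by positivity) h1
        exact Complex.ofReal_ne_zero.2 (abs_pos.1 h5)
      have e3 := hs m n
      rw [if_neg hmn] at e3
      have e4 : ((E m - E n : ℝ) : ℂ) • (P m * X * P n) = gF P Y Zb X m n := by
        conv_lhs => rw [e3]
        rw [smul_inv_smul₀ hE]
      rw [e2, e4, pf_orth hP hmn, zero_mul, zero_add, hAP']
      unfold gF
      have e5 : P m * ((Y + Zb) * (1 + X)) * P n = P m * (Y * X + Zb + Zb * X) * P n + P m * Y * P n := by
        noncomm_ring
      rw [e5, h.hYd.1 m n hmn, add_zero]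

/-- the Gram operator is diagonal -/
lemma FP.gram (h : FP P E γ cH j r y z e Y Zb) {T A' : 𝓗 →L[ℂ] 𝓗} (hA : DiagB P γ (7/6 * (y + z)) A')
    (hT : HRel P E T (T * A' - (Y + Zb) * T)) :
    (∀ n, P n * (star T * T) = (star T * T) * P n) ∧ (star T * T) * A' = star A' * (star T * T) := by
  have hP := h.hP
  have hN : HRel P E (star T * T) ((star T * T) * A' - star A' * (star T * T)) := by
    have := (hT.star hP).mul hP hT
    have e1 : -star (T * A' - (Y + Zb) * T) * T + star T * (T * A' - (Y + Zb) * T) =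
        (star T * T) * A' - star A' * (star T * T) := by
      rw [star_sub, star_mul, star_mul, star_add, h.hYs, h.hZbs]
      noncomm_ring
    rwa [e1] at this
  have hAs : ∀ n, ‖P n * star A'‖ = ‖A' * P n‖ := fun n => by
    rw [← norm_star, star_mul, star_star, pf_star hP]
  have off : ∀ m n, m ≠ n → P m * (star T * T) * P n = 0 := by
    intro m n hmn
    set N := star T * T
    have h0 := hN m n
    have hcs : P m * star A' = star A' * P m := by
      have := congrArg star (hA.comm hP m)
      rw [star_mul, star_mul, pf_star hP] at this
      exact this.symm
    have e1 : P m * (N * A' - star A' * N) * P n = (P m * N * P n) * (A' * P n) - (P m * star A') * (P m * N * P n) := by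
      rw [mul_sub, sub_mul, hA.mul_entry hP]
      congr 1
      have : P m * star A' = P m * star A' * P m := by
        rw [mul_assoc, ← hcs, ← mul_assoc, pf_idem hP]
      have k : P m * star A' * (P m * N * P n) = (P m * star A' * P m) * N * P n := by simp only [mul_assoc]
      rw [k, ← this]; simp only [mul_assoc]
    rw [e1] at h0
    have n1 := congrArg norm h0
    rw [norm_smul, Complex.norm_real, Real.norm_eq_abs] at n1
    have n2 : |E m - E n| * ‖P m * N * P n‖ ≤ ‖P m * N * P n‖ * ‖A' * P n‖ + ‖A' * P m‖ * ‖P m * N * P n‖ := by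
      rw [← n1, ← hAs m]
      exact le_trans (norm_sub_le _ _) (add_le_add (norm_mul_le _ _) (norm_mul_le _ _))
    have b1 := hA.2 n
    have b2 := hA.2 m
    have g1 := mxu_le_two_self h.hγ h.hγh m n
    have g2 := mxu_le_two_self h.hγ h.hγh n m
    rw [mxu_symm, jd_symm] at g2
    have p1 := mxu_pos h.hγ m n
    have p2 := mxu_pos h.hγ n n
    have p3 := mxu_pos h.hγ m m
    have p4 := jd_pos m n
    have hcH := h.hcH
    have he := h.he
    have inv1 : (mxu γ n n)⁻¹ ≤ 2 * jd m n * (mxu γ m n)⁻¹ := by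
      rw [inv_eq_one_div, ← div_eq_mul_inv, div_le_div_iff₀ p2 p1]; linarith
    have inv2 : (mxu γ m m)⁻¹ ≤ 2 * jd m n * (mxu γ m n)⁻¹ := by
      rw [inv_eq_one_div, ← div_eq_mul_inv, div_le_div_iff₀ p3 p1]; linarith
    have hyz0 : 0 ≤ y + z := add_nonneg h.hy h.hz
    have hyz := h.hyz
    have he' : e ≤ 1/288 := by nlinarith [h.hDe, Dc_ge h.hr1]
    have c0 : 0 < jd m n * (mxu γ m n)⁻¹ := by positivity
    have hk : 7/3 * (y+z) ≤ cH * (1/10) := by nlinarith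
    have c1 : ‖A' * P n‖ ≤ cH * (1/10) * (jd m n * (mxu γ m n)⁻¹) := by
      calc _ ≤ 7/6 * (y+z) * (mxu γ n n)⁻¹ := b1
        _ ≤ 7/6 * (y+z) * (2 * jd m n * (mxu γ m n)⁻¹) := by gcongr
        _ = (7/3 * (y+z)) * (jd m n * (mxu γ m n)⁻¹) := by ring
        _ ≤ _ := mul_le_mul_of_nonneg_right hk c0.le
    have c2 : ‖A' * P m‖ ≤ cH * (1/10) * (jd m n * (mxu γ m n)⁻¹) := by
      calc _ ≤ 7/6 * (y+z) * (mxu γ m m)⁻¹ := b2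
        _ ≤ 7/6 * (y+z) * (2 * jd m n * (mxu γ m n)⁻¹) := by gcongr
        _ = (7/3 * (y+z)) * (jd m n * (mxu γ m n)⁻¹) := by ring
        _ ≤ _ := mul_le_mul_of_nonneg_right hk c0.le
    have hgap := h.hE m n hmn
    rw [mul_assoc] at hgap
    have d0 : 0 < cH * (jd m n * (mxu γ m n)⁻¹) := by positivity
    have hx := norm_nonneg (P m * N * P n)
    by_contra hne
    have hx' : 0 < ‖P m * N * P n‖ := norm_pos_iff.2 hne
    have : |E m - E n| ≤ ‖A' * P n‖ + ‖A' * P m‖ := by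
      by_contra hlt
      push Not at hlt
      nlinarith
    nlinarith
  refine ⟨diag_comm hP off, ?_⟩
  rw [← sub_eq_zero]
  apply op_ext hP
  intro m n
  rw [hN m n, mul_zero, zero_mul]
  by_cases hmn : m = n
  · subst hmn; simp
  · rw [off m n hmn, smul_zero]

end diagonalization

section finalstep
variable {P : ℕ+ → 𝓗 →L[ℂ] 𝓗} {E : ℕ+ → ℝ} {γ : ℝ}
variable {cH : ℝ} {j : ℕ} {r y z e : ℝ} {Y Zb : 𝓗 →L[ℂ] 𝓗}

lemma Dc_ratio (hr : 2 < r) : Dc r ≤ 2 * Dc (r - 1) := by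
  unfold Dc
  have h1 : Ssum r ≤ Ssum (r - 1) := by
    unfold Ssum; linarith [rzeta_anti (p := r - 1) (q := r) (by linarith) (by linarith)]
  rw [sub_add_cancel, Real.rpow_add_one (by norm_num)]
  have : (0:ℝ) < 2 ^ r := by positivity
  nlinarith

lemma Ssum_Dc (hr : 2 < r) : 8 * Ssum r ≤ Dc r := by
  unfold Dc; have := Ssum_ge (p := r) (by linarith)
  have h : (2:ℝ)^(3:ℝ) ≤ 2 ^ (r+1) := Real.rpow_le_rpow_of_exponent_le (by norm_num) (by linarith)
  norm_num at h
  nlinarith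

/-- the weighted bound of a conjugation -/
lemma FP.conj_ent (h : FP P E γ cH j r y z e Y Zb) {X S M : 𝓗 →L[ℂ] 𝓗}
    (hX : Ent P r (wX γ j) (2*e) X) (hSP : ∀ n, P n * S = S * P n) (hS : ‖S‖ ^ 2 ≤ 3/2)
    {b : ℝ} (hb : 0 ≤ b) (hM : Ent P (r - 1) (wB γ j) b M) :
    Ent P (r - 1) (wB γ j) (Real.exp (2 * Cconst r / Cconst (r + 1)) * b)
      (S * (star (1 + X) * M * (1 + X)) * S) := by
  have hP := h.hP
  have hγ := h.hγ
  have he := h.he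
  have hq : 1 < r - 1 := by linarith [h.hr]
  have hW := ent_XW hγ h.hγh (by positivity : 0 ≤ 2 * e) hX
  set κ := Dc (r-1) * (4 * (2*e)) with hκ
  have hD1 := Dc_pos hq
  have hD := Dc_pos h.hr1
  have hκ0 : 0 ≤ κ := by positivity
  have g0 : ∀ m n, 0 ≤ wB γ j m n := fun m n => (wB_pos hγ j m n).le
  have h1 : Ent P (r-1) (wB γ j) ((1 + κ) * b) (M * (1 + X)) := by
    rw [mul_add, mul_one]
    exact (hM.add (BW_B hP hγ hq (by positivity) hb hW hM)).mono g0 (le_of_eq (by rw [hκ]; ring))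
  have h2 : Ent P (r-1) (wB γ j) ((1 + κ) ^ 2 * b) (star (1 + X) * M * (1 + X)) := by
    rw [mul_assoc, star_add, star_one, add_mul, one_mul]
    exact (h1.add (WB_B hP hγ hq (by positivity) (by positivity) (hW.star hP (wW_symm j)) h1)).mono g0
      (le_of_eq (by rw [hκ]; ring))
  set ρ := Dc (r-1) / Dc r with hρ
  have e1 : 2 * Cconst r / Cconst (r + 1) = 2 * ρ := by
    rw [Cconst_eq, Cconst_eq, add_sub_cancel_right, hρ]; field_simp
  have hρ2 : 1/2 ≤ ρ := by
    rw [hρ, div_le_div_iff₀ (by norm_num) hD]; linarith [Dc_ratio h.hr]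
  have hκρ : κ ≤ ρ / 3 := by
    have : κ = 8 * ρ * (Dc r * e) := by rw [hκ, hρ]; field_simp; ring
    rw [this]
    have := h.hDe
    nlinarith
  have hfin : 3/2 * (1 + κ)^2 ≤ Real.exp (2 * ρ) := by
    have a1 : 1 + κ ≤ Real.exp (ρ/3) := by linarith [Real.add_one_le_exp (ρ/3)]
    have a2 : 3/2 ≤ Real.exp (4 * ρ / 3) := by linarith [Real.add_one_le_exp (4 * ρ/3)]
    have a3 : Real.exp (2 * ρ) = Real.exp (4 * ρ / 3) * Real.exp (ρ/3) ^ 2 := by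
      rw [← Real.exp_nat_mul, ← Real.exp_add]; congr 1; push_cast; ring
    rw [a3]; gcongr
  intro m n
  have k : P m * (S * (star (1 + X) * M * (1 + X)) * S) * P n =
      S * (P m * (star (1 + X) * M * (1 + X)) * P n) * S := by
    have t : P m * (S * (star (1 + X) * M * (1 + X)) * S) * P n =
      (P m * S) * (star (1 + X) * M * (1 + X)) * (S * P n) := by simp only [mul_assoc]
    rw [t, hSP, ← hSP n]; simp only [mul_assoc]
  rw [k, e1]
  have hw : 0 ≤ ((jd m n ^ (r-1))⁻¹ * wB γ j m n) := by
    have := jpos m n (r-1)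
    have := g0 m n
    positivity
  calc _ ≤ ‖S‖ * ‖P m * (star (1 + X) * M * (1 + X)) * P n‖ * ‖S‖ :=
        le_trans (norm_mul_le _ _) (mul_le_mul_of_nonneg_right (norm_mul_le _ _) (norm_nonneg _))
    _ = ‖S‖ ^ 2 * ‖P m * (star (1 + X) * M * (1 + X)) * P n‖ := by ring
    _ ≤ 3/2 * ((1 + κ) ^ 2 * b * ((jd m n ^ (r-1))⁻¹ * wB γ j m n)) := by
        gcongr; exact h2 m n
    _ = (3/2 * (1 + κ)^2) * (b * ((jd m n ^ (r-1))⁻¹ * wB γ j m n)) := by ring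
    _ ≤ Real.exp (2 * ρ) * (b * ((jd m n ^ (r-1))⁻¹ * wB γ j m n)) := by
        gcongr
    _ = _ := by ring

lemma FP.diagonalize (h : FP P E γ cH j r y z e Y Zb) {T b : ℝ} (hb : 0 ≤ b)
    {B : ℝ → 𝓗 →L[ℂ] 𝓗} (hB : Rem P γ j (r - 1) T b B) :
    ∃ A B', star A = A ∧ DiagB P γ (2 * (y + z)) A ∧
      Rem P γ j (r - 1) T (Real.exp (2 * Cconst r / Cconst (r + 1)) * b) B' ∧
      Gauge P E T (fun t => (Y + Zb) + B t) (fun t => A + B' t) := by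
  have hP := h.hP
  obtain ⟨X, hs, hX⟩ := h.exists_X
  obtain ⟨A', hA, hT⟩ := h.exists_A' hs hX
  obtain ⟨hN1, hN2⟩ := h.gram hA hT
  have he := h.he
  have hXn : ‖X‖ ≤ 1/96 := by
    have h1 := ent_norm hP h.hr1 (fun m n => wX_le h.hγ j m n) (by positivity) hX
    have h2 := Ssum_Dc h.hr
    have h3 := h.hDe
    nlinarith
  have h1n : ‖(1 : 𝓗 →L[ℂ] 𝓗)‖ ≤ 1 := ContinuousLinearMap.norm_id_le
  have hTn : ‖1 + X‖ ≤ 97/96 := le_trans (norm_add_le _ _) (by linarith)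
  have hu : IsUnit (1 + X) := by
    have : ((Units.oneSub (-X) (by rw [norm_neg]; linarith) : (𝓗 →L[ℂ] 𝓗)ˣ) : 𝓗 →L[ℂ] 𝓗) = 1 + X := by
      rw [Units.val_oneSub, sub_neg_eq_add]
    exact ⟨_, this⟩
  obtain ⟨Ti, hT1, hT2⟩ : ∃ Ti, (1 + X) * Ti = 1 ∧ Ti * (1 + X) = 1 :=
    ⟨Ring.inverse (1 + X), Ring.mul_inverse_cancel _ hu, Ring.inverse_mul_cancel _ hu⟩
  have hTi : ‖Ti‖ ≤ 96/95 := by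
    have k : Ti = 1 - X * Ti := by rw [← hT1]; noncomm_ring
    have k2 : ‖Ti‖ ≤ 1 + 1/96 * ‖Ti‖ := by
      calc ‖Ti‖ = ‖1 - X * Ti‖ := by rw [← k]
        _ ≤ ‖(1 : 𝓗 →L[ℂ] 𝓗)‖ + ‖X‖ * ‖Ti‖ := le_trans (norm_sub_le _ _) (by gcongr; exact norm_mul_le _ _)
        _ ≤ _ := by gcongr
    linarith
  obtain ⟨S, hSs, hSS, hSn, hSc⟩ := exists_sqrt hT1 hT2
  set Th := 1 + X with hTh
  set N := star Th * Th with hN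
  have hSn' : ‖S‖ ^ 2 ≤ 11/10 := by
    rw [hSn]; nlinarith [norm_nonneg Ti]
  have hNn : ‖N‖ ≤ 11/10 := by
    refine le_trans (norm_mul_le _ _) ?_
    rw [norm_star]; nlinarith [norm_nonneg Th]
  have hSP : ∀ n, P n * S = S * P n := fun n => hSc _ (hN1 n)
  have hNS : N * S = S * N := hSc N rfl
  have s1 : star Ti * star Th = 1 := by rw [← star_mul, hT1, star_one]
  have s2 : star Th * star Ti = 1 := by rw [← star_mul, hT2, star_one]
  have hSNS : S * N * S = 1 := by
    rw [← hNS, mul_assoc, hSS, hN, mul_assoc, ← mul_assoc Th, hT1, one_mul, s2]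
  -- the unitary
  have hstar : star (S * star Th) = Th * S := by rw [star_mul, star_star, hSs]
  have hW : IsUnitaryOp (S * star Th) := by
    constructor
    · rw [hstar, ← hSNS, hN]; simp only [mul_assoc]
    · rw [hstar]
      calc Th * S * (S * star Th) = Th * (S * S) * star Th := by simp only [mul_assoc]
        _ = (Th * Ti) * (star Ti * star Th) := by rw [hSS]; simp only [mul_assoc]
        _ = 1 := by rw [hT1, s1, one_mul]
  have hHS : HRel P E S 0 := by
    intro m n
    rw [mul_zero, zero_mul]
    by_cases hmn : m = n
    · subst hmn; simp
    · rw [comm_diag hP hSP hmn, smul_zero]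
  have hK : HRel P E (Th * S) ((Th * A' - (Y + Zb) * Th) * S) := by
    have := hT.mul hP hHS
    rwa [mul_zero, add_zero] at this
  have hAc := hA.comm hP
  refine ⟨S * (N * A') * S, fun t => S * (star Th * B t * Th) * S, ?_, ⟨?_, ?_⟩, ⟨?_, ?_, ?_, ?_⟩, ?_⟩
  · rw [star_mul, star_mul, hSs]
    have : star (N * A') = N * A' := by
      rw [star_mul, hN2]
      congr 1
      rw [hN, star_mul, star_star]
    rw [this]; simp only [mul_assoc]
  · intro m n hmn
    apply comm_diag hP (fun n => ?_) hmn
    calc P n * (S * (N * A') * S) = (P n * S) * (N * A') * S := by simp only [mul_assoc]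
      _ = S * (P n * N) * A' * S := by rw [hSP]; simp only [mul_assoc]
      _ = S * N * (P n * A') * S := by rw [hN1]; simp only [mul_assoc]
      _ = S * N * A' * (P n * S) := by rw [hAc]; simp only [mul_assoc]
      _ = _ := by rw [hSP]; simp only [mul_assoc]
  · intro n
    have k : S * (N * A') * S * P n = S * N * (A' * P n) * S := by
      rw [mul_assoc, ← hSP]; simp only [mul_assoc]
    rw [k]
    have hm := mxu_pos h.hγ n n
    have hyz : 0 ≤ y + z := add_nonneg h.hy h.hz
    calc ‖S * N * (A' * P n) * S‖ ≤ ‖S‖ * ‖N‖ * ‖A' * P n‖ * ‖S‖ := by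
          refine le_trans (norm_mul_le _ _) (mul_le_mul_of_nonneg_right ?_ (norm_nonneg _))
          exact le_trans (norm_mul_le _ _) (mul_le_mul_of_nonneg_right (norm_mul_le _ _) (norm_nonneg _))
      _ = ‖S‖^2 * (‖N‖ * ‖A' * P n‖) := by ring
      _ ≤ 11/10 * (11/10 * (7/6 * (y+z) * (mxu γ n n)⁻¹)) := by
          gcongr; exact hA.2 n
      _ = (11/10 * (11/10 * (7/6)) ) * ((y+z) * (mxu γ n n)⁻¹) := by ring
      _ ≤ 2 * ((y+z) * (mxu γ n n)⁻¹) := by gcongr; norm_num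
      _ = _ := by ring
  · exact ((StrongC1.const S).mul (((StrongC1.const (star Th)).mul hB.1).mul (StrongC1.const Th))).mul
      (StrongC1.const S)
  · intro t; simp only [hB.2.1 t]
  · intro t
    rw [star_mul, star_mul, star_mul, star_mul, hSs, hB.2.2.1, star_star]
    simp only [mul_assoc]
  · intro t
    exact h.conj_ent hX hSP (by linarith) hb (hB.2.2.2 t)
  · refine ⟨fun _ => S * star Th, fun _ => 0, fun _ => (Th * A' - (Y + Zb) * Th) * S, fun _ => hW,
      fun _ => rfl, strongC1_of_hasDerivAt (fun t => hasDerivAt_const t _) continuous_const,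
      fun _ => by rw [hstar]; exact hK, fun t => ?_⟩
    rw [hstar, zero_mul, smul_zero, add_zero, hN]
    noncomm_ring

end finalstep

/-- Corollary 6.1: combination of the anti-adiabatic transform and the
progressive diagonalization, transforming `D + H + Y + Z(t)` into `D + H + A + B(t)`. -/
theorem statement5
    (P : ℕ+ → 𝓗 →L[ℂ] 𝓗) (hP : ProjFamily P)
    (E : ℕ+ → ℝ) (hEmono : StrictMono E)
    (γ cH CH : ℝ) (hγ0 : 0 < γ) (hγh : γ < 1 / 2) (hcH : 0 < cH) (hcC : cH ≤ CH)
    (hgap : ∀ m n : ℕ+,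
      cH * |((m : ℕ) : ℝ) - ((n : ℕ) : ℝ)| / (((max m n : ℕ+) : ℕ) : ℝ) ^ (2 * γ)
          ≤ |E m - E n| ∧
      |E m - E n|
          ≤ CH * |((m : ℕ) : ℝ) - ((n : ℕ) : ℝ)| / (((max m n : ℕ+) : ℕ) : ℝ) ^ (2 * γ))
    (r : ℝ) (hr : 2 < r) (k : ℕ) (hk : 1 ≤ k) (T : ℝ) (hT : 0 < T)
    (Y : 𝓗 →L[ℂ] 𝓗) (hYsa : IsSelfAdjoint Y) (hYd : IsDiag P Y)
    (y : ℝ) (hY : ∀ n : ℕ+, ((n : ℕ) : ℝ) ^ (2 * γ) * ‖Y.comp (P n)‖ ≤ y)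
    (Z : ℝ → 𝓗 →L[ℂ] 𝓗) (hZper : ∀ t, Z (t + T) = Z t)
    (hZsa : ∀ t, IsSelfAdjoint (Z t)) (hZc1 : StrongC1 Z)
    (z : ℝ) (hZ : ∀ (t : ℝ) (m n : ℕ+), wnorm P r ((k : ℝ) * γ) (Z t) m n ≤ z)
    (hsmall : y + z ≤ cH / (4 * Real.pi * Cconst (r + 1))) :
    ∃ (𝒰 : ℝ → 𝓗 →L[ℂ] 𝓗) (A : 𝓗 →L[ℂ] 𝓗) (B : ℝ → 𝓗 →L[ℂ] 𝓗),
      (∀ t, IsUnitaryOp (𝒰 t)) ∧ (∀ t, 𝒰 (t + T) = 𝒰 t) ∧ StrongC1 𝒰 ∧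
      IsSelfAdjoint A ∧ IsDiag P A ∧
      (∀ n : ℕ+, ((n : ℕ) : ℝ) ^ (2 * γ) * ‖A.comp (P n)‖ ≤ 2 * (y + z)) ∧
      (∀ t, B (t + T) = B t) ∧ (∀ t, IsSelfAdjoint (B t)) ∧ StrongC1 B ∧
      (∀ (t : ℝ) (m n : ℕ+),
        wnorm P (r - 1) (((k : ℝ) + 1) * γ) (B t) m n ≤
          1 / (2 * Cconst r) * Real.exp (2 * Cconst r / Cconst (r + 1)) *
            (Real.exp (4 * Cconst r * T * z) - 1) *
            (CH + 4 * y + 2 * Cconst r * z)) ∧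
      (∀ t : ℝ, ⇑(star (𝒰 t)) '' HDom P E = HDom P E) ∧
      (∀ t : ℝ, ∀ ψ ∈ HDom P E, ∀ h₁ h₂ : 𝓗,
        IsHSum P E ψ h₁ → IsHSum P E (star (𝒰 t) ψ) h₂ →
        h₁ + A ψ + B t ψ =
          𝒰 t (h₂ + Y (star (𝒰 t) ψ) + Z t (star (𝒰 t) ψ)) +
            Complex.I • deriv (fun τ => 𝒰 τ (star (𝒰 t) ψ)) t) := by
  obtain ⟨j, rfl⟩ : ∃ j, k = j + 1 := ⟨k - 1, by omega⟩
  have hy : 0 ≤ y := le_trans (by positivity) (hY 1)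
  have hjap : ∀ x : ℝ, 0 ≤ jap x := fun x => le_trans zero_le_one (le_max_left _ _)
  have hz : 0 ≤ z := by
    refine le_trans ?_ (hZ 0 1 1)
    unfold wnorm
    have := Real.rpow_nonneg (hjap (((1 : ℕ+) : ℕ) - ((1 : ℕ+) : ℕ) : ℝ)) r
    positivity
  have hCH : 0 ≤ CH := by linarith
  have hr1 : 1 < r := by linarith
  have hUE : UGap E γ CH := by
    intro m n
    refine le_trans (hgap m n).2 ?_
    rw [div_eq_mul_inv]
    have := mxu_pos hγ0 m n
    exact mul_le_mul_of_nonneg_right (mul_le_mul_of_nonneg_left (abs_le_jd m n) hCH)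
      (inv_nonneg.2 this.le)
  have hLE : ∀ m n, m ≠ n → cH * jd m n * (mxu γ m n)⁻¹ ≤ |E m - E n| := by
    intro m n hmn
    have := (hgap m n).1
    rw [jd_eq_abs hmn, div_eq_mul_inv] at this
    exact this
  have hYD : DiagB P γ y Y := by
    refine ⟨fun m n hmn => ?_, fun n => ?_⟩
    · rw [mul_assoc]; exact hYd m n hmn
    · have h1 := hY n
      have h2 := mxu_pos hγ0 n n
      rw [← mxu_self] at h1
      rw [← div_eq_mul_inv, le_div_iff₀ h2, mul_comm]
      exact h1
  have hZE : ∀ t, Ent P r (wZ γ j) z (Z t) := fun t m n => (ent_iff hγ0 (j := j + 1) m n).1 (hZ t m n)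
  obtain ⟨Zb, F, C, Cd, hZbs, hZb, hFd, hFper, hFs, hF, hFC, hCd, hCdc⟩ :=
    exists_FC hP hγ0 hUE hr hCH hz hT hZE hZper (fun t => (hZsa t).star_eq) hZc1.continuous
  have hFCD : FCD P E γ CH j r T y z (T / 2 * z) Y Zb Z F C Cd :=
    { hP := hP, hγ := hγ0, hγh := hγh, hE := hUE, hr := hr, hCH := hCH, hz := hz, hy := hy,
      hf := by positivity, hT := hT, hYs := hYsa.star_eq, hYd := hYD, hZ := hZE, hZper := hZper,
      hZs := fun t => (hZsa t).star_eq, hZc := hZc1, hZbs := hZbs, hZb := hZb, hFd := hFd,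
      hFper := hFper, hFs := hFs, hF := hF, hFC := hFC, hCd := hCd, hCdc := hCdc }
  obtain ⟨B, hB, hG⟩ := anti_adiabatic hFCD rfl
  have hDp := Dc_pos hr1
  have hC : Cconst (r + 1) = 2 * Dc r := by rw [Cconst_eq, add_sub_cancel_right]
  have hCr : 0 < Cconst r := by
    rw [Cconst_eq]; have := Dc_pos (p := r - 1) (by linarith); positivity
  have hpi := Real.pi_gt_three
  have hFP : FP P E γ cH j r y z ((y + z) / cH) Y Zb :=
    { hP := hP, hγ := hγ0, hγh := hγh, hcH := hcH, hE := hLE, hr := hr, hy := hy, hz := hz,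
      he := by positivity
      hyz := le_of_eq (by field_simp)
      hDe := by
        rw [hC, le_div_iff₀ (by positivity)] at hsmall
        rw [← mul_div_assoc, div_le_iff₀ hcH]
        have : 0 ≤ Dc r * (y + z) := by positivity
        nlinarith
      hYs := hYsa.star_eq, hYd := hYD, hZbs := hZbs, hZb := hZb }
  have hb : 0 ≤ 1 / (2 * Cconst r) * (Real.exp (4 * Cconst r * T * z) - 1) *
            (CH + 4 * y + 2 * Cconst r * z) := by
    have : 1 ≤ Real.exp (4 * Cconst r * T * z) := Real.one_le_exp (by positivity)
    have h2 : 0 ≤ Real.exp (4 * Cconst r * T * z) - 1 := by linarith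
    positivity
  obtain ⟨A, B', hAs, hAd, hB', hG'⟩ := hFP.diagonalize hb hB
  obtain ⟨U, u1, u2, u3, u4, u5⟩ := (hG.trans hP hG').final hP
  refine ⟨U, A, B', u1, u2, u3, hAs, fun m n hmn => ?_, fun n => ?_, hB'.2.1, hB'.2.2.1, hB'.1,
    fun t m n => ?_, u4, fun t ψ hψ h₁ h₂ H1 H2 => ?_⟩
  · have := hAd.1 m n hmn
    rw [mul_assoc] at this
    exact this
  · have h1 := hAd.2 n
    have h2 := mxu_pos hγ0 n n
    rw [← div_eq_mul_inv, le_div_iff₀ h2, mul_comm, mxu_self] at h1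
    exact h1
  · have h1 := hB'.2.2.2 t m n
    have h2 := (ent_iff hγ0 (j := j + 2) m n).2 h1
    have e1 : ((((j + 1 : ℕ) : ℝ)) + 1) = ((j + 2 : ℕ) : ℝ) := by push_cast; ring
    rw [e1]
    exact le_trans h2 (le_of_eq (by ring))
  · have := u5 t ψ hψ h₁ h₂ H1 H2
    simp only [ContinuousLinearMap.add_apply] at this
    rw [add_assoc, this, add_assoc h₂]

end
end

section
/- Suppose the real sequence (E_n)_{n≥1} satisfies |E_m − E_n| ≤ C_H·|m−n|/max{m,n}^{2γ} for all m,n ≥ 1, for some γ > 0 and C_H > 0. Let p > 2, δ ≥ 0, and let A be a bounded operator with ‖A‖_{p,δ} < ∞. Then for all m,n ≥ 1: ⟨m−n⟩^{p−1}·max{m,n}^{2(δ+γ)}·|E_m − E_n|·‖A_{m,n}‖ ≤ C_H·‖A‖_{p,δ}. In particular, the operator with blocks ([A,H])_{m,n} = (E_n − E_m)A_{m,n} (the commutator of A with H := Σ_n E_n P_n) satisfies ‖[A,H]‖_{p−1,δ+γ} ≤ C_H·‖A‖_{p,δ}. -/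
noncomputable section

open ContinuousLinearMap

variable {𝓗 : Type*} [NormedAddCommGroup 𝓗] [InnerProductSpace ℂ 𝓗] [CompleteSpace 𝓗]

/-- Lemma 2.1: if `A ∈ 𝒴(p,δ)` then `[A,H] ∈ 𝒴(p-1,δ+γ)` with
`‖[A,H]‖_{p-1,δ+γ} ≤ C_H ‖A‖_{p,δ}`. -/
theorem statement6
    (P : ℕ+ → 𝓗 →L[ℂ] 𝓗) (hP : ProjFamily P)
    (E : ℕ+ → ℝ) (γ CH : ℝ) (hγ0 : 0 < γ) (hCH : 0 < CH)
    (hgap : ∀ m n : ℕ+,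
      |E m - E n|
        ≤ CH * |((m : ℕ) : ℝ) - ((n : ℕ) : ℝ)| / (((max m n : ℕ+) : ℕ) : ℝ) ^ (2 * γ))
    (p δ : ℝ) (hp : 2 < p) (hδ : 0 ≤ δ)
    (A : 𝓗 →L[ℂ] 𝓗) (a : ℝ) (hA : ∀ m n : ℕ+, wnorm P p δ A m n ≤ a) :
    (∀ m n : ℕ+,
      jap (((m : ℕ) : ℝ) - ((n : ℕ) : ℝ)) ^ (p - 1) *
          (((max m n : ℕ+) : ℕ) : ℝ) ^ (2 * (δ + γ)) * |E m - E n| *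
          ‖(P m).comp (A.comp (P n))‖ ≤ CH * a) ∧
    (∀ B : 𝓗 →L[ℂ] 𝓗,
      (∀ m n : ℕ+, (P m).comp (B.comp (P n)) =
        ((E n - E m : ℝ) : ℂ) • (P m).comp (A.comp (P n))) →
      ∀ m n : ℕ+, wnorm P (p - 1) (δ + γ) B m n ≤ CH * a) := by
  have key : ∀ m n : ℕ+,
      jap (((m : ℕ) : ℝ) - ((n : ℕ) : ℝ)) ^ (p - 1) *
          (((max m n : ℕ+) : ℕ) : ℝ) ^ (2 * (δ + γ)) * |E m - E n| *
          ‖(P m).comp (A.comp (P n))‖ ≤ CH * a := by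
    intro m n
    have h1 := hA m n
    have h2 := hgap m n
    unfold wnorm at h1
    have hM : (0 : ℝ) < (((max m n : ℕ+) : ℕ) : ℝ) := by
      exact_mod_cast (max m n).pos
    generalize (((max m n : ℕ+) : ℕ) : ℝ) = M at *
    generalize (((m : ℕ) : ℝ) - ((n : ℕ) : ℝ)) = x at *
    have hN : 0 ≤ ‖(P m).comp (A.comp (P n))‖ := norm_nonneg _
    generalize ‖(P m).comp (A.comp (P n))‖ = N at *
    have hj : 0 < jap x := lt_of_lt_of_le one_pos (le_max_left _ _)
    have hx : |x| ≤ jap x := le_max_right _ _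
    have hMγ : 0 < M ^ (2 * γ) := Real.rpow_pos_of_pos hM _
    have hMδ : 0 < M ^ (2 * δ) := Real.rpow_pos_of_pos hM _
    have hjp : 0 < jap x ^ (p - 1) := Real.rpow_pos_of_pos hj _
    have e1 : M ^ (2 * (δ + γ)) = M ^ (2 * δ) * M ^ (2 * γ) := by
      rw [← Real.rpow_add hM]; ring_nf
    have e2 : jap x ^ p = jap x ^ (p - 1) * jap x := by
      rw [← Real.rpow_add_one hj.ne']; ring_nf
    rw [e2] at h1
    rw [e1]
    rw [le_div_iff₀ hMγ] at h2
    have h3 : |E m - E n| * M ^ (2 * γ) ≤ CH * jap x :=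
      h2.trans (mul_le_mul_of_nonneg_left hx hCH.le)
    calc _ = (jap x ^ (p - 1) * M ^ (2 * δ) * N) * (|E m - E n| * M ^ (2 * γ)) := by ring
      _ ≤ (jap x ^ (p - 1) * M ^ (2 * δ) * N) * (CH * jap x) :=
          mul_le_mul_of_nonneg_left h3 (by positivity)
      _ = CH * (jap x ^ (p - 1) * jap x * M ^ (2 * δ) * N) := by ring
      _ ≤ CH * a := mul_le_mul_of_nonneg_left h1 hCH.le
  refine ⟨key, fun B hB m n => ?_⟩
  have h := key m n
  unfold wnorm
  rw [hB, norm_smul, Complex.norm_real, Real.norm_eq_abs, abs_sub_comm, ← mul_assoc]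
  exact h

end
end
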